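/- Fix an integer e ≥ 2 and κ = (κ₁, κ₂) ∈ (ℤ/eℤ)². Suppose λ is a bipartition with wt(λ) = 1. Then λ is restricted (with respect to e and κ) if and only if there exists a bipartition μ with the same content as λ such that λ does not dominate μ. -/

import Mathlib

namespace Wt3

/-- `f : ℕ → ℕ` (0-indexed: `f r` is the `(r+1)`-th part `λ_{r+1}`) is a partition if it is
weakly decreasing with finitely many nonzero terms. -/
def IsPartition (f : ℕ → ℕ) : Prop :=
  (∀ r, f (r + 1) ≤ f r) ∧ ∃ N, ∀ r, N ≤ r → f r = 0

/-- A bipartition: an ordered pair of partitions, given as `lam : Fin 2 → ℕ → ℕ`. -/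
def IsBipartition (lam : Fin 2 → ℕ → ℕ) : Prop := ∀ a, IsPartition (lam a)

/-- Nodes `(r, c, a)` with 0-indexed row `r`, column `c`, and component `a : Fin 2`. -/
abbrev Node := ℕ × ℕ × Fin 2

/-- The Young diagram of a bipartition: `(r,c,a)` is a node iff `c < λ⁽ᵃ⁾_r` (0-indexed,
corresponding to `c+1 ≤ λ⁽ᵃ⁾_{r+1}` in 1-indexed terms). -/
def Diagram (lam : Fin 2 → ℕ → ℕ) : Set Node := {x | x.2.1 < lam x.2.2 x.1}

/-- A node of `[λ]` is removable if deleting it leaves the Young diagram of a bipartition. -/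
def IsRemovable (lam : Fin 2 → ℕ → ℕ) (x : Node) : Prop :=
  x ∈ Diagram lam ∧ ∃ mu, IsBipartition mu ∧ Diagram mu = Diagram lam \ {x}

/-- A node not in `[λ]` is addable if adding it gives the Young diagram of a bipartition. -/
def IsAddable (lam : Fin 2 → ℕ → ℕ) (x : Node) : Prop :=
  x ∉ Diagram lam ∧ ∃ mu, IsBipartition mu ∧ Diagram mu = Diagram lam ∪ {x}

/-- The residue `c − r + κ_a ∈ ℤ/eℤ` of a node `(r,c,a)` (0-indexing leaves this unchanged). -/
def res (e : ℕ) (κ : Fin 2 → ZMod e) (x : Node) : ZMod e :=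
  (x.2.1 : ZMod e) - (x.1 : ZMod e) + κ x.2.2

/-- `c_i(λ)`: the number of `i`-nodes of `λ`. -/
noncomputable def cnt (e : ℕ) (κ : Fin 2 → ZMod e) (lam : Fin 2 → ℕ → ℕ) (i : ZMod e) : ℕ :=
  Set.ncard {x : Node | x ∈ Diagram lam ∧ res e κ x = i}

/-- The number of removable `i`-nodes of `λ`. -/
noncomputable def remCount (e : ℕ) (κ : Fin 2 → ZMod e) (lam : Fin 2 → ℕ → ℕ) (i : ZMod e) : ℕ :=
  Set.ncard {x : Node | IsRemovable lam x ∧ res e κ x = i}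

/-- The number of addable `i`-nodes of `λ`. -/
noncomputable def addCount (e : ℕ) (κ : Fin 2 → ZMod e) (lam : Fin 2 → ℕ → ℕ) (i : ZMod e) : ℕ :=
  Set.ncard {x : Node | IsAddable lam x ∧ res e κ x = i}

/-- `δ_i(λ)`: number of removable `i`-nodes minus number of addable `i`-nodes. -/
noncomputable def delta (e : ℕ) (κ : Fin 2 → ZMod e) (lam : Fin 2 → ℕ → ℕ) (i : ZMod e) : ℤ :=
  (remCount e κ lam i : ℤ) - (addCount e κ lam i : ℤ)

/-- The weight `wt(λ) = c_{κ₁}(λ) + c_{κ₂}(λ) − ½ Σ_{i ∈ ℤ/eℤ} (c_i(λ) − c_{i+1}(λ))²`. -/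
noncomputable def wt (e : ℕ) (κ : Fin 2 → ZMod e) (lam : Fin 2 → ℕ → ℕ) : ℚ :=
  (cnt e κ lam (κ 0) : ℚ) + (cnt e κ lam (κ 1) : ℚ) -
    (1 / 2) * ∑ j ∈ Finset.range e,
      ((cnt e κ lam (j : ZMod e) : ℚ) - (cnt e κ lam ((j : ZMod e) + 1) : ℚ)) ^ 2

/-- The rim of `λ`: nodes `(r,c,a) ∈ [λ]` with `(r+1,c+1,a) ∉ [λ]`. -/
def Rim (lam : Fin 2 → ℕ → ℕ) : Set Node :=
  {x | x ∈ Diagram lam ∧ (x.1 + 1, x.2.1 + 1, x.2.2) ∉ Diagram lam}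

/-- One step along a strip: `y` is one step to the right of, or one step above, `x`
(in the same component). -/
def Step (x y : Node) : Prop :=
  y.2.2 = x.2.2 ∧ ((y.1 = x.1 ∧ y.2.1 = x.2.1 + 1) ∨ (x.1 = y.1 + 1 ∧ y.2.1 = x.2.1))

/-- A rim hook of `λ`: a nonempty subset of the rim, contained in a single component,
forming a connected strip, whose removal leaves the Young diagram of a bipartition. -/
def IsRimHook (lam : Fin 2 → ℕ → ℕ) (H : Finset Node) : Prop :=
  H.Nonempty ∧ ↑H ⊆ Rim lam ∧ (∀ x ∈ H, ∀ y ∈ H, x.2.2 = y.2.2) ∧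
    (∃ l : List Node, l.Chain' Step ∧ ∀ x : Node, x ∈ l ↔ x ∈ H) ∧
    ∃ mu, IsBipartition mu ∧ Diagram mu = Diagram lam \ ↑H

/-- A bicore: a bipartition with no rim `e`-hooks. -/
def IsBicore (e : ℕ) (lam : Fin 2 → ℕ → ℕ) : Prop :=
  ¬ ∃ H : Finset Node, IsRimHook lam H ∧ H.card = e

/-- The beta-set `{λ_r + k − r : 1 ≤ r ≤ k}` of a partition with charge `k` (0-indexed form). -/
def betaSet (f : ℕ → ℕ) (k : ℕ) : Finset ℕ :=
  (Finset.range k).image fun r => f r + (k - (r + 1))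

/-- The number of nonzero parts of a partition. -/
noncomputable def len (f : ℕ → ℕ) : ℕ := Set.ncard {r : ℕ | f r ≠ 0}

/-- `(k₁,k₂)` is a bicharge for `κ` relative to `λ`. -/
def IsBicharge (e : ℕ) (κ : Fin 2 → ZMod e) (lam : Fin 2 → ℕ → ℕ) (k₁ k₂ : ℕ) : Prop :=
  (k₁ : ZMod e) = κ 0 ∧ (k₂ : ZMod e) = κ 1 ∧ len (lam 0) ≤ k₁ ∧ len (lam 1) ≤ k₂

/-- `γ_x(λ)`: beads of residue `x` in the first beta-set minus those in the second. -/
def gamma (e : ℕ) (lam : Fin 2 → ℕ → ℕ) (k₁ k₂ : ℕ) (x : ZMod e) : ℤ :=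
  (((betaSet (lam 0) k₁).filter fun b : ℕ => (b : ZMod e) = x).card : ℤ) -
    (((betaSet (lam 1) k₂).filter fun b : ℕ => (b : ZMod e) = x).card : ℤ)

/-- `x` is above (higher than) `y`. -/
def Above (x y : Node) : Prop := x.2.2 < y.2.2 ∨ (x.2.2 = y.2.2 ∧ x.1 < y.1)

/-- A normal `i`-node: a removable `i`-node `x` such that for every addable `i`-node `y`
below `x`, the removable `i`-nodes strictly between `x` and `y` outnumber the addable ones
(equivalently, the `−` sign of `x` survives in the reduced `i`-signature). -/
def IsNormal (e : ℕ) (κ : Fin 2 → ZMod e) (lam : Fin 2 → ℕ → ℕ) (i : ZMod e) (x : Node) :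
    Prop :=
  IsRemovable lam x ∧ res e κ x = i ∧
    ∀ y : Node, IsAddable lam y → res e κ y = i → Above x y →
      Set.ncard {z : Node | IsAddable lam z ∧ res e κ z = i ∧ Above x z ∧ Above z y} <
        Set.ncard {z : Node | IsRemovable lam z ∧ res e κ z = i ∧ Above x z ∧ Above z y}

/-- The good `i`-node: the highest normal `i`-node. -/
def IsGood (e : ℕ) (κ : Fin 2 → ZMod e) (lam : Fin 2 → ℕ → ℕ) (i : ZMod e) (x : Node) :
    Prop :=
  IsNormal e κ lam i x ∧ ∀ y, IsNormal e κ lam i y → y = x ∨ Above x y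

/-- An antinormal `i`-node: a removable `i`-node `x` such that for every addable `i`-node `y`
above `x`, the removable `i`-nodes strictly between `y` and `x` outnumber the addable ones
(equivalently, the `−` sign of `x` survives in the antireduced `i`-signature). -/
def IsAntinormal (e : ℕ) (κ : Fin 2 → ZMod e) (lam : Fin 2 → ℕ → ℕ) (i : ZMod e) (x : Node) :
    Prop :=
  IsRemovable lam x ∧ res e κ x = i ∧
    ∀ y : Node, IsAddable lam y → res e κ y = i → Above y x →
      Set.ncard {z : Node | IsAddable lam z ∧ res e κ z = i ∧ Above y z ∧ Above z x} <
        Set.ncard {z : Node | IsRemovable lam z ∧ res e κ z = i ∧ Above y z ∧ Above z x}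

/-- The antigood `i`-node: the lowest antinormal `i`-node. -/
def IsAntigood (e : ℕ) (κ : Fin 2 → ZMod e) (lam : Fin 2 → ℕ → ℕ) (i : ZMod e) (x : Node) :
    Prop :=
  IsAntinormal e κ lam i x ∧ ∀ y, IsAntinormal e κ lam i y → y = x ∨ Above y x

/-- `μ →ᵢ λ`: `μ` is obtained from `λ` by removing the good `i`-node. -/
def RemGoodAt (e : ℕ) (κ : Fin 2 → ZMod e) (i : ZMod e) (mu lam : Fin 2 → ℕ → ℕ) : Prop :=
  ∃ x, IsGood e κ lam i x ∧ Diagram mu = Diagram lam \ {x}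

/-- `μ ⇒ᵢ λ`: `μ` is obtained from `λ` by removing the antigood `i`-node. -/
def RemAntigoodAt (e : ℕ) (κ : Fin 2 → ZMod e) (i : ZMod e) (mu lam : Fin 2 → ℕ → ℕ) : Prop :=
  ∃ x, IsAntigood e κ lam i x ∧ Diagram mu = Diagram lam \ {x}

/-- `μ → λ`: `μ` is obtained from the bipartition `λ` by removing a good node. -/
def RemGood (e : ℕ) (κ : Fin 2 → ZMod e) (mu lam : Fin 2 → ℕ → ℕ) : Prop :=
  IsBipartition mu ∧ IsBipartition lam ∧ ∃ i, RemGoodAt e κ i mu lam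

/-- A bipartition is restricted if it lies in the class of the empty bipartition under the
equivalence relation generated by `→`. -/
def IsRestricted (e : ℕ) (κ : Fin 2 → ZMod e) (lam : Fin 2 → ℕ → ℕ) : Prop :=
  Relation.EqvGen (RemGood e κ) lam (fun _ _ => 0)

/-- A partition is `e`-restricted if `λ_r − λ_{r+1} < e` for all `r`. -/
def IsERestricted (e : ℕ) (f : ℕ → ℕ) : Prop := ∀ r, f r < f (r + 1) + e

/-- The conjugate partition: `λ′_r = #{c : λ_c ≥ r}` (0-indexed form). -/
noncomputable def conjP (f : ℕ → ℕ) : ℕ → ℕ := fun r => Set.ncard {c : ℕ | r + 1 ≤ f c}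

/-- The conjugate bipartition `λ′ = ((λ⁽²⁾)′ | (λ⁽¹⁾)′)`. -/
noncomputable def conjB (lam : Fin 2 → ℕ → ℕ) : Fin 2 → ℕ → ℕ := fun a => conjP (lam (1 - a))

/-- `|λ|` for a partition. -/
noncomputable def psize (f : ℕ → ℕ) : ℕ := Set.ncard {p : ℕ × ℕ | p.2 < f p.1}

/-- `|λ|` for a bipartition. -/
noncomputable def bsize (lam : Fin 2 → ℕ → ℕ) : ℕ := psize (lam 0) + psize (lam 1)

/-- `λ_1 + ⋯ + λ_r`. -/
def psum (f : ℕ → ℕ) (r : ℕ) : ℕ := ∑ j ∈ Finset.range r, f j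

/-- The dominance order on bipartitions: `λ ⊵ μ`. -/
def Dominates (lam mu : Fin 2 → ℕ → ℕ) : Prop :=
  ∀ r : ℕ, psum (mu 0) r ≤ psum (lam 0) r ∧
    psize (mu 0) + psum (mu 1) r ≤ psize (lam 0) + psum (lam 1) r

/-! Single-partition versions (for statement 11). -/

abbrev Node1 := ℕ × ℕ

def Diagram1 (f : ℕ → ℕ) : Set Node1 := {x | x.2 < f x.1}

def IsRemovable1 (f : ℕ → ℕ) (x : Node1) : Prop :=
  x ∈ Diagram1 f ∧ ∃ g, IsPartition g ∧ Diagram1 g = Diagram1 f \ {x}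

def IsAddable1 (f : ℕ → ℕ) (x : Node1) : Prop :=
  x ∉ Diagram1 f ∧ ∃ g, IsPartition g ∧ Diagram1 g = Diagram1 f ∪ {x}

def res1 (e : ℕ) (k : ZMod e) (x : Node1) : ZMod e := (x.2 : ZMod e) - (x.1 : ZMod e) + k

def Rim1 (f : ℕ → ℕ) : Set Node1 := {x | x ∈ Diagram1 f ∧ (x.1 + 1, x.2 + 1) ∉ Diagram1 f}

def Step1 (x y : Node1) : Prop :=
  (y.1 = x.1 ∧ y.2 = x.2 + 1) ∨ (x.1 = y.1 + 1 ∧ y.2 = x.2)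

def IsRimHook1 (f : ℕ → ℕ) (H : Finset Node1) : Prop :=
  H.Nonempty ∧ ↑H ⊆ Rim1 f ∧
    (∃ l : List Node1, l.Chain' Step1 ∧ ∀ x : Node1, x ∈ l ↔ x ∈ H) ∧
    ∃ g, IsPartition g ∧ Diagram1 g = Diagram1 f \ ↑H

/-- An `e`-core: a partition with no rim `e`-hooks. -/
def IsECore (e : ℕ) (f : ℕ → ℕ) : Prop := ¬ ∃ H : Finset Node1, IsRimHook1 f H ∧ H.card = e

/-- A pair of bead sequences, both read from the highest position downwards. -/
abbrev Config := ℕ → Bool × Bool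

/-- The contribution to the signature of the adjacent positions with entries `a` (upper) and `b`
(lower): `1` if a bead can be moved down, `-1` if a bead can be moved up. -/
def sgn (a b : Bool) : ℤ := (if a then 1 else 0) - (if b then 1 else 0)

/-- The signature of residue `j`, the two components being interleaved. -/
def word (e : ℕ) (X : Config) (j t : ℕ) : ℤ :=
  if t % 2 = 0 then sgn (X (j + e * (t / 2))).1 (X (j + e * (t / 2) + 1)).1
  else sgn (X (j + e * (t / 2))).2 (X (j + e * (t / 2) + 1)).2

/-- Partial sums of the signature. -/
def height (e : ℕ) (X : Config) (j t : ℕ) : ℤ := ∑ s ∈ Finset.range t, word e X j s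

/-- `t` is the last point at which `F` attains its minimum. -/
def LastMin (F : ℕ → ℤ) (t : ℕ) : Prop := (∀ s < t, F t ≤ F s) ∧ ∀ s, t < s → F t < F s

/-- Entries `r₀, r₁` in adjacent positions become `s₀, s₁` when a bead is moved down, the
component being determined by the reduced signature of the two positions. -/
def BlockMove (r₀ r₁ s₀ s₁ : Bool × Bool) : Prop :=
  (r₀.1 = true ∧ r₁.1 = false ∧ ¬ (r₀.2 = false ∧ r₁.2 = true) ∧
    s₀ = (false, r₀.2) ∧ s₁ = (true, r₁.2)) ∨
  (r₀.2 = true ∧ r₁.2 = false ∧ ¬ (r₀.1 = true ∧ r₁.1 = false) ∧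
    s₀ = (r₀.1, false) ∧ s₁ = (r₁.1, true))

instance (r₀ r₁ s₀ s₁ : Bool × Bool) : Decidable (BlockMove r₀ r₁ s₀ s₁) := by
  unfold BlockMove; infer_instance

/-- The minimal partial sum of the signature of two adjacent positions. -/
def blockMin (r₀ r₁ : Bool × Bool) : ℤ :=
  min 0 (min (sgn r₀.1 r₁.1) (sgn r₀.1 r₁.1 + sgn r₀.2 r₁.2))

/-- The total of the signature of two adjacent positions. -/
def blockSum (r₀ r₁ : Bool × Bool) : ℤ := sgn r₀.1 r₁.1 + sgn r₀.2 r₁.2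

/-- The change made to `X` in moving the bead given by the entry `t` of the signature. -/
def IsShift (e : ℕ) (X Y : Config) (j t : ℕ) : Prop :=
  (∀ m, m ≠ j + e * (t / 2) → m ≠ j + e * (t / 2) + 1 → Y m = X m) ∧
  if t % 2 = 0 then
    Y (j + e * (t / 2)) = (false, (X (j + e * (t / 2))).2) ∧
      Y (j + e * (t / 2) + 1) = (true, (X (j + e * (t / 2) + 1)).2)
  else
    Y (j + e * (t / 2)) = ((X (j + e * (t / 2))).1, false) ∧
      Y (j + e * (t / 2) + 1) = ((X (j + e * (t / 2) + 1)).1, true)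

/-- `Y` is obtained from `X` by moving down the good bead of some residue. -/
def Move (e : ℕ) (X Y : Config) : Prop :=
  ∃ j < e, ∃ t, LastMin (height e X j) t ∧ IsShift e X Y j t

/-- The block of two adjacent positions singled out by the signature. -/
def BlockChoice (e : ℕ) (X : Config) (j k : ℕ) : Prop :=
  (∀ k' < k, height e X j (2 * k) + blockMin (X (j + e * k)) (X (j + e * k + 1)) ≤
    height e X j (2 * k') + blockMin (X (j + e * k')) (X (j + e * k' + 1))) ∧
  ∀ k', k < k' → height e X j (2 * k) + blockMin (X (j + e * k)) (X (j + e * k + 1)) <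
    height e X j (2 * k') + blockMin (X (j + e * k')) (X (j + e * k' + 1))

theorem height_odd (e : ℕ) (X : Config) (j k : ℕ) : height e X j (2 * k + 1) =
    height e X j (2 * k) + sgn (X (j + e * k)).1 (X (j + e * k + 1)).1 := by
  simp [height, Finset.sum_range_succ, word]

theorem height_even (e : ℕ) (X : Config) (j k : ℕ) : height e X j (2 * (k + 1)) =
    height e X j (2 * k) + blockSum (X (j + e * k)) (X (j + e * k + 1)) := by
  have h1 : (2 * k + 1) % 2 = 1 := by omega
  have h2 : (2 * k + 1) / 2 = k := by omega
  rw [show 2 * (k + 1) = 2 * k + 1 + 1 by ring, height, Finset.sum_range_succ, ← height,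
    height_odd]
  simp [word, h1, h2, blockSum, add_assoc]

theorem sgn_vals (a b : Bool) : sgn a b = 1 ∧ a = true ∧ b = false ∨
    sgn a b = -1 ∧ a = false ∧ b = true ∨ sgn a b = 0 ∧ a = b := by
  cases a <;> cases b <;> simp [sgn]

/-- The least partial sum of the signature met within the block `k`. -/
def level (e : ℕ) (X : Config) (j k : ℕ) : ℤ :=
  height e X j (2 * k) + blockMin (X (j + e * k)) (X (j + e * k + 1))

theorem level_spec (e : ℕ) (X : Config) (j k : ℕ) :
    level e X j k = min (height e X j (2 * k))
      (min (height e X j (2 * k + 1)) (height e X j (2 * k + 2))) := by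
  have h := height_even e X j k
  rw [show 2 * (k + 1) = 2 * k + 2 by ring] at h
  rw [level, h, height_odd, blockMin, blockSum]
  omega

theorem lastMin_block {e : ℕ} {X : Config} {j t : ℕ} (h : LastMin (height e X j) t) :
    BlockChoice e X j (t / 2) := by
  obtain ⟨hlt, hgt⟩ := h
  have key : ∀ s, height e X j t ≤ height e X j s := fun s => by
    rcases lt_trichotomy s t with h | rfl | h
    · exact hlt s h
    · exact le_rfl
    · exact (hgt s h).le
  have hl : level e X j (t / 2) = height e X j t := by
    rw [level_spec]
    have h0 := key (2 * (t / 2))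
    have h1 := key (2 * (t / 2) + 1)
    have h2 := key (2 * (t / 2) + 2)
    rcases Nat.mod_two_eq_zero_or_one t with ht | ht
    · rw [show 2 * (t / 2) = t by omega] at *; omega
    · rw [show 2 * (t / 2) + 1 = t by omega] at *; omega
  change (∀ k' < t / 2, level e X j (t / 2) ≤ level e X j k') ∧
    ∀ k', t / 2 < k' → level e X j (t / 2) < level e X j k'
  constructor
  · intro k _
    rw [hl, level_spec]
    exact le_min (key _) (le_min (key _) (key _))
  · intro k hk
    rw [hl, level_spec]
    exact lt_min (hgt _ (by omega)) (lt_min (hgt _ (by omega)) (hgt _ (by omega)))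

theorem block_lastMin {e : ℕ} {X : Config} {j t : ℕ} (h : BlockChoice e X j (t / 2))
    (h0 : height e X j t ≤ height e X j (2 * (t / 2)))
    (h1 : height e X j t ≤ height e X j (2 * (t / 2) + 1))
    (h2 : height e X j t < height e X j (2 * (t / 2) + 2))
    (h3 : t % 2 = 0 → height e X j t < height e X j (2 * (t / 2) + 1)) :
    LastMin (height e X j) t := by
  change (∀ k' < t / 2, level e X j (t / 2) ≤ level e X j k') ∧
    ∀ k', t / 2 < k' → level e X j (t / 2) < level e X j k' at h
  obtain ⟨hlt, hgt⟩ := h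
  have hl : level e X j (t / 2) = height e X j t := by
    rw [level_spec]
    rcases Nat.mod_two_eq_zero_or_one t with ht | ht
    · rw [show 2 * (t / 2) = t by omega] at *; omega
    · rw [show 2 * (t / 2) + 1 = t by omega] at *; omega
  have low : ∀ s, level e X j (s / 2) ≤ height e X j s := fun s => by
    rw [level_spec]
    rcases Nat.mod_two_eq_zero_or_one s with hs | hs
    · rw [show 2 * (s / 2) = s by omega]; omega
    · rw [show 2 * (s / 2) + 1 = s by omega]; omega
  constructor
  · intro s hs
    rcases lt_or_eq_of_le (Nat.div_le_div_right (c := 2) hs.le) with h | h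
    · rw [← hl]; exact (hlt _ h).trans (low s)
    · have : s = 2 * (t / 2) := by omega
      rw [this]; exact h0
  · intro s hs
    rcases lt_or_eq_of_le (Nat.div_le_div_right (c := 2) hs.le) with h | h
    · rw [← hl]; exact (hgt _ h).trans_le (low s)
    · have : s = 2 * (t / 2) + 1 := by omega
      rw [this]; exact h3 (by omega)

theorem sgn_one {a b : Bool} (ha : a = true) (hb : b = false) : sgn a b = 1 := by
  simp [sgn, ha, hb]

theorem move_iff (e : ℕ) (X Y : Config) : Move e X Y ↔ ∃ j < e, ∃ k, BlockChoice e X j k ∧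
    BlockMove (X (j + e * k)) (X (j + e * k + 1)) (Y (j + e * k)) (Y (j + e * k + 1)) ∧
    ∀ m, m ≠ j + e * k → m ≠ j + e * k + 1 → Y m = X m := by
  unfold Move
  refine exists_congr fun j => and_congr_right fun _ => ?_
  constructor
  · rintro ⟨t, hl, hm, hs⟩
    refine ⟨t / 2, lastMin_block hl, ?_, hm⟩
    obtain ⟨hlt, hgt⟩ := hl
    have o := height_odd e X j (t / 2)
    have v := height_even e X j (t / 2)
    rw [blockSum] at v
    have s1 := sgn_vals (X (j + e * (t / 2))).1 (X (j + e * (t / 2) + 1)).1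
    have s2 := sgn_vals (X (j + e * (t / 2))).2 (X (j + e * (t / 2) + 1)).2
    rcases Nat.mod_two_eq_zero_or_one t with ht | ht
    · rw [if_pos ht] at hs
      have h1 := hgt (2 * (t / 2) + 1) (by omega)
      have h2 := hgt (2 * (t / 2 + 1)) (by omega)
      rw [v] at h2
      rw [o] at h1
      rw [show 2 * (t / 2) = t by omega] at h1 h2
      left
      rcases s1 with s1 | s1 | s1
      · refine ⟨s1.2.1, s1.2.2, ?_, hs.1, hs.2⟩
        rintro ⟨ha, hb⟩
        rw [s1.1, ha, hb] at h2
        simp [sgn] at h2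
      · omega
      · omega
    · rw [if_neg (by omega)] at hs
      have h1 := hgt (2 * (t / 2 + 1)) (by omega)
      have h2 := hlt (2 * (t / 2)) (by omega)
      rw [v, ← add_assoc, ← o] at h1
      rw [show 2 * (t / 2) + 1 = t by omega] at h1 o
      right
      rcases s2 with s2 | s2 | s2
      · refine ⟨s2.2.1, s2.2.2, ?_, hs.1, hs.2⟩
        rintro ⟨ha, hb⟩
        rw [ha, hb] at o
        simp [sgn] at o
        omega
      · omega
      · omega
  · rintro ⟨k, hc, hb, hm⟩
    have o := height_odd e X j k
    have v := height_even e X j k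
    rw [blockSum, show 2 * (k + 1) = 2 * k + 2 by ring] at v
    have s1 := sgn_vals (X (j + e * k)).1 (X (j + e * k + 1)).1
    have s2 := sgn_vals (X (j + e * k)).2 (X (j + e * k + 1)).2
    rcases hb with ⟨a1, a2, a3, a4, a5⟩ | ⟨a1, a2, a3, a4, a5⟩
    · have d : 2 * k / 2 = k := by omega
      refine ⟨2 * k, block_lastMin (by rwa [d]) ?_ ?_ ?_ ?_, ?_⟩
      · rw [d]
      · rw [d]; have := sgn_one a1 a2; omega
      · rw [d]; have := sgn_one a1 a2
        rcases s2 with s2 | s2 | s2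
        · omega
        · exact absurd s2.2 a3
        · omega
      · rw [d]; have := sgn_one a1 a2; omega
      · refine ⟨by rwa [d], ?_⟩
        rw [if_pos (by omega), d]; exact ⟨a4, a5⟩
    · have d : (2 * k + 1) / 2 = k := by omega
      refine ⟨2 * k + 1, block_lastMin (by rwa [d]) ?_ ?_ ?_ ?_, ?_⟩
      · rw [d]
        rcases s1 with s1 | s1 | s1
        · exact absurd s1.2 a3
        · omega
        · omega
      · rw [d]
      · rw [d]; have := sgn_one a1 a2; omega
      · omega
      · refine ⟨by rwa [d], ?_⟩
        rw [if_neg (by omega), d]; exact ⟨a4, a5⟩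

/-- The number of unmatched entries `(false, true)` after a further entry has been read. -/
def nxt (q : ℕ) (r : Bool × Bool) : ℕ :=
  if r = (true, false) then q - 1 else if r = (false, true) then q + 1 else q

/-- An entry `(true, false)` which cannot be matched is interchanged. -/
def out (q : ℕ) (r : Bool × Bool) : Bool × Bool :=
  if r = (true, false) ∧ q = 0 then (false, true) else r

/-- `1` if the entry `r` is unmatched when read in state `q`. -/
def conv (q : ℕ) (r : Bool × Bool) : ℕ := if r = (true, false) ∧ q = 0 then 1 else 0

/-- The number of entries `(false, true)` pending after reading the first `n` entries. -/
def pending (X : Config) : ℕ → ℕ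
  | 0 => 0
  | n + 1 => nxt (pending X n) (X n)

/-- The number of entries `(true, false)` which are unmatched among the first `n`. -/
def unmatched (X : Config) : ℕ → ℕ
  | 0 => 0
  | n + 1 => unmatched X n + conv (pending X n) (X n)

/-- The crossing of the two components: unmatched entries are interchanged. -/
def cross (X : Config) : Config := fun n => out (pending X n) (X n)

theorem out_min (q : ℕ) (r : Bool × Bool) : out q r = out (min q 1) r ∧ out q r = out (min q 2) r := by
  have h1 : min q 1 = 0 ↔ q = 0 := by omega
  have h2 : min q 2 = 0 ↔ q = 0 := by omega
  simp only [out, h1, h2, and_self]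

theorem out_nxt_min (q : ℕ) (r r' : Bool × Bool) : out (nxt q r) r' = out (nxt (min q 2) r) r' := by
  have h : nxt q r = 0 ↔ nxt (min q 2) r = 0 := by
    unfold nxt; rcases q with _ | _ | q <;> split_ifs <;> simp
  simp only [out, h]

theorem block_cross (q : ℕ) (r₀ r₁ : Bool × Bool) :
    blockSum (out q r₀) (out (nxt q r₀) r₁) = blockSum r₀ r₁ ∧
    blockMin (out q r₀) (out (nxt q r₀) r₁) = blockMin r₀ r₁ := by
  rw [(out_min q r₀).2, out_nxt_min]
  have : min q 2 < 3 := by omega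
  generalize min q 2 = p at *
  revert r₀ r₁
  interval_cases p <;> decide

theorem blockMove_cross (q : ℕ) {r₀ r₁ s₀ s₁ : Bool × Bool} (h : BlockMove r₀ r₁ s₀ s₁) :
    nxt (nxt q s₀) s₁ = nxt (nxt q r₀) r₁ ∧
    conv q s₀ + conv (nxt q s₀) s₁ = conv q r₀ + conv (nxt q r₀) r₁ ∧
    BlockMove (out q r₀) (out (nxt q r₀) r₁) (out q s₀) (out (nxt q s₀) s₁) := by
  rcases h with ⟨a1, a2, a3, rfl, rfl⟩ | ⟨a1, a2, a3, rfl, rfl⟩ <;> obtain ⟨x0, y0⟩ := r₀ <;>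
    obtain ⟨x1, y1⟩ := r₁ <;> simp only at a1 a2 a3 <;> subst a1 a2 <;> rcases q with _ | _ | q <;>
    (try cases x0) <;> (try cases x1) <;> (try cases y0) <;> (try cases y1) <;>
    simp [nxt, conv, out, BlockMove] at a3 ⊢

theorem pending_congr {X Y : Config} {n : ℕ} (h : ∀ m < n, Y m = X m) :
    pending Y n = pending X n ∧ unmatched Y n = unmatched X n := by
  induction n with
  | zero => exact ⟨rfl, rfl⟩
  | succ n ih =>
    have := ih fun m hm => h m (by omega)
    simp only [pending, unmatched, this.1, this.2, h n (by omega), and_self]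

theorem pending_congr_tail {X Y : Config} {n m : ℕ} (hnm : n ≤ m)
    (h0 : pending Y n = pending X n ∧ unmatched Y n = unmatched X n)
    (h : ∀ k, n ≤ k → Y k = X k) : pending Y m = pending X m ∧ unmatched Y m = unmatched X m := by
  induction m, hnm using Nat.le_induction with
  | base => exact h0
  | succ m hm ih => simp only [pending, unmatched, ih.1, ih.2, h m hm, and_self]

theorem height_even_congr {e j : ℕ} {X Y : Config}
    (h : ∀ k, blockSum (Y (j + e * k)) (Y (j + e * k + 1)) =
      blockSum (X (j + e * k)) (X (j + e * k + 1))) (k : ℕ) :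
    height e Y j (2 * k) = height e X j (2 * k) := by
  induction k with
  | zero => simp [height]
  | succ k ih => rw [height_even, height_even, ih, h]

/-- Crossing the components turns moves into moves, and a move does not affect the matching far
down. -/
theorem Move.cross {e : ℕ} {X Y : Config} (h : Move e X Y) : Move e (cross X) (cross Y) ∧
    ∃ N, ∀ n, N ≤ n → pending Y n = pending X n ∧ unmatched Y n = unmatched X n := by
  obtain ⟨j, hj, k, hc, hb, hm⟩ := (move_iff e X Y).1 h
  set p := j + e * k with hp
  have hpre := pending_congr (X := X) (Y := Y) (n := p) fun m hm' => hm m (by omega) (by omega)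
  obtain ⟨b1, b2, b3⟩ := blockMove_cross (pending X p) hb
  have hpost : pending Y (p + 2) = pending X (p + 2) ∧
      unmatched Y (p + 2) = unmatched X (p + 2) := by
    refine ⟨?_, ?_⟩
    · simp only [pending, hpre.1]; exact b1
    · simp only [pending, unmatched, hpre.1, hpre.2, add_assoc, b2]
  have htail : ∀ n, p + 2 ≤ n → pending Y n = pending X n ∧ unmatched Y n = unmatched X n :=
    fun n hn => pending_congr_tail hn hpost fun k hk => hm k (by omega) (by omega)
  refine ⟨(move_iff e _ _).2 ⟨j, hj, k, ?_, ?_, ?_⟩, p + 2, htail⟩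
  · have hs : ∀ k, blockSum (Wt3.cross X (j + e * k)) (Wt3.cross X (j + e * k + 1)) =
        blockSum (X (j + e * k)) (X (j + e * k + 1)) := fun k =>
      (block_cross (pending X (j + e * k)) _ _).1
    have hmn : ∀ k, blockMin (Wt3.cross X (j + e * k)) (Wt3.cross X (j + e * k + 1)) =
        blockMin (X (j + e * k)) (X (j + e * k + 1)) := fun k =>
      (block_cross (pending X (j + e * k)) _ _).2
    simp only [BlockChoice, height_even_congr hs, hmn]
    exact hc
  · rw [← hp]
    simp only [Wt3.cross, pending, hpre.1]
    exact b3
  · intro m h1 h2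
    rcases Nat.lt_or_ge m p with h | h
    · simp only [Wt3.cross, hm m h1 h2, (pending_congr (X := X) (Y := Y) (n := m)
        fun m hm' => hm m (by omega) (by omega)).1]
    · simp only [Wt3.cross, hm m h1 h2, (htail m (by omega)).1]

/-- The components are crossed and one of them is then moved down by `e` positions. -/
def turn (e : ℕ) (X : Config) : Config := fun n =>
  (if n < e then false else (cross X (n - e)).2, (cross X n).1)

theorem word_turn_zero {e j : ℕ} {X : Config} (hj : j < e) (hX : X 0 = (false, false)) :
    word e (turn e X) j 0 = 0 := by
  have hc : Wt3.cross X 0 = (false, false) := by simp [Wt3.cross, hX, out]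
  simp only [word, turn, sgn]
  by_cases h : j + 1 < e
  · simp [hj, h]
  · simp [hj, show j + 1 = e by omega, hc]

theorem word_turn_succ {e j : ℕ} (X : Config) (t : ℕ) :
    word e (turn e X) j (t + 1) = word e (cross X) j t := by
  rcases Nat.mod_two_eq_zero_or_one t with ht | ht
  · simp only [word, ht, show (t + 1) % 2 = 1 by omega, show (t + 1) / 2 = t / 2 by omega, turn]
    simp
  · have h2 : (t + 1) / 2 = t / 2 + 1 := by omega
    have h3 : j + e * (t / 2 + 1) = j + e * (t / 2) + e := by ring
    simp only [word, ht, show (t + 1) % 2 = 0 by omega, h2, turn, h3]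
    have h4 : j + e * (t / 2) + e + 1 - e = j + e * (t / 2) + 1 := by omega
    simp [h4, show ¬ j + e * (t / 2) + e < e by omega, show ¬ j + e * (t / 2) + e + 1 < e by omega]

theorem height_turn {e j : ℕ} {X : Config} (hj : j < e) (hX : X 0 = (false, false)) (t : ℕ) :
    height e (turn e X) j (t + 1) = height e (cross X) j t := by
  simp only [height, Finset.sum_range_succ', word_turn_zero hj hX, word_turn_succ, add_zero]

theorem turn_zero {e : ℕ} (he : 0 < e) {X : Config} (hX : X 0 = (false, false)) :
    turn e X 0 = (false, false) := by
  simp [turn, he, Wt3.cross, hX, out]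

theorem Move.turn {e : ℕ} {X Y : Config} (hX : X 0 = (false, false))
    (h : Move e X Y) : Move e (turn e X) (turn e Y) := by
  obtain ⟨j, hj, t, ⟨hlt, hgt⟩, hs⟩ := h.cross.1
  have h0 : height e (Wt3.turn e X) j 0 = 0 := by simp [height]
  have h1 : height e (Wt3.cross X) j 0 = 0 := by simp [height]
  refine ⟨j, hj, t + 1, ⟨?_, ?_⟩, ?_⟩
  · rintro (_ | s) hs
    · rw [height_turn hj hX, h0, ← h1]
      rcases t with _ | t
      · rfl
      · exact hlt 0 (by omega)
    · rw [height_turn hj hX, height_turn hj hX]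
      exact hlt s (by omega)
  · rintro (_ | s) hs
    · omega
    · rw [height_turn hj hX, height_turn hj hX]
      exact hgt s (by omega)
  · obtain ⟨hm, hs⟩ := hs
    rcases Nat.mod_two_eq_zero_or_one t with ht | ht
    · rw [if_pos ht] at hs
      have h2 : (t + 1) / 2 = t / 2 := by omega
      rw [IsShift, if_neg (by omega), h2]
      set p := j + e * (t / 2) with hp
      have hsnd : ∀ m, (Wt3.cross Y m).2 = (Wt3.cross X m).2 := fun m => by
        by_cases a1 : m = p
        · rw [a1, hs.1]
        · by_cases a2 : m = p + 1
          · rw [a2, hs.2]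
          · rw [hm m a1 a2]
      refine ⟨fun m a1 a2 => ?_, ?_, ?_⟩
      · simp only [Wt3.turn, hsnd, hm m a1 a2]
      · simp only [Wt3.turn, hsnd, hs.1]
      · simp only [Wt3.turn, hsnd, hs.2]
    · rw [if_neg (by omega)] at hs
      have h2 : (t + 1) / 2 = t / 2 + 1 := by omega
      have h3 : j + e * (t / 2 + 1) = j + e * (t / 2) + e := by ring
      rw [IsShift, if_pos (by omega), h2, h3]
      set p := j + e * (t / 2) with hp
      have hfst : ∀ m, (Wt3.cross Y m).1 = (Wt3.cross X m).1 := fun m => by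
        by_cases a1 : m = p
        · rw [a1, hs.1]
        · by_cases a2 : m = p + 1
          · rw [a2, hs.2]
          · rw [hm m a1 a2]
      refine ⟨fun m a1 a2 => ?_, ?_, ?_⟩
      · simp only [Wt3.turn, hfst]
        by_cases hme : m < e
        · simp [hme]
        · simp only [hme, if_false, hm (m - e) (by omega) (by omega)]
      · simp only [Wt3.turn, hfst, hs.1, Nat.add_sub_cancel,
          show ¬ p + e < e by omega, if_false]
      · simp only [Wt3.turn, hfst, show p + e + 1 - e = p + 1 by omega, hs.2,
          show ¬ p + e + 1 < e by omega, if_false]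

/-- A move between configurations without bead in the first position. -/
def TopMove (e : ℕ) (X Y : Config) : Prop :=
  X 0 = (false, false) ∧ Y 0 = (false, false) ∧ Move e X Y

theorem TopMove.iterate_turn {e : ℕ} (he : 0 < e) {X Y : Config}
    (h : Relation.EqvGen (TopMove e) X Y) (k : ℕ) :
    Relation.EqvGen (TopMove e) ((turn e)^[k] X) ((turn e)^[k] Y) := by
  induction k with
  | zero => exact h
  | succ k ih =>
    rw [Function.iterate_succ_apply', Function.iterate_succ_apply']
    generalize (turn e)^[k] X = X', (turn e)^[k] Y = Y' at ih
    induction ih with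
    | rel X Y h => exact .rel _ _ ⟨turn_zero he h.1, turn_zero he h.2.1, h.2.2.turn h.1⟩
    | refl X => exact .refl _
    | symm X Y _ h => exact .symm _ _ h
    | trans X Y Z _ _ h1 h2 => exact .trans _ _ _ h1 h2

theorem TopMove.eventually {e : ℕ} {X Y : Config} (h : Relation.EqvGen (TopMove e) X Y) :
    ∃ N, ∀ n, N ≤ n → pending Y n = pending X n ∧ unmatched Y n = unmatched X n := by
  induction h with
  | rel X Y h => exact h.2.2.cross.2
  | refl X => exact ⟨0, fun n _ => ⟨rfl, rfl⟩⟩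
  | symm X Y _ h =>
    obtain ⟨N, h⟩ := h
    exact ⟨N, fun n hn => ⟨(h n hn).1.symm, (h n hn).2.symm⟩⟩
  | trans X Y Z _ _ h1 h2 =>
    obtain ⟨N, h1⟩ := h1
    obtain ⟨M, h2⟩ := h2
    exact ⟨max N M, fun n hn => ⟨(h2 n (le_of_max_le_right hn)).1.trans
      (h1 n (le_of_max_le_left hn)).1, (h2 n (le_of_max_le_right hn)).2.trans
      (h1 n (le_of_max_le_left hn)).2⟩⟩

/-- The configuration obtained by reading `U` downwards from `A` and `V` downwards from `B`. -/
def conf (U V : ℤ → Bool) (A B : ℤ) : Config := fun n => (U (A - n), V (B - n))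

theorem turn_conf {e : ℕ} {U V : ℤ → Bool} {A B : ℤ}
    (h : ∀ n : ℕ, V (B - n) = true → U (A - n) = true) (hA : ∀ b, A < b → U b = false) :
    turn e (conf U V A B) = conf U V (A + e) B := by
  have hp : ∀ n, pending (conf U V A B) n = 0 := by
    intro n
    induction n with
    | zero => rfl
    | succ n ih =>
      have := h n
      simp only [pending, ih, nxt, conf, Prod.mk.injEq]
      cases hu : U (A - n) <;> cases hv : V (B - n) <;> simp_all
  have hc : ∀ n, cross (conf U V A B) n = (V (B - n), U (A - n)) := by
    intro n
    have := h n
    simp only [cross, hp, out, conf, Prod.mk.injEq, and_true]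
    cases hu : U (A - n) <;> cases hv : V (B - n) <;> simp_all
  funext n
  simp only [turn, hc, conf, Prod.mk.injEq, and_true]
  split_ifs with hn
  · rw [hA _ (by omega)]
  · congr 1; omega

theorem iterate_turn_conf {e : ℕ} {U V : ℤ → Bool} (K : ℕ)
    (h : ∀ (b : ℤ) (k : ℕ), 0 < k → V b = true → U (b - k * e) = true)
    (hA : ∀ b, (K * e : ℤ) < b → U b = false) :
    (turn e)^[K] (conf U V (K * e) (2 * K * e)) = conf U V (2 * K * e) (2 * K * e) := by
  have key : ∀ k ≤ K, (turn e)^[k] (conf U V (K * e) (2 * K * e)) =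
      conf U V ((K + k) * e) (2 * K * e) := by
    intro k hk
    induction k with
    | zero => simp
    | succ k ih =>
      rw [Function.iterate_succ_apply', ih (by omega), turn_conf]
      · congr 1; push_cast; ring
      · intro n hn
        have := h _ (K - k) (by omega) hn
        rw [Nat.cast_sub (by omega)] at this
        convert this using 2; ring
      · intro b hb
        refine hA b (lt_of_le_of_lt ?_ hb)
        have : (0:ℤ) ≤ k * e := by positivity
        nlinarith
  rw [key K le_rfl]
  congr 1; ring

theorem pending_eq_zero {X : Config} {n : ℕ} (h : ∀ m < n, X m ≠ (false, true)) :
    pending X n = 0 := by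
  induction n with
  | zero => rfl
  | succ n ih =>
    simp [pending, ih fun m hm => h m (by omega), nxt, h n (by omega)]

theorem pending_pos {X : Config} {n m : ℕ} (hn : X n = (false, true)) (hm : n < m)
    (h : ∀ k, n < k → X k ≠ (true, false)) : 0 < pending X m := by
  induction m, hm using Nat.le_induction with
  | base => simp [pending, nxt, hn]
  | succ m hm ih =>
    simp only [pending, nxt, h m hm, if_false]
    split_ifs <;> omega

theorem unmatched_eq_zero {X : Config} {n : ℕ} (h : ∀ m < n, X m ≠ (true, false)) :
    unmatched X n = 0 := by
  induction n with
  | zero => rfl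
  | succ n ih =>
    simp [unmatched, ih fun m hm => h m (by omega), conv, h n (by omega)]

theorem unmatched_pos {X : Config} {n m : ℕ} (hn : X n = (true, false)) (hm : n < m)
    (h : ∀ k < n, X k ≠ (false, true)) : 0 < unmatched X m := by
  induction m, hm using Nat.le_induction with
  | base => simp [unmatched, conv, hn, pending_eq_zero h]
  | succ m hm ih =>
    simp only [unmatched]; omega

/-- Configurations of this kind cannot be reduced to the empty one. -/
theorem not_eqvGen_conf {e : ℕ} (he : 0 < e) {U V U₀ V₀ : ℤ → Bool} {s₀ s₁ : ℤ} {K : ℕ}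
    (hU₀ : ∀ b, U₀ b = true ↔ b < s₀) (hV₀ : ∀ b, V₀ b = true ↔ b < s₁)
    (hs : s₁ ≤ s₀ + e) (hs₀ : s₀ ≤ K * e)
    (h : ∀ (b : ℤ) (k : ℕ), 0 < k → V b = true → U (b - k * e) = true)
    (hA : ∀ b, (K * e : ℤ) < b → U b = false) (hB : ∀ b, (2 * K * e : ℤ) < b → V b = false)
    {p q : ℤ} (hp : U p = true ∧ V p = false) (hq : U q = false ∧ V q = true)
    (hpq : ∀ p q, U p = true → V p = false → U q = false → V q = true → q < p) :
    ¬ Relation.EqvGen (TopMove e) (conf U V (K * e) (2 * K * e))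
      (conf U₀ V₀ (K * e) (2 * K * e)) := by
  intro hE
  have hE := TopMove.iterate_turn he hE K
  have hke : (0:ℤ) ≤ K * e := by positivity
  rw [iterate_turn_conf K h hA, iterate_turn_conf K] at hE
  · obtain ⟨N, hN⟩ := TopMove.eventually hE
    have hpK : p ≤ 2 * K * e := by
      by_contra hc
      have := hA p (by nlinarith)
      simp_all
    have hqK : q ≤ 2 * K * e := by
      by_contra hc
      have := hB q (by linarith)
      simp_all
    obtain ⟨n, hn⟩ := Int.eq_ofNat_of_zero_le (sub_nonneg.2 hpK)
    obtain ⟨m, hm⟩ := Int.eq_ofNat_of_zero_le (sub_nonneg.2 hqK)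
    obtain rfl : p = 2 * K * e - n := by omega
    obtain rfl : q = 2 * K * e - m := by omega
    obtain ⟨h1, h2⟩ := hN (N + n + m + 1) (by omega)
    have c1 : 0 < unmatched (conf U V (2 * K * e) (2 * K * e)) (N + n + m + 1) := by
      refine unmatched_pos (n := n) ?_ (by omega) ?_
      · simp [conf, hp]
      · intro k hk hx
        simp only [conf, Prod.mk.injEq] at hx
        have := hpq _ _ hp.1 hp.2 hx.1 hx.2
        omega
    have c2 : 0 < pending (conf U V (2 * K * e) (2 * K * e)) (N + n + m + 1) := by
      refine pending_pos (n := m) ?_ (by omega) ?_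
      · simp [conf, hq]
      · intro k hk hx
        simp only [conf, Prod.mk.injEq] at hx
        have := hpq _ _ hx.1 hx.2 hq.1 hq.2
        omega
    rcases le_total s₁ s₀ with hle | hle
    · rw [pending_eq_zero] at h1
      · omega
      · intro k _ hx
        simp only [conf, Prod.mk.injEq, hV₀] at hx
        rw [← Bool.not_eq_true, hU₀] at hx
        omega
    · rw [unmatched_eq_zero] at h2
      · omega
      · intro k _ hx
        simp only [conf, Prod.mk.injEq, hU₀] at hx
        rw [← Bool.not_eq_true, hV₀] at hx
        omega
  · intro b k hk hb
    rw [hV₀] at hb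
    rw [hU₀]
    have : (e : ℤ) ≤ k * e := by exact_mod_cast Nat.le_mul_of_pos_left e hk
    linarith
  · intro b hb
    rw [← Bool.not_eq_true, hU₀]
    omega

/-- The maximal elements of a signature given by any family of nodes. -/
theorem lastMin_of_good {α : Type*} {R A : α → Prop} {lt : α → α → Prop} {τ : α → ℕ} {w : ℕ → ℤ}
    (hw : ∀ t, w t = 1 ∨ w t = -1 ∨ w t = 0)
    (hR : ∀ x, R x → w (τ x) = 1) (hA : ∀ x, A x → w (τ x) = -1)
    (hR' : ∀ t, w t = 1 → ∃ x, R x ∧ τ x = t) (hA' : ∀ t, w t = -1 → ∃ x, A x ∧ τ x = t)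
    (hlt : ∀ x y, R x ∨ A x → R y ∨ A y → (lt x y ↔ τ x < τ y))
    (hinj : ∀ x y, R x ∨ A x → R y ∨ A y → τ x = τ y → x = y) {x : α}
    (hx : R x) (hn : ∀ y, A y → lt x y →
      Set.ncard {z | A z ∧ lt x z ∧ lt z y} < Set.ncard {z | R z ∧ lt x z ∧ lt z y})
    (hgood : ∀ x', R x' → (∀ y, A y → lt x' y →
      Set.ncard {z | A z ∧ lt x' z ∧ lt z y} < Set.ncard {z | R z ∧ lt x' z ∧ lt z y}) →
      x' = x ∨ lt x x') :
    LastMin (fun t => ∑ s ∈ Finset.range t, w s) (τ x) := by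
  have cardR : ∀ x y, R x → A y → Set.ncard {z | R z ∧ lt x z ∧ lt z y} =
      ((Finset.Ico (τ x + 1) (τ y)).filter fun s => w s = 1).card := by
    intro x y hx hy
    rw [← Set.ncard_coe_finset]
    refine Set.ncard_congr (fun z _ => τ z) ?_ ?_ ?_
    · rintro z ⟨hz, h1, h2⟩
      rw [hlt _ _ (.inl hx) (.inl hz)] at h1
      rw [hlt _ _ (.inl hz) (.inr hy)] at h2
      simp [hR z hz, h2]; omega
    · rintro z z' ⟨hz, -⟩ ⟨hz', -⟩ h
      exact hinj _ _ (.inl hz) (.inl hz') h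
    · intro t ht
      simp only [Finset.coe_filter, Finset.mem_Ico, Set.mem_ofPred_eq] at ht
      obtain ⟨z, hz, rfl⟩ := hR' t ht.2
      exact ⟨z, ⟨hz, (hlt _ _ (.inl hx) (.inl hz)).2 (by omega),
        (hlt _ _ (.inl hz) (.inr hy)).2 (by omega)⟩, rfl⟩
  have cardA : ∀ x y, R x → A y → Set.ncard {z | A z ∧ lt x z ∧ lt z y} =
      ((Finset.Ico (τ x + 1) (τ y)).filter fun s => w s = -1).card := by
    intro x y hx hy
    rw [← Set.ncard_coe_finset]
    refine Set.ncard_congr (fun z _ => τ z) ?_ ?_ ?_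
    · rintro z ⟨hz, h1, h2⟩
      rw [hlt _ _ (.inl hx) (.inr hz)] at h1
      rw [hlt _ _ (.inr hz) (.inr hy)] at h2
      simp [hA z hz, h2]; omega
    · rintro z z' ⟨hz, -⟩ ⟨hz', -⟩ h
      exact hinj _ _ (.inr hz) (.inr hz') h
    · intro t ht
      simp only [Finset.coe_filter, Finset.mem_Ico, Set.mem_ofPred_eq] at ht
      obtain ⟨z, hz, rfl⟩ := hA' t ht.2
      exact ⟨z, ⟨hz, (hlt _ _ (.inl hx) (.inr hz)).2 (by omega),
        (hlt _ _ (.inr hz) (.inr hy)).2 (by omega)⟩, rfl⟩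
  set F : ℕ → ℤ := fun t => ∑ s ∈ Finset.range t, w s with hF
  have Fs : ∀ t, F (t + 1) = F t + w t := fun t => Finset.sum_range_succ _ _
  have key : ∀ x y, R x → A y → τ x < τ y → (Set.ncard {z | A z ∧ lt x z ∧ lt z y} <
      Set.ncard {z | R z ∧ lt x z ∧ lt z y} ↔ F (τ x) + 1 < F (τ y)) := by
    intro x y hx hy hxy
    rw [cardR x y hx hy, cardA x y hx hy]
    have h1 : F (τ y) - F (τ x + 1) = ∑ s ∈ Finset.Ico (τ x + 1) (τ y), w s :=
      (Finset.sum_Ico_eq_sub _ hxy).symm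
    have h2 : ∑ s ∈ Finset.Ico (τ x + 1) (τ y), w s =
        (((Finset.Ico (τ x + 1) (τ y)).filter fun s => w s = 1).card : ℤ) -
        (((Finset.Ico (τ x + 1) (τ y)).filter fun s => w s = -1).card : ℤ) := by
      rw [Finset.card_filter, Finset.card_filter, Nat.cast_sum, Nat.cast_sum,
        ← Finset.sum_sub_distrib]
      refine Finset.sum_congr rfl fun s _ => ?_
      rcases hw s with h | h | h <;> simp [h]
    have h3 := Fs (τ x)
    rw [hR x hx] at h3
    omega
  have after : ∀ s, τ x < s → F (τ x) < F s := by
    intro s hs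
    induction s, hs using Nat.le_induction with
    | base => have := Fs (τ x); rw [hR x hx] at this; change F (τ x) < F (τ x + 1); omega
    | succ s hs ih =>
      have h3 := Fs s
      rcases hw s with h | h | h
      · omega
      · obtain ⟨y, hy, rfl⟩ := hA' s h
        have := (key x y hx hy (by omega)).1 (hn y hy ((hlt _ _ (.inl hx) (.inr hy)).2 (by omega)))
        omega
      · omega
  refine ⟨?_, after⟩
  by_contra! hc
  obtain ⟨s, hs, hsF⟩ := hc
  obtain ⟨m, hm, hmin⟩ := Finset.exists_min_image (Finset.range (τ x + 1)) F ⟨0, by simp⟩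
  have hne : ((Finset.range (τ x + 1)).filter fun t => F t = F m).Nonempty :=
    ⟨m, by simp at hm ⊢; omega⟩
  set t := ((Finset.range (τ x + 1)).filter fun t => F t = F m).max' hne with htdef
  have ht := Finset.max'_mem _ hne
  rw [← htdef] at ht
  simp only [Finset.mem_filter, Finset.mem_range] at ht hmin
  have ht1 : F t < F (τ x) := by
    have := hmin s (by omega)
    change F s < F (τ x) at hsF
    omega
  have ht2 : t < τ x := by
    rcases Nat.lt_or_ge t (τ x) with h | h
    · exact h
    · have heq : t = τ x := by omega
      rw [heq] at ht1
      exact absurd ht1 (lt_irrefl _)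
  have hlast : ∀ s, t < s → F t < F s := by
    intro s hs
    rcases Nat.lt_or_ge (τ x) s with h | h
    · exact ht1.trans (after s h)
    · have h1 := hmin s (by omega)
      rcases lt_or_eq_of_le h1 with h2 | h2
      · omega
      · have := Finset.le_max' ((Finset.range (τ x + 1)).filter fun t => F t = F m) s
          (by simp [h2]; omega)
        omega
  have hwt : w t = 1 := by
    have := hlast (t + 1) (by omega)
    have := Fs t
    rcases hw t with h | h | h <;> omega
  obtain ⟨z, hz, hzt⟩ := hR' t hwt
  have := hgood z hz fun y hy hzy => by
    rw [hlt _ _ (.inl hz) (.inr hy)] at hzy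
    rw [key z y hz hy hzy, hzt]
    have h1 := hlast (τ y + 1) (by omega)
    have h2 := Fs (τ y)
    rw [hA y hy] at h2
    omega
  rcases this with h | h
  · rw [h] at hzt; omega
  · rw [hlt _ _ (.inl hx) (.inl hz)] at h
    omega

/-- The bead positions of a partition with charge `s`. -/
def Bead (f : ℕ → ℕ) (s b : ℤ) : Prop := ∃ r : ℕ, (f r : ℤ) - r - 1 + s = b

theorem diagram_injective {lam mu : Fin 2 → ℕ → ℕ} (h : Diagram lam = Diagram mu) : lam = mu := by
  funext a r
  have : ∀ c, c < lam a r ↔ c < mu a r := fun c => by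
    have := Set.ext_iff.1 h (r, c, a)
    exact this
  have h1 := this (lam a r)
  have h2 := this (mu a r)
  omega

theorem IsPartition.anti {f : ℕ → ℕ} (hf : IsPartition f) : Antitone f :=
  antitone_nat_of_succ_le hf.1

theorem IsPartition.pos_lt {f : ℕ → ℕ} (hf : IsPartition f) {r r' : ℕ} (h : r < r') :
    (f r' : ℤ) - r' < f r - r := by
  have := hf.anti h.le
  omega

theorem IsBipartition.update {lam : Fin 2 → ℕ → ℕ} (hlam : IsBipartition lam) {a : Fin 2}
    {f : ℕ → ℕ} (hf : IsPartition f) : IsBipartition (Function.update lam a f) := by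
  intro b
  by_cases h : b = a
  · subst h; simpa using hf
  · rw [Function.update_of_ne h]; exact hlam b

theorem IsPartition.decrease {f : ℕ → ℕ} (hf : IsPartition f) {r c : ℕ} (h : f r = c + 1)
    (h' : f (r + 1) ≤ c) : IsPartition (Function.update f r c) := by
  refine ⟨fun k => ?_, ?_⟩
  · have := hf.1 k
    simp only [Function.update_apply]
    split_ifs with h1 h2 h2
    · omega
    · rw [← h1] at h; omega
    · rw [h2]; exact h'
    · exact this
  · obtain ⟨N, hN⟩ := hf.2
    refine ⟨N, fun k hk => ?_⟩
    have := hN k hk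
    simp only [Function.update_apply]
    split_ifs with h1
    · rw [← h1] at h; omega
    · exact this

theorem IsPartition.increase {f : ℕ → ℕ} (hf : IsPartition f) {r : ℕ}
    (h' : ∀ k, r = k + 1 → f r < f k) : IsPartition (Function.update f r (f r + 1)) := by
  refine ⟨fun k => ?_, ?_⟩
  · have := hf.1 k
    simp only [Function.update_apply]
    split_ifs with h1 h2 h2
    · omega
    · exact h' k h1.symm
    · rw [← h2]; omega
    · exact this
  · obtain ⟨N, hN⟩ := hf.2
    refine ⟨max N (r + 1), fun k hk => ?_⟩
    have := hN k (le_of_max_le_left hk)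
    simp only [Function.update_apply]
    split_ifs with h1
    · have := le_of_max_le_right hk; omega
    · exact this

theorem diagram_decrease {lam : Fin 2 → ℕ → ℕ} {r c : ℕ} {a : Fin 2} (h : lam a r = c + 1) :
    Diagram (Function.update lam a (Function.update (lam a) r c)) = Diagram lam \ {(r, c, a)} := by
  ext ⟨r', c', a'⟩
  simp only [Diagram, Set.mem_ofPred_eq, Set.mem_sdiff, Set.mem_singleton_iff, Prod.mk.injEq]
  by_cases ha : a' = a
  · subst ha
    by_cases hr : r' = r
    · subst hr; simp [h]; omega
    · simp [hr]
  · simp [ha]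

theorem diagram_increase {lam : Fin 2 → ℕ → ℕ} {r : ℕ} {a : Fin 2} :
    Diagram (Function.update lam a (Function.update (lam a) r (lam a r + 1))) =
      Diagram lam ∪ {(r, lam a r, a)} := by
  ext ⟨r', c', a'⟩
  simp only [Diagram, Set.mem_ofPred_eq, Set.mem_union, Set.mem_singleton_iff, Prod.mk.injEq]
  by_cases ha : a' = a
  · subst ha
    by_cases hr : r' = r
    · subst hr; simp; omega
    · simp [hr]
  · simp [ha]

theorem isRemovable_iff {lam : Fin 2 → ℕ → ℕ} (hlam : IsBipartition lam) {r c : ℕ} {a : Fin 2} :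
    IsRemovable lam (r, c, a) ↔ lam a r = c + 1 ∧ lam a (r + 1) ≤ c := by
  constructor
  · rintro ⟨hx, mu, hmu, hd⟩
    have h : ∀ r' c', c' < mu a r' ↔ c' < lam a r' ∧ ¬ (r' = r ∧ c' = c) := fun r' c' => by
      have := Set.ext_iff.1 hd (r', c', a)
      simpa [Diagram] using this
    change c < lam a r at hx
    have h1 := (h r c).not.2 (by simp)
    have h2 := (h r (c + 1)).not.1 (by omega)
    have h3 := hmu a |>.1 r
    have h4 := (h (r + 1) c).not.1 (by omega)
    simp at h2 h4
    omega
  · rintro ⟨h1, h2⟩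
    refine ⟨by change c < lam a r; omega, _, ?_, diagram_decrease h1⟩
    exact hlam.update ((hlam a).decrease h1 h2)

theorem isAddable_iff {lam : Fin 2 → ℕ → ℕ} (hlam : IsBipartition lam) {r c : ℕ} {a : Fin 2} :
    IsAddable lam (r, c, a) ↔ lam a r = c ∧ ∀ k, r = k + 1 → lam a r < lam a k := by
  constructor
  · rintro ⟨hx, mu, hmu, hd⟩
    have h : ∀ r' c', c' < mu a r' ↔ c' < lam a r' ∨ (r' = r ∧ c' = c) := fun r' c' => by
      have := Set.ext_iff.1 hd (r', c', a)
      simpa [Diagram, or_comm] using this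
    change ¬ c < lam a r at hx
    have h1 := (h r c).2 (by simp)
    have h2 : lam a r = c := by
      by_contra hc
      have := (h r (lam a r)).1 (by omega)
      omega
    refine ⟨h2, ?_⟩
    rintro k rfl
    have h3 := hmu a |>.1 k
    have h4 := (h k c).1 (by omega)
    rcases h4 with h4 | h4 <;> omega
  · rintro ⟨rfl, h2⟩
    refine ⟨by simp [Diagram], _, ?_, diagram_increase⟩
    exact hlam.update ((hlam a).increase h2)

theorem bead_of_isRemovable {lam : Fin 2 → ℕ → ℕ} (hlam : IsBipartition lam) {r c : ℕ} {a : Fin 2}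
    (h : IsRemovable lam (r, c, a)) (s : ℤ) :
    Bead (lam a) s (c - r + s) ∧ ¬ Bead (lam a) s (c - r + s - 1) := by
  rw [isRemovable_iff hlam] at h
  refine ⟨⟨r, by omega⟩, ?_⟩
  rintro ⟨r', h'⟩
  rcases Nat.lt_or_ge r r' with hr | hr
  · have := (hlam a).anti (Nat.succ_le_of_lt hr)
    simp only [Nat.succ_eq_add_one] at this
    omega
  · have := (hlam a).anti hr
    omega

theorem bead_of_isAddable {lam : Fin 2 → ℕ → ℕ} (hlam : IsBipartition lam) {r c : ℕ} {a : Fin 2}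
    (h : IsAddable lam (r, c, a)) (s : ℤ) :
    ¬ Bead (lam a) s (c - r + s) ∧ Bead (lam a) s (c - r + s - 1) := by
  rw [isAddable_iff hlam] at h
  refine ⟨?_, ⟨r, by omega⟩⟩
  rintro ⟨r', h'⟩
  rcases Nat.lt_or_ge r' r with hr | hr
  · obtain ⟨k, rfl⟩ : ∃ k, r = k + 1 := ⟨r - 1, by omega⟩
    have := (hlam a).anti (show r' ≤ k by omega)
    have := h.2 k rfl
    omega
  · have := (hlam a).anti hr
    omega

theorem exists_isRemovable {lam : Fin 2 → ℕ → ℕ} (hlam : IsBipartition lam) {a : Fin 2}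
    {s b : ℤ} (h : Bead (lam a) s b) (h' : ¬ Bead (lam a) s (b - 1)) :
    ∃ r c : ℕ, IsRemovable lam (r, c, a) ∧ (c : ℤ) - r + s = b := by
  obtain ⟨r, hr⟩ := h
  have h1 := (hlam a).1 r
  have h2 : lam a (r + 1) ≠ lam a r := fun h2 => h' ⟨r + 1, by rw [h2]; push_cast; omega⟩
  refine ⟨r, lam a r - 1, (isRemovable_iff hlam).2 ⟨by omega, by omega⟩, by omega⟩

theorem exists_isAddable {lam : Fin 2 → ℕ → ℕ} (hlam : IsBipartition lam) {a : Fin 2}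
    {s b : ℤ} (h : ¬ Bead (lam a) s b) (h' : Bead (lam a) s (b - 1)) :
    ∃ r c : ℕ, IsAddable lam (r, c, a) ∧ (c : ℤ) - r + s = b := by
  obtain ⟨r, hr⟩ := h'
  refine ⟨r, lam a r, (isAddable_iff hlam).2 ⟨rfl, ?_⟩, by omega⟩
  rintro k rfl
  have h1 := (hlam a).1 k
  have h2 : lam a (k + 1) ≠ lam a k := fun h2 => h ⟨k, by rw [← h2]; push_cast at *; omega⟩
  omega

theorem bead_decrease {f : ℕ → ℕ} (hf : IsPartition f) {r c : ℕ} (h : f r = c + 1) (s b : ℤ) :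
    Bead (Function.update f r c) s b ↔
      (Bead f s b ∧ b ≠ c - r + s) ∨ b = c - r + s - 1 := by
  constructor
  · rintro ⟨k, hk⟩
    by_cases hkr : k = r
    · subst hkr; simp at hk; right; omega
    · rw [Function.update_of_ne hkr] at hk
      refine .inl ⟨⟨k, hk⟩, ?_⟩
      rcases Nat.lt_or_ge k r with h' | h'
      · have := hf.pos_lt h'; omega
      · have := hf.pos_lt (show r < k by omega); omega
  · rintro (⟨⟨k, hk⟩, hb⟩ | hb)
    · refine ⟨k, ?_⟩
      rw [Function.update_of_ne]
      · exact hk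
      · rintro rfl; omega
    · exact ⟨r, by simp; omega⟩

theorem bead_increase {f : ℕ → ℕ} (hf : IsPartition f) {r : ℕ} (s b : ℤ) :
    Bead (Function.update f r (f r + 1)) s b ↔
      (Bead f s b ∧ b ≠ f r - r + s - 1) ∨ b = f r - r + s := by
  constructor
  · rintro ⟨k, hk⟩
    by_cases hkr : k = r
    · subst hkr; simp at hk; right; omega
    · rw [Function.update_of_ne hkr] at hk
      refine .inl ⟨⟨k, hk⟩, ?_⟩
      rcases Nat.lt_or_ge k r with h' | h'
      · have := hf.pos_lt h'; omega
      · have := hf.pos_lt (show r < k by omega); omega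
  · rintro (⟨⟨k, hk⟩, hb⟩ | hb)
    · refine ⟨k, ?_⟩
      rw [Function.update_of_ne]
      · exact hk
      · rintro rfl; omega
    · exact ⟨r, by simp; omega⟩

/-- Positions far below are occupied and positions far above are not. -/
theorem exists_bead_bound {f : ℕ → ℕ} (hf : IsPartition f) (s : ℤ) : ∃ B : ℕ, ∀ B' : ℤ, B ≤ B' →
    (∀ b < -B', Bead f s b) ∧ ∀ b, B' ≤ b → ¬ Bead f s b := by
  obtain ⟨N, hN⟩ := hf.2
  refine ⟨N + f 0 + s.natAbs, fun B' hB => ⟨fun b hb => ?_, ?_⟩⟩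
  · have : 0 ≤ s - 1 - b := by omega
    obtain ⟨r, hr⟩ := Int.eq_ofNat_of_zero_le this
    exact ⟨r, by rw [hN r (by omega)]; push_cast; omega⟩
  · rintro b hb ⟨r, hr⟩
    have := hf.anti (Nat.zero_le r)
    omega

open Classical in
/-- The bead positions as a Boolean function. -/
noncomputable def beads (lam : Fin 2 → ℕ → ℕ) (s : Fin 2 → ℤ) (a : Fin 2) (b : ℤ) : Bool :=
  decide (Bead (lam a) (s a) b)

theorem beads_iff {lam : Fin 2 → ℕ → ℕ} {s : Fin 2 → ℤ} {a : Fin 2} {b : ℤ} :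
    beads lam s a b = true ↔ Bead (lam a) (s a) b := by simp [beads]

theorem beads_eq_false {lam : Fin 2 → ℕ → ℕ} {s : Fin 2 → ℤ} {a : Fin 2} {b : ℤ} :
    beads lam s a b = false ↔ ¬ Bead (lam a) (s a) b := by simp [beads]

/-- The configuration of a bipartition. -/
noncomputable def abacus (e : ℕ) (s : Fin 2 → ℤ) (K : ℕ) (lam : Fin 2 → ℕ → ℕ) : Config :=
  conf (beads lam s 0) (beads lam s 1) (K * e) (2 * K * e)

theorem word_abacus (e : ℕ) (s : Fin 2 → ℤ) (K : ℕ) (lam : Fin 2 → ℕ → ℕ) (j k : ℕ) (a : Fin 2) :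
    word e (abacus e s K lam) j (2 * k + a) =
      sgn (beads lam s a ((1 + (a : ℕ)) * K * e - j - e * k))
        (beads lam s a ((1 + (a : ℕ)) * K * e - j - e * k - 1)) := by
  match a with
  | 0 =>
    simp only [word, abacus, conf]
    simp [sub_sub, add_assoc]
  | 1 =>
    have h1 : (2 * k + 1) % 2 = 1 := by omega
    have h2 : (2 * k + 1) / 2 = k := by omega
    simp only [word, abacus, conf]
    simp [sub_sub, add_assoc, h1, h2]

theorem row_site {lam : Fin 2 → ℕ → ℕ} (hlam : IsBipartition lam) {r c r' c' : ℕ} {a : Fin 2}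
    (h : IsRemovable lam (r, c, a) ∨ IsAddable lam (r, c, a))
    (h' : IsRemovable lam (r', c', a) ∨ IsAddable lam (r', c', a)) :
    (r < r' → (c' : ℤ) - r' < c - r) ∧ (r = r' → c ≤ c' + 1) := by
  rw [isRemovable_iff hlam, isAddable_iff hlam] at h h'
  constructor
  · intro hr
    have h1 := (hlam a).pos_lt hr
    rcases h with h | h <;> rcases h' with h' | h'
    · omega
    · have := (hlam a).anti (Nat.succ_le_of_lt hr)
      simp only [Nat.succ_eq_add_one] at this
      omega
    · omega
    · omega
  · rintro rfl
    omega

theorem row_lt_iff {lam : Fin 2 → ℕ → ℕ} (hlam : IsBipartition lam) {e : ℕ} (he : 2 ≤ e)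
    {r c r' c' : ℕ} {a : Fin 2}
    (h : IsRemovable lam (r, c, a) ∨ IsAddable lam (r, c, a))
    (h' : IsRemovable lam (r', c', a) ∨ IsAddable lam (r', c', a))
    (hd : (e : ℤ) ∣ (c - r) - (c' - r')) :
    (r < r' ↔ (c' : ℤ) - r' < c - r) ∧ ((c' : ℤ) - r' = c - r → r = r' ∧ c = c') := by
  obtain ⟨h1, h2⟩ := row_site hlam h h'
  obtain ⟨h3, h4⟩ := row_site hlam h' h
  rcases lt_trichotomy r r' with hr | hr | hr
  · have := h1 hr
    exact ⟨⟨fun _ => this, fun _ => hr⟩, fun h => by omega⟩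
  · have a1 := h2 hr
    have a2 := h4 hr.symm
    have : ((c : ℤ) - r) - (c' - r') = 0 := by
      refine Int.eq_zero_of_abs_lt_dvd hd ?_
      rw [abs_lt]; omega
    exact ⟨⟨fun h => by omega, fun h => by omega⟩, fun h => by omega⟩
  · have := h3 hr
    exact ⟨⟨fun h => by omega, fun h => by omega⟩, fun h => by omega⟩

theorem exists_beads_bound {lam : Fin 2 → ℕ → ℕ} (hlam : IsBipartition lam) (s : Fin 2 → ℤ) :
    ∃ B : ℕ, ∀ B' : ℤ, B ≤ B' → ∀ a, (∀ b < -B', Bead (lam a) (s a) b) ∧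
      ∀ b, B' ≤ b → ¬ Bead (lam a) (s a) b := by
  obtain ⟨B, h⟩ := exists_bead_bound (hlam 0) (s 0)
  obtain ⟨B', h'⟩ := exists_bead_bound (hlam 1) (s 1)
  refine ⟨max B B', fun C hC a => ?_⟩
  have : (B : ℤ) ≤ C ∧ (B' : ℤ) ≤ C := by push_cast at hC; omega
  match a with
  | 0 => exact h C this.1
  | 1 => exact h' C this.2

theorem RemGood.topMove {e : ℕ} (he : 2 ≤ e) {κ : Fin 2 → ZMod e} {s : Fin 2 → ℤ}
    (hs : ∀ a, (s a : ZMod e) = κ a) {mu lam : Fin 2 → ℕ → ℕ} (h : RemGood e κ mu lam) :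
    ∃ K₀, ∀ K, K₀ ≤ K → TopMove e (abacus e s K lam) (abacus e s K mu) := by
  obtain ⟨hmu, hlam, i, ⟨r, c, a⟩, ⟨⟨hrem, hres, hnorm⟩, hgood⟩, hd⟩ := h
  have : NeZero e := ⟨by omega⟩
  obtain ⟨B, hB⟩ := exists_beads_bound hlam s
  replace hB := hB B le_rfl
  refine ⟨2 * B + 3, fun K hK => ?_⟩
  have hKe : (2 * B + e : ℤ) < K * e := by
    have : (2 * B + 3 : ℤ) ≤ K := by exact_mod_cast hK
    have : (2 : ℤ) ≤ e := by exact_mod_cast he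
    nlinarith
  obtain ⟨hr1, hr2⟩ := (isRemovable_iff hlam).1 hrem
  have hmu' : mu = Function.update lam a (Function.update (lam a) r c) :=
    diagram_injective (by rw [hd, diagram_decrease hr1])
  set j := (-i).val with hj
  have hje : j < e := ZMod.val_lt _
  let site : Node → ℤ := fun y => (y.2.1 : ℤ) - y.1 + s y.2.2
  have hsite : ∀ y, res e κ y = i ↔ (e : ℤ) ∣ site y + j := by
    intro y
    rw [← ZMod.intCast_zmod_eq_zero_iff_dvd]
    simp only [site, res, hj, ← hs]
    push_cast
    rw [ZMod.natCast_zmod_val]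
    constructor
    · intro h; rw [h]; ring
    · intro h; linear_combination h
  let R : Node → Prop := fun y => IsRemovable lam y ∧ res e κ y = i
  let A : Node → Prop := fun y => IsAddable lam y ∧ res e κ y = i
  have bdd : ∀ y, R y ∨ A y → -B ≤ site y ∧ site y ≤ B := by
    rintro ⟨r, c, a⟩ (⟨h, -⟩ | ⟨h, -⟩)
    · obtain ⟨h1, h2⟩ := bead_of_isRemovable hlam h (s a)
      have h3 := (not_le.1 fun h' => (hB a).2 _ h' h1)
      have h4 := (not_lt.1 fun h' => h2 ((hB a).1 _ h'))
      simp only [site]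
      omega
    · obtain ⟨h1, h2⟩ := bead_of_isAddable hlam h (s a)
      have h3 := (not_le.1 fun h' => (hB a).2 _ h' h2)
      have h4 := (not_lt.1 fun h' => h1 ((hB a).1 _ h'))
      simp only [site]
      omega
  let idx : Node → ℕ := fun y =>
    (((1 + ((y.2.2 : ℕ) : ℤ)) * K * e - site y - j) / e).toNat
  let τ : Node → ℕ := fun y => 2 * idx y + (y.2.2 : ℕ)
  have he0 : (0:ℤ) < e := by omega
  have hidx : ∀ y, R y ∨ A y → site y = (1 + ((y.2.2 : ℕ) : ℤ)) * K * e - j - e * idx y := by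
    intro y hy
    have h1 : (e : ℤ) ∣ (1 + ((y.2.2 : ℕ) : ℤ)) * K * e - site y - j := by
      have h2 := (hsite y).1 (hy.elim (·.2) (·.2))
      rw [sub_sub]
      exact (Dvd.intro_left _ rfl).sub h2
    have h3 : 0 ≤ (1 + ((y.2.2 : ℕ) : ℤ)) * K * e - site y - j := by
      have := (bdd y hy).2
      have : 0 ≤ ((y.2.2 : ℕ) : ℤ) * (K * e) := by positivity
      have : (j : ℤ) < e := by exact_mod_cast hje
      nlinarith
    simp only [idx]
    rw [Int.toNat_of_nonneg (Int.ediv_nonneg h3 he0.le), Int.mul_ediv_cancel' h1]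
    ring
  have hτ2 : ∀ y, τ y / 2 = idx y ∧ τ y % 2 = (y.2.2 : ℕ) := by
    intro y
    have := y.2.2.isLt
    simp only [τ]
    omega
  have hword : ∀ y, R y ∨ A y → word e (abacus e s K lam) j (τ y) =
      sgn (beads lam s y.2.2 (site y)) (beads lam s y.2.2 (site y - 1)) := by
    intro y hy
    simp only [τ]
    rw [word_abacus, ← hidx y hy]
  have hback : ∀ t : ℕ, ∃ (a : Fin 2) (k : ℕ), t = 2 * k + a := fun t =>
    ⟨⟨t % 2, by omega⟩, t / 2, by simp; omega⟩
  have hb : ∀ (r c k : ℕ) (a : Fin 2), (c : ℤ) - r + s a =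
      (1 + ((a : ℕ) : ℤ)) * K * e - j - e * k → res e κ (r, c, a) = i ∧ τ (r, c, a) = 2 * k + a := by
    intro r c k a h
    refine ⟨(hsite _).2 ⟨(1 + ((a : ℕ) : ℤ)) * K - k, by simp only [site]; rw [h]; ring⟩, ?_⟩
    simp only [τ, idx, site]
    rw [h]
    have : (1 + ((a : ℕ) : ℤ)) * K * e - ((1 + ((a : ℕ) : ℤ)) * K * e - j - e * k) - j = e * k := by
      ring
    rw [this, Int.mul_ediv_cancel_left _ (by omega)]
    simp
  have hfin : ∀ a a' : Fin 2, a < a' → (a : ℕ) = 0 ∧ (a' : ℕ) = 1 := by decide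
  have cross : ∀ x y, R x ∨ A x → R y ∨ A y → x.2.2 < y.2.2 → τ x < τ y := by
    intro x y hx hy hxy
    obtain ⟨h0, h1⟩ := hfin _ _ hxy
    have ix := hidx x hx
    have iy := hidx y hy
    have bx := bdd x hx
    have by' := bdd y hy
    rw [h0] at ix
    rw [h1] at iy
    have : (idx x : ℤ) < idx y := by
      have : (e : ℤ) * idx x < e * idx y := by push_cast at ix iy; linarith
      exact lt_of_mul_lt_mul_left this he0.le
    simp only [τ, h0, h1]
    omega
  have same : ∀ x y, R x ∨ A x → R y ∨ A y → x.2.2 = y.2.2 →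
      (x.1 < y.1 ↔ τ x < τ y) ∧ (τ x = τ y → x = y) := by
    rintro ⟨r, c, a⟩ ⟨r', c', a'⟩ hx hy haa
    obtain rfl : a = a' := haa
    have ix := hidx _ hx
    have iy := hidx _ hy
    have hdvd : (e : ℤ) ∣ ((c : ℤ) - r) - (c' - r') := by
      simp only [site] at ix iy
      exact ⟨idx (r', c', a) - idx (r, c, a), by linear_combination ix - iy⟩
    obtain ⟨h1, h2⟩ := row_lt_iff hlam he (hx.imp And.left And.left) (hy.imp And.left And.left) hdvd
    simp only [site] at ix iy
    have h3 : (c' : ℤ) - r' < c - r ↔ idx (r, c, a) < idx (r', c', a) := by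
      have h4 := mul_lt_mul_iff_right₀ (b := (idx (r, c, a) : ℤ)) (c := idx (r', c', a)) he0
      rw [← Int.ofNat_lt, ← h4]
      constructor <;> intro h <;> linarith
    refine ⟨?_, ?_⟩
    · rw [show (r, c, a).1 = r from rfl, show (r', c', a).1 = r' from rfl, h1, h3]
      simp only [τ]
      omega
    · intro h
      have : idx (r, c, a) = idx (r', c', a) := by simp only [τ] at h; omega
      rw [this] at ix
      obtain ⟨rfl, rfl⟩ := h2 (by linarith)
      rfl
  have hall : LastMin (height e (abacus e s K lam) j) (τ (r, c, a)) := by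
    refine lastMin_of_good (R := R) (A := A) (lt := Above) ?_ ?_ ?_ ?_ ?_ ?_ ?_ ⟨hrem, hres⟩ ?_ ?_
    · intro t
      obtain ⟨a, k, rfl⟩ := hback t
      rw [word_abacus]
      rcases sgn_vals (beads lam s a ((1 + (a : ℕ)) * K * e - j - e * k))
        (beads lam s a ((1 + (a : ℕ)) * K * e - j - e * k - 1)) with h | h | h <;> simp [h.1]
    · rintro ⟨r, c, a⟩ hx
      rw [hword _ (.inl hx)]
      obtain ⟨h1, h2⟩ := bead_of_isRemovable hlam hx.1 (s a)
      exact sgn_one (beads_iff.2 h1) (beads_eq_false.2 h2)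
    · rintro ⟨r, c, a⟩ hx
      rw [hword _ (.inr hx)]
      obtain ⟨h1, h2⟩ := bead_of_isAddable hlam hx.1 (s a)
      simp only [site]
      rw [beads_eq_false.2 h1, beads_iff.2 h2]
      simp [sgn]
    · intro t ht
      obtain ⟨a, k, rfl⟩ := hback t
      rw [word_abacus] at ht
      rcases sgn_vals (beads lam s a ((1 + (a : ℕ)) * K * e - j - e * k))
        (beads lam s a ((1 + (a : ℕ)) * K * e - j - e * k - 1)) with h | h | h
      · obtain ⟨r, c, h1, h2⟩ := exists_isRemovable hlam (beads_iff.1 h.2.1) (beads_eq_false.1 h.2.2)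
        obtain ⟨h3, h4⟩ := hb r c k a h2
        exact ⟨_, ⟨h1, h3⟩, h4⟩
      · omega
      · omega
    · intro t ht
      obtain ⟨a, k, rfl⟩ := hback t
      rw [word_abacus] at ht
      rcases sgn_vals (beads lam s a ((1 + (a : ℕ)) * K * e - j - e * k))
        (beads lam s a ((1 + (a : ℕ)) * K * e - j - e * k - 1)) with h | h | h
      · omega
      · obtain ⟨r, c, h1, h2⟩ := exists_isAddable hlam (beads_eq_false.1 h.2.1) (beads_iff.1 h.2.2)
        obtain ⟨h3, h4⟩ := hb r c k a h2
        exact ⟨_, ⟨h1, h3⟩, h4⟩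
      · omega
    · intro x y hx hy
      rcases lt_trichotomy x.2.2 y.2.2 with h | h | h
      · exact ⟨fun _ => cross x y hx hy h, fun _ => .inl h⟩
      · rw [← (same x y hx hy h).1]
        simp [Above, h]
      · have := cross y x hy hx h
        refine ⟨?_, fun h => by omega⟩
        rintro (h' | ⟨h', -⟩)
        · exact absurd h' h.not_gt
        · exact absurd h' h.ne'
    · intro x y hx hy hxy
      rcases lt_trichotomy x.2.2 y.2.2 with h | h | h
      · have := cross x y hx hy h; omega
      · exact (same x y hx hy h).2 hxy
      · have := cross y x hy hx h; omega
    · intro y hy hxy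
      simpa only [A, R, and_assoc] using hnorm y hy.1 hy.2 hxy
    · intro y hy hn
      refine hgood y ⟨hy.1, hy.2, fun z hz hzr hyz => ?_⟩
      simpa only [A, R, and_assoc] using hn z ⟨hz, hzr⟩ hyz
  have hid := hidx (r, c, a) (.inl ⟨hrem, hres⟩)
  have hb1 := bdd (r, c, a) (.inl ⟨hrem, hres⟩)
  have hother : ∀ a', a' ≠ a → beads mu s a' = beads lam s a' := by
    intro a' ha
    have : mu a' = lam a' := by rw [hmu', Function.update_of_ne ha]
    funext b
    simp [beads, this]
  have hsame : ∀ b, b ≠ site (r, c, a) → b ≠ site (r, c, a) - 1 →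
      beads mu s a b = beads lam s a b := by
    intro b h1 h2
    rw [Bool.eq_iff_iff, beads_iff, beads_iff, hmu', Function.update_self, bead_decrease (hlam a) hr1]
    simp only [site] at h1 h2
    simp [h1, h2]
  have hs1 : beads mu s a (site (r, c, a)) = false := by
    rw [beads_eq_false, hmu', Function.update_self, bead_decrease (hlam a) hr1]
    simp only [site]
    omega
  have hs2 : beads mu s a (site (r, c, a) - 1) = true := by
    rw [beads_iff, hmu', Function.update_self, bead_decrease (hlam a) hr1]
    simp only [site]
    simp
  have htop : ∀ a (b : ℤ), B ≤ b → beads lam s a b = false := fun a b hb =>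
    beads_eq_false.2 ((hB a).2 b hb)
  have e2 : (2 : ℤ) ≤ e := by exact_mod_cast he
  have hX : abacus e s K lam 0 = (false, false) := by
    simp only [abacus, conf]
    rw [htop, htop]
    · push_cast; linarith
    · push_cast; linarith
  refine ⟨hX, ?_, j, hje, τ (r, c, a), hall, ?_⟩
  · rw [← hX]
    simp only [abacus, conf]
    clear_value site idx τ j
    match a with
    | 0 =>
      rw [hother 1 (by decide), hsame]
      · push_cast; intro h; linarith
      · push_cast; intro h; linarith
    | 1 =>
      rw [hother 0 (by decide), hsame]
      · push_cast; intro h; linarith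
      · push_cast; intro h; linarith
  · rw [IsShift, (hτ2 _).1, (hτ2 _).2]
    clear_value site idx τ j
    match a with
    | 0 =>
      have e1 : ((K : ℤ) * e - (j + e * idx (r, c, 0) : ℕ)) = site (r, c, 0) := by
        rw [hid]; push_cast; simp; ring
      have e2 : ((K : ℤ) * e - (j + e * idx (r, c, 0) + 1 : ℕ)) = site (r, c, 0) - 1 := by
        rw [hid]; push_cast; simp; ring
      rw [if_pos (by simp)]
      refine ⟨fun m h1 h2 => ?_, ?_, ?_⟩
      · simp only [abacus, conf, hother 1 (by decide)]
        rw [hsame]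
        · rw [← e1]; omega
        · rw [← e2]; omega
      · simp only [abacus, conf, hother 1 (by decide), e1, hs1]
      · simp only [abacus, conf, hother 1 (by decide), e2, hs2]
    | 1 =>
      have e1 : (2 * (K : ℤ) * e - (j + e * idx (r, c, 1) : ℕ)) = site (r, c, 1) := by
        rw [hid]; push_cast; simp; ring
      have e2 : (2 * (K : ℤ) * e - (j + e * idx (r, c, 1) + 1 : ℕ)) = site (r, c, 1) - 1 := by
        rw [hid]; push_cast; simp; ring
      rw [if_neg (by simp)]
      refine ⟨fun m h1 h2 => ?_, ?_, ?_⟩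
      · simp only [abacus, conf, hother 0 (by decide)]
        rw [hsame]
        · rw [← e1]; omega
        · rw [← e2]; omega
      · simp only [abacus, conf, hother 0 (by decide), e1, hs1]
      · simp only [abacus, conf, hother 0 (by decide), e2, hs2]

theorem eqvGen_abacus {e : ℕ} (he : 2 ≤ e) {κ : Fin 2 → ZMod e} {s : Fin 2 → ℤ}
    (hs : ∀ a, (s a : ZMod e) = κ a) {lam mu : Fin 2 → ℕ → ℕ}
    (h : Relation.EqvGen (RemGood e κ) lam mu) :
    ∃ K₀, ∀ K, K₀ ≤ K → Relation.EqvGen (TopMove e) (abacus e s K lam) (abacus e s K mu) := by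
  induction h with
  | rel x y h =>
    obtain ⟨K, hK⟩ := h.topMove he hs
    exact ⟨K, fun k hk => .symm _ _ (.rel _ _ (hK k hk))⟩
  | refl x => exact ⟨0, fun k _ => .refl _⟩
  | symm x y _ h =>
    obtain ⟨K, hK⟩ := h
    exact ⟨K, fun k hk => .symm _ _ (hK k hk)⟩
  | trans x y z _ _ h1 h2 =>
    obtain ⟨K, hK⟩ := h1
    obtain ⟨L, hL⟩ := h2
    exact ⟨max K L, fun k hk => .trans _ _ _ (hK k (le_of_max_le_left hk))
      (hL k (le_of_max_le_right hk))⟩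

theorem bead_zero (s b : ℤ) : Bead (fun _ => 0) s b ↔ b < s := by
  constructor
  · rintro ⟨r, hr⟩
    push_cast at hr; omega
  · intro h
    obtain ⟨r, hr⟩ := Int.eq_ofNat_of_zero_le (show 0 ≤ s - 1 - b by omega)
    exact ⟨r, by push_cast; omega⟩

theorem not_isRestricted {e : ℕ} (he : 2 ≤ e) {κ : Fin 2 → ZMod e} {s : Fin 2 → ℤ}
    (hs : ∀ a, (s a : ZMod e) = κ a) (hs' : s 1 ≤ s 0 + e) {lam : Fin 2 → ℕ → ℕ}
    (hlam : IsBipartition lam)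
    (hflush : ∀ b, Bead (lam 0) (s 0) b ∨ Bead (lam 1) (s 1) b →
      Bead (lam 0) (s 0) (b - e) ∧ Bead (lam 1) (s 1) (b - e))
    {p q : ℤ} (hp : Bead (lam 0) (s 0) p ∧ ¬ Bead (lam 1) (s 1) p)
    (hq : ¬ Bead (lam 0) (s 0) q ∧ Bead (lam 1) (s 1) q)
    (hpq : ∀ p q, Bead (lam 0) (s 0) p → ¬ Bead (lam 1) (s 1) p → ¬ Bead (lam 0) (s 0) q →
      Bead (lam 1) (s 1) q → q < p) : ¬ IsRestricted e κ lam := by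
  intro h
  obtain ⟨K₀, hK⟩ := eqvGen_abacus he hs h
  obtain ⟨B, hB⟩ := exists_beads_bound hlam s
  replace hB := hB B le_rfl
  set K := K₀ + B + (s 0).natAbs with hKdef
  have hKe : (K : ℤ) ≤ K * e := by exact_mod_cast Nat.le_mul_of_pos_right K (by omega)
  have hdown : ∀ (k : ℕ) (b : ℤ), 0 < k → Bead (lam 1) (s 1) b →
      Bead (lam 0) (s 0) (b - k * e) ∧ Bead (lam 1) (s 1) (b - k * e) := by
    intro k b hk hb
    induction k, hk using Nat.le_induction with
    | base => simpa using hflush b (.inr hb)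
    | succ k hk ih =>
      have := hflush _ (.inr ih.2)
      rw [show b - (k + 1 : ℕ) * e = b - k * e - e by push_cast; ring]
      exact this
  refine not_eqvGen_conf (s₀ := s 0) (s₁ := s 1) (by omega) ?_ ?_ hs' ?_ ?_ ?_ ?_
    (p := p) (q := q) ?_ ?_ ?_ (hK K (by omega))
  · intro b; rw [beads_iff]; exact bead_zero _ _
  · intro b; rw [beads_iff]; exact bead_zero _ _
  · omega
  · intro b k hk hb
    rw [beads_iff] at hb ⊢
    exact (hdown k b hk hb).1
  · intro b hb
    exact beads_eq_false.2 ((hB 0).2 b (by omega))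
  · intro b hb
    exact beads_eq_false.2 ((hB 1).2 b (by linarith [show (B:ℤ) ≤ K by omega]))
  · simpa [beads] using hp
  · simpa [beads] using hq
  · simpa [beads] using hpq

/-- Every bead has beads directly above it on both abacuses. -/
def Flush (e : ℕ) (U V : ℤ → Prop) : Prop := ∀ b, U b ∨ V b → U (b - e) ∧ V (b - e)

theorem Flush.of_dvd {e : ℕ} {U V : ℤ → Prop} (h : Flush e U V) (he : 0 < e) {b y : ℤ}
    (hb : U b ∨ V b) (hy : y < b) (hd : (e : ℤ) ∣ b - y) : U y ∧ V y := by
  obtain ⟨k, hk⟩ := hd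
  have he' : (0 : ℤ) < e := by exact_mod_cast he
  have hk0 : 0 < k := by
    by_contra hc
    have : (e : ℤ) * k ≤ 0 := mul_nonpos_of_nonneg_of_nonpos he'.le (by omega)
    omega
  obtain ⟨n, rfl⟩ := Int.eq_ofNat_of_zero_le hk0.le
  have key : ∀ n : ℕ, 0 < n → U (b - e * n) ∧ V (b - e * n) := by
    intro n hn
    induction n, hn using Nat.le_induction with
    | base => simpa using h b hb
    | succ n hn ih =>
      have := h _ (.inl ih.1)
      rwa [show b - e * (n + 1 : ℕ) = b - e * n - e by push_cast; ring]
  have := key n (by omega)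
  rwa [show b - e * n = y by linarith] at this

/-- `W'` is obtained from `W` by moving beads from the positions in `I` one step up. -/
def Sorted (I : ℤ → Prop) (W W' : ℤ → Prop) : Prop :=
  ∀ z, (I z → (W' z ↔ W z ∧ W (z - 1))) ∧ (I (z + 1) → (W' z ↔ W (z + 1) ∨ W z)) ∧
    (¬ I z → ¬ I (z + 1) → (W' z ↔ W z))

open Classical in
/-- The lower end of the block containing `z`. -/
noncomputable def base (I : ℤ → Prop) (z : ℤ) : ℤ := if I z then z - 1 else z

theorem base_eq {I : ℤ → Prop} {p q : ℤ} (h : base I p = base I q) :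
    p = q ∨ (I p ∧ q = p - 1) ∨ (I q ∧ p = q - 1) := by
  unfold base at h
  split_ifs at h with h1 h2 h2
  · left; omega
  · right; left; exact ⟨h1, by omega⟩
  · right; right; exact ⟨h2, by omega⟩
  · left; omega

theorem base_sub_one {I : ℤ → Prop} (hI : ∀ z, I z → ¬ I (z - 1)) {z : ℤ} (h : I z) :
    base I (z - 1) = base I z := by
  simp [base, h, hI z h]

theorem lt_of_base {I : ℤ → Prop} {p q p' q' : ℤ} (hpq : p < q) (h : base I p ≠ base I q)
    (hp : base I p' = base I p) (hq : base I q' = base I q) : p' < q' := by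
  by_contra hc
  have h1 : base I p < base I q := by
    unfold base at *
    split_ifs at * <;> omega
  rw [← hp, ← hq] at h1
  have : p' = q' := by
    unfold base at h1
    split_ifs at h1 <;> omega
  rw [this] at h1
  exact lt_irrefl _ h1

theorem Sorted.mem_of_left {I : ℤ → Prop} (hI : ∀ z, I z → ¬ I (z - 1)) {U V U' V' : ℤ → Prop}
    (hU : Sorted I U U') (hV : Sorted I V V') {p : ℤ} (hp : U' p ∧ ¬ V' p) :
    ∃ p', base I p' = base I p ∧ U p' ∧ ¬ V p' := by
  by_cases h1 : I p
  · rw [(hU p).1 h1, (hV p).1 h1] at hp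
    by_cases hv : V p
    · exact ⟨p - 1, base_sub_one hI h1, hp.1.2, fun h => hp.2 ⟨hv, h⟩⟩
    · exact ⟨p, rfl, hp.1.1, hv⟩
  · by_cases h2 : I (p + 1)
    · rw [(hU p).2.1 h2, (hV p).2.1 h2] at hp
      rcases hp.1 with h | h
      · refine ⟨p + 1, ?_, h, fun h => hp.2 (.inl h)⟩
        rw [← base_sub_one hI h2]; congr 1; ring
      · exact ⟨p, rfl, h, fun h => hp.2 (.inr h)⟩
    · rw [(hU p).2.2 h1 h2, (hV p).2.2 h1 h2] at hp
      exact ⟨p, rfl, hp⟩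

theorem Sorted.subsingleton {I : ℤ → Prop} (hI : ∀ z, I z → ¬ I (z - 1)) {U V U' V' : ℤ → Prop}
    (hU : Sorted I U U') (hV : Sorted I V V')
    (h : ∀ p p', U p ∧ ¬ V p → U p' ∧ ¬ V p' → p = p') (p p' : ℤ) (hp : U' p ∧ ¬ V' p)
    (hp' : U' p' ∧ ¬ V' p') : p = p' := by
  obtain ⟨x, hx, hx'⟩ := hU.mem_of_left hI hV hp
  obtain ⟨y, hy, hy'⟩ := hU.mem_of_left hI hV hp'
  obtain rfl := h x y hx' hy'
  have key : ∀ p, I p → U' p ∧ ¬ V' p → U' (p - 1) ∧ ¬ V' (p - 1) → False := by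
    intro p h1 hp hp'
    have h2 : I (p - 1 + 1) := by simpa using h1
    rw [(hU _).1 h1, (hV _).1 h1] at hp
    rw [(hU _).2.1 h2, (hV _).2.1 h2] at hp'
    simp only [sub_add_cancel, not_or] at hp'
    have := h p (p - 1) ⟨hp.1.1, hp'.2.1⟩ ⟨hp.1.2, hp'.2.2⟩
    omega
  rcases base_eq (hx.symm.trans hy) with h | ⟨h1, rfl⟩ | ⟨h1, rfl⟩
  · exact h
  · exact (key _ h1 hp hp').elim
  · exact (key _ h1 hp' hp).elim

theorem Sorted.exists_left {I : ℤ → Prop} (hI : ∀ z, I z → ¬ I (z - 1)) {U V U' V' : ℤ → Prop}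
    (hU : Sorted I U U') (hV : Sorted I V V') {p : ℤ} (hp : U p ∧ ¬ V p)
    (hn : ∀ q, base I q = base I p → V q → U q) : ∃ p', base I p' = base I p ∧ U' p' ∧ ¬ V' p' := by
  by_cases h1 : I p
  · have h0 := hn (p - 1) (base_sub_one hI h1)
    have h2 : I (p - 1 + 1) := by simpa using h1
    have a1 := (hU p).1 h1
    have a2 := (hV p).1 h1
    have b1 := (hU (p - 1)).2.1 h2
    have b2 := (hV (p - 1)).2.1 h2
    simp only [sub_add_cancel] at b1 b2
    by_cases hu : U (p - 1)
    · exact ⟨p, rfl, by tauto, by tauto⟩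
    · exact ⟨p - 1, base_sub_one hI h1, by tauto, by tauto⟩
  · by_cases h2 : I (p + 1)
    · have hb : base I (p + 1) = base I p := by
        rw [← base_sub_one hI h2]; congr 1; ring
      have h0 := hn (p + 1) hb
      have b1 := (hU p).2.1 h2
      have b2 := (hV p).2.1 h2
      have a1 := (hU (p + 1)).1 h2
      have a2 := (hV (p + 1)).1 h2
      simp only [add_sub_cancel_right] at a1 a2
      by_cases hu : U (p + 1)
      · exact ⟨p + 1, hb, by tauto, by tauto⟩
      · exact ⟨p, rfl, by tauto, by tauto⟩
    · rw [← (hU p).2.2 h1 h2, ← (hV p).2.2 h1 h2] at hp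
      exact ⟨p, rfl, hp⟩

theorem Sorted.not_of_both {I : ℤ → Prop} (hI : ∀ z, I z → ¬ I (z - 1)) {U V U' V' : ℤ → Prop}
    (hU : Sorted I U U') (hV : Sorted I V V') {p q : ℤ} (hp : U p ∧ ¬ V p) (hq : V q ∧ ¬ U q)
    (hb : base I p = base I q) : (∀ x, base I x = base I p → (U' x ↔ V' x)) := by
  have key : ∀ z, I z → (U z ∧ ¬ V z ∧ V (z - 1) ∧ ¬ U (z - 1)) ∨
      (V z ∧ ¬ U z ∧ U (z - 1) ∧ ¬ V (z - 1)) → ∀ x, x = z ∨ x = z - 1 → (U' x ↔ V' x) := by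
    intro z hz h x hx
    have h2 : I (z - 1 + 1) := by simpa using hz
    have a1 := (hU z).1 hz
    have a2 := (hV z).1 hz
    have b1 := (hU (z - 1)).2.1 h2
    have b2 := (hV (z - 1)).2.1 h2
    simp only [sub_add_cancel] at b1 b2
    rcases hx with rfl | rfl
    · rw [a1, a2]; tauto
    · rw [b1, b2]; tauto
  intro x hx
  rcases base_eq hb with h | ⟨h1, rfl⟩ | ⟨h1, rfl⟩
  · rw [h] at hp; exact absurd hp.1 hq.2
  · refine key p h1 (.inl (by tauto)) x ?_
    rcases base_eq hx with h | ⟨h3, h4⟩ | ⟨h3, h4⟩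
    · exact .inl h
    · exact absurd h1 (by rw [h4]; exact hI _ h3)
    · exact .inr h4
  · refine key q h1 (.inr (by tauto)) x ?_
    rw [base_sub_one hI h1] at hx
    rcases base_eq hx with h | ⟨h3, h4⟩ | ⟨h3, h4⟩
    · exact .inl h
    · exact absurd h1 (by rw [h4]; exact hI _ h3)
    · exact .inr h4

/-- The bead configurations from which the empty bipartition can be reached. -/
structure Reducible (e : ℕ) (U V : ℤ → Prop) : Prop where
  flush : Flush e U V
  subsingleton : (∀ p p', U p ∧ ¬ V p → U p' ∧ ¬ V p' → p = p') ∨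
    ∀ q q', V q ∧ ¬ U q → V q' ∧ ¬ U q' → q = q'
  exists_lt : ∀ p q, U p ∧ ¬ V p → V q ∧ ¬ U q →
    ∃ p q, (U p ∧ ¬ V p) ∧ (V q ∧ ¬ U q) ∧ p < q

theorem Reducible.sorted {e : ℕ} {U V U' V' : ℤ → Prop} (h : Reducible e U V)
    {I : ℤ → Prop} (hI : ∀ z, I z → ¬ I (z - 1)) (hIe : ∀ z, I (z - e) ↔ I z)
    (hU : Sorted I U U') (hV : Sorted I V V') : Reducible e U' V' where
  flush := by
    intro b hb
    have f0 := h.flush b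
    by_cases h1 : I b
    · have f1 := h.flush (b - 1)
      rw [show b - 1 - (e : ℤ) = b - e - 1 by ring] at f1
      rw [(hU _).1 h1, (hV _).1 h1] at hb
      rw [(hU _).1 ((hIe b).2 h1), (hV _).1 ((hIe b).2 h1)]
      tauto
    · by_cases h2 : I (b + 1)
      · have f1 := h.flush (b + 1)
        have h3 : I (b - e + 1) := by
          rw [show b - (e : ℤ) + 1 = b + 1 - e by ring]; exact (hIe _).2 h2
        rw [show b + 1 - (e : ℤ) = b - e + 1 by ring] at f1
        rw [(hU _).2.1 h2, (hV _).2.1 h2] at hb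
        rw [(hU _).2.1 h3, (hV _).2.1 h3]
        tauto
      · have h3 : ¬ I (b - e + 1) := by
          rw [show b - (e : ℤ) + 1 = b + 1 - e by ring]; exact (hIe _).not.2 h2
        have h4 := (hIe b).not.2 h1
        rw [(hU _).2.2 h1 h2, (hV _).2.2 h1 h2] at hb
        rw [(hU _).2.2 h4 h3, (hV _).2.2 h4 h3]
        exact f0 hb
  subsingleton := h.subsingleton.imp (Sorted.subsingleton hI hU hV) (Sorted.subsingleton hI hV hU)
  exists_lt := by
    intro p' q' hp' hq'
    obtain ⟨p, bp, hp⟩ := hU.mem_of_left hI hV hp'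
    obtain ⟨q, bq, hq⟩ := hV.mem_of_left hI hU hq'
    obtain ⟨x, y, hx, hy, hxy⟩ := h.exists_lt p q hp hq
    rcases h.subsingleton with hs | hs
    · obtain rfl := hs p x hp hx
      have hb : base I p ≠ base I y := fun hb => hp'.2 <|
        (Sorted.not_of_both hI hU hV hp hy hb p' bp.symm).1 hp'.1
      obtain ⟨y', by', hy'⟩ := hV.exists_left hI hU hy fun z hz huz => by
        by_contra hvz
        rw [hs z p ⟨huz, hvz⟩ hp] at hz
        exact hb hz
      exact ⟨p', y', hp', hy', lt_of_base hxy hb bp.symm by'⟩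
    · obtain rfl := hs q y hq hy
      have hb : base I x ≠ base I q := fun hb => hq'.2 <|
        (Sorted.not_of_both hI hU hV hx hq hb q' (bq.symm.trans hb.symm)).2 hq'.1
      obtain ⟨x', bx, hx'⟩ := hU.exists_left hI hV hx fun z hz huz => by
        by_contra hvz
        rw [hs z q ⟨huz, hvz⟩ hq] at hz
        exact hb hz.symm
      exact ⟨x', q', hx', hq', lt_of_base hxy hb bx bq.symm⟩

theorem exists_step {W : ℤ → Prop} {x q : ℤ} (hxq : x < q) (hx : ¬ W x) (hq : W q) :
    ∃ y, x < y ∧ y ≤ q ∧ W y ∧ ¬ W (y - 1) := by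
  obtain ⟨n, hn⟩ := Int.eq_ofNat_of_zero_le (sub_nonneg.2 hxq.le)
  obtain rfl : q = x + n := by omega
  clear hn
  induction n with
  | zero => omega
  | succ n ih =>
    by_cases h : W (x + n)
    · have : x < x + n := by
        rcases n with _ | n
        · simp at h; contradiction
        · push_cast; omega
      obtain ⟨y, h1, h2, h3⟩ := ih this h
      exact ⟨y, h1, by push_cast; omega, h3⟩
    · refine ⟨_, hxq, le_rfl, hq, ?_⟩
      rwa [show x + (n + 1 : ℕ) - 1 = x + n by push_cast; ring]

/-- A step which can be undone in a residue without obstruction. -/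
theorem Reducible.exists_step {e : ℕ} (he : 0 < e) {U V : ℤ → Prop} (h : Reducible e U V) {x : ℤ}
    (hx : U x ∧ ¬ V x) (hx' : V (x - 1) ∧ ¬ U (x - 1)) :
    ∃ y, V y ∧ ¬ V (y - 1) ∧
      ∀ x', U x' ∧ ¬ V x' → V (x' - 1) ∧ ¬ U (x' - 1) → ¬ (e : ℤ) ∣ x' - y := by
  obtain ⟨p, q, hp, hq, hpq⟩ := h.exists_lt _ _ hx hx'
  rcases h.subsingleton with hs | hs
  · obtain rfl := hs x p hx hp
    obtain ⟨y, h1, -, h3, h4⟩ := Wt3.exists_step hpq hx.2 hq.1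
    refine ⟨y, h3, h4, fun x' a b hd => hx.2 ?_⟩
    rw [hs x' x a hx, ← dvd_neg, neg_sub] at hd
    exact (h.flush.of_dvd he (.inr h3) h1 hd).2
  · obtain rfl := hs (x - 1) q hx' hq
    obtain ⟨y, h1, h2, h3, h4⟩ := Wt3.exists_step hpq hp.2 hq.1
    refine ⟨y, h3, h4, fun x' a b hd => h4 ?_⟩
    have := hs _ _ b hx'
    obtain rfl : x' = x := by omega
    refine (h.flush.of_dvd he (.inr hq.1) (by omega) ?_).2
    rwa [show x' - 1 - (y - 1) = x' - y by ring]

theorem finite_diagram {lam : Fin 2 → ℕ → ℕ} (hlam : IsBipartition lam) : (Diagram lam).Finite := by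
  have h : ∀ a, ∃ N, ∀ r, N ≤ r → lam a r = 0 := fun a => (hlam a).2
  choose N hN using h
  refine Set.Finite.subset (s := Set.Iio (N 0 + N 1) ×ˢ (Set.Iio (lam 0 0 + lam 1 0) ×ˢ Set.univ))
    ((Set.finite_Iio _).prod ((Set.finite_Iio _).prod Set.finite_univ)) ?_
  rintro ⟨r, c, a⟩ hx
  change c < lam a r at hx
  have h1 : r < N a := by
    by_contra hc
    have := hN a r (by omega)
    omega
  have h2 := (hlam a).anti (Nat.zero_le r)
  refine ⟨?_, ?_, trivial⟩ <;> simp only [Set.mem_Iio] <;> fin_cases a <;> simp at * <;> omega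

theorem res_eq_cast {e : ℕ} {κ : Fin 2 → ZMod e} {s : Fin 2 → ℤ} (hs : ∀ a, (s a : ZMod e) = κ a)
    (r c : ℕ) (a : Fin 2) : res e κ (r, c, a) = (((c : ℤ) - r + s a : ℤ) : ZMod e) := by
  simp [res, hs]

theorem cast_sub_one_ne {e : ℕ} (he : 2 ≤ e) {i : ZMod e} {z : ℤ} (h : (z : ZMod e) = i) :
    ((z - 1 : ℤ) : ZMod e) ≠ i := by
  have : Fact (1 < e) := ⟨by omega⟩
  intro h'
  push_cast at h'
  rw [h, sub_eq_self] at h'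
  exact one_ne_zero h'

theorem Sorted.trans_single {I W W₁ W₂ : ℤ → Prop} (hI : ∀ z, I z → ¬ I (z - 1)) {b : ℤ} (hb : I b)
    (hWb : W b) (hWb' : ¬ W (b - 1)) (hW₁ : ∀ z, W₁ z ↔ (W z ∧ z ≠ b) ∨ z = b - 1)
    (h : Sorted I W₁ W₂) : Sorted I W W₂ := by
  intro z
  obtain ⟨h1, h2, h3⟩ := h z
  have hI' : ¬ I (b + 1) := fun h => hI _ h (by simpa using hb)
  refine ⟨fun hz => ?_, fun hz => ?_, fun hz hz' => ?_⟩
  · rw [h1 hz, hW₁, hW₁]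
    by_cases hzb : z = b
    · subst hzb
      simp [hWb', show ¬ z = z - 1 by omega]
    · have h4 : z ≠ b - 1 := by rintro rfl; exact hI _ hb hz
      have h5 : z - 1 ≠ b := by
        intro h; apply hI'; rwa [← h, sub_add_cancel]
      have h6 : z - 1 ≠ b - 1 := by omega
      simp [hzb, h4, h5]
  · rw [h2 hz, hW₁, hW₁]
    by_cases hzb : z + 1 = b
    · obtain rfl : z = b - 1 := by omega
      simp [hWb]
    · have h4 : z ≠ b - 1 := by omega
      have h5 : z ≠ b := by
        rintro rfl; exact hI' hz
      have h6 : z + 1 ≠ b - 1 := by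
        intro h; rw [h] at hz; exact hI _ hb hz
      simp [hzb, h4, h5, h6]
  · have h4 : z ≠ b := by rintro rfl; exact hz hb
    have h5 : z ≠ b - 1 := by rintro rfl; exact hz' (by simpa using hb)
    rw [h3 hz hz', hW₁]
    simp [h4, h5]

/-- The highest removable node of a given residue is good when there is no addable node of that
residue below it. -/
theorem isGood_of_highest {e : ℕ} {κ : Fin 2 → ZMod e} {lam : Fin 2 → ℕ → ℕ} {i : ZMod e} {x : Node}
    (hx : IsRemovable lam x) (hxi : res e κ x = i)
    (hmax : ∀ y, IsRemovable lam y → res e κ y = i → y = x ∨ Above x y)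
    (hadd : ∀ y, IsAddable lam y → res e κ y = i → ¬ Above x y) : IsGood e κ lam i x :=
  ⟨⟨hx, hxi, fun y hy hyi hxy => absurd hxy (hadd y hy hyi)⟩, fun y hy => hmax y hy.1 hy.2.1⟩

theorem exists_highest {lam : Fin 2 → ℕ → ℕ} (hlam : IsBipartition lam) {S : Set Node}
    (hS : ∀ x ∈ S, IsRemovable lam x) (hne : S.Nonempty) :
    ∃ x ∈ S, ∀ y ∈ S, y = x ∨ Above x y := by
  obtain ⟨x, hx, hmin⟩ := (InvImage.wf (fun x : Node => toLex (x.2.2, x.1))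
    (wellFounded_lt : WellFounded ((· < ·) : Fin 2 ×ₗ ℕ → _ → Prop))).has_min S hne
  refine ⟨x, hx, fun y hy => ?_⟩
  have h1 : ¬ toLex (y.2.2, y.1) < toLex (x.2.2, x.1) := hmin y hy
  obtain ⟨r, c, a⟩ := x
  obtain ⟨r', c', a'⟩ := y
  have hx' := (isRemovable_iff hlam).1 (hS _ hx)
  have hy' := (isRemovable_iff hlam).1 (hS _ hy)
  rw [Prod.Lex.toLex_lt_toLex] at h1
  simp only [Above, not_or, not_and, not_lt] at h1 ⊢
  rcases h1.1.lt_or_eq with h | h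
  · exact .inr (.inl h)
  · subst h
    rcases (h1.2 rfl).lt_or_eq with h | h
    · exact .inr (.inr ⟨rfl, h⟩)
    · subst h
      left
      have : c' = c := by omega
      rw [this]

theorem exists_removeAll {e : ℕ} (he : 2 ≤ e) {κ : Fin 2 → ZMod e} {s : Fin 2 → ℤ}
    (hs : ∀ a, (s a : ZMod e) = κ a) (i : ZMod e) {lam : Fin 2 → ℕ → ℕ} (hlam : IsBipartition lam)
    (H : ∀ x y, IsRemovable lam x → res e κ x = i → IsAddable lam y → res e κ y = i → ¬ Above x y) :
    ∃ mu, IsBipartition mu ∧ Relation.EqvGen (RemGood e κ) lam mu ∧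
      (∀ a, Sorted (fun z => (z : ZMod e) = i) (Bead (lam a) (s a)) (Bead (mu a) (s a))) ∧
      (Diagram mu).ncard ≤ (Diagram lam).ncard ∧
      ((∃ x, IsRemovable lam x ∧ res e κ x = i) → (Diagram mu).ncard < (Diagram lam).ncard) := by
  induction hn : (Diagram lam).ncard using Nat.strong_induction_on generalizing lam with
  | _ n ih =>
  subst hn
  by_cases hne : ∃ x, IsRemovable lam x ∧ res e κ x = i
  swap
  · refine ⟨lam, hlam, .refl _, fun a z => ?_, le_rfl, fun h => absurd h hne⟩
    have key : ∀ z : ℤ, (z : ZMod e) = i → Bead (lam a) (s a) z → Bead (lam a) (s a) (z - 1) := by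
      intro z hz h
      by_contra hc
      obtain ⟨r, c, hr, hrc⟩ := exists_isRemovable hlam h hc
      exact hne ⟨_, hr, by rw [res_eq_cast hs, hrc, hz]⟩
    refine ⟨fun hz => ⟨fun h => ⟨h, key z hz h⟩, fun h => h.1⟩, fun hz => ⟨.inr, ?_⟩,
      fun _ _ => Iff.rfl⟩
    rintro (h | h)
    · simpa using key _ hz h
    · exact h
  obtain ⟨⟨r, c, a⟩, ⟨hx, hxi⟩, hmax⟩ := exists_highest hlam
    (S := {x | IsRemovable lam x ∧ res e κ x = i}) (fun x hx => hx.1) hne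
  have hgood : IsGood e κ lam i (r, c, a) := isGood_of_highest hx hxi
    (fun y hy hyi => hmax y ⟨hy, hyi⟩) fun y hy hyi => H _ y hx hxi hy hyi
  obtain ⟨hr, hr'⟩ := (isRemovable_iff hlam).1 hx
  set mu := Function.update lam a (Function.update (lam a) r c) with hmu
  have hmub : IsBipartition mu := hlam.update ((hlam a).decrease hr hr')
  have hdiag : Diagram mu = Diagram lam \ {(r, c, a)} := diagram_decrease hr
  have hlt : (Diagram mu).ncard < (Diagram lam).ncard := by
    rw [hdiag]
    exact Set.ncard_sdiff_singleton_lt_of_mem hx.1 (finite_diagram hlam)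
  have hres := res_eq_cast hs
  have hne1 : ∀ {z w : ℤ}, (z : ZMod e) = i → (w : ZMod e) = i → w ≠ z - 1 := by
    rintro z w hz hw rfl
    exact cast_sub_one_ne he hz hw
  have hrem : ∀ y, IsRemovable mu y → res e κ y = i → IsRemovable lam y ∧ y ≠ (r, c, a) := by
    rintro ⟨r', c', a'⟩ hy hyi
    have hyd := hy.1
    rw [isRemovable_iff hmub] at hy
    rw [hres] at hyi hxi
    have h1 := hne1 hxi hyi
    have h2 := hne1 hyi hxi
    refine ⟨(isRemovable_iff hlam).2 ?_, ?_⟩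
    · by_cases ha : a' = a
      · subst ha
        simp only [hmu, Function.update_self] at hy
        by_cases hrr : r' = r
        · subst hrr
          simp only [Function.update_self] at hy
          omega
        · rw [Function.update_of_ne hrr] at hy
          by_cases hrr' : r' + 1 = r
          · subst hrr'
            simp only [Function.update_self] at hy
            push_cast at h1 h2
            omega
          · rwa [Function.update_of_ne hrr'] at hy
      · simpa only [hmu, Function.update_of_ne ha] using hy
    · rintro h
      rw [hdiag, h] at hyd
      exact hyd.2 rfl
  have hadd : ∀ y, IsAddable mu y → res e κ y = i → IsAddable lam y ∨ y = (r, c, a) := by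
    rintro ⟨r', c', a'⟩ hy hyi
    rw [isAddable_iff hmub] at hy
    rw [isAddable_iff hlam]
    by_cases ha : a' = a
    · subst ha
      simp only [hmu, Function.update_self] at hy
      by_cases hrr : r' = r
      · subst hrr
        simp only [Function.update_self] at hy
        right
        rw [hy.1]
      · rw [Function.update_of_ne hrr] at hy
        left
        refine ⟨hy.1, fun k hk => ?_⟩
        have := hy.2 k hk
        by_cases hkr : k = r
        · subst hkr
          rw [Function.update_self] at this
          omega
        · rwa [Function.update_of_ne hkr] at this
    · left
      simpa only [hmu, Function.update_of_ne ha] using hy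
  obtain ⟨nu, hnu, heq, hsort, hle, -⟩ := ih _ hlt hmub (by
    intro x y hx' hxi' hy hyi hxy
    obtain ⟨h1, h2⟩ := hrem x hx' hxi'
    rcases hadd y hy hyi with h | rfl
    · exact H x y h1 hxi' h hyi hxy
    · rcases hmax x ⟨h1, hxi'⟩ with h | h
      · exact h2 h
      · simp only [Above] at h hxy
        omega) rfl
  refine ⟨nu, hnu, .trans _ _ _ (.symm _ _ (.rel _ _ ⟨hmub, hlam, i, _, hgood, hdiag⟩)) heq,
    fun a' => ?_, hle.trans hlt.le, fun _ => hle.trans_lt hlt⟩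
  by_cases ha : a' = a
  · subst ha
    obtain ⟨h1, h2⟩ := bead_of_isRemovable hlam hx (s a')
    rw [hres] at hxi
    refine Sorted.trans_single (fun z => cast_sub_one_ne he) hxi h1 h2 (fun z => ?_) (hsort a')
    simp only [hmu, Function.update_self]
    exact bead_decrease (hlam a') hr _ z
  · have := hsort a'
    simpa only [hmu, Function.update_of_ne ha] using this

theorem eq_zero_of_not_isRemovable {lam : Fin 2 → ℕ → ℕ} (hlam : IsBipartition lam)
    (h : ∀ x, ¬ IsRemovable lam x) : lam = fun _ _ => 0 := by
  funext a r
  have h1 : ∀ r, lam a r ≤ lam a (r + 1) := by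
    intro r
    by_contra hc
    refine h (r, lam a r - 1, a) ((isRemovable_iff hlam).2 ?_)
    omega
  obtain ⟨N, hN⟩ := (hlam a).2
  have h2 := monotone_nat_of_le_succ h1 (Nat.le_add_right r N)
  have := hN (r + N) (by omega)
  omega

theorem Reducible.isRestricted {e : ℕ} (he : 2 ≤ e) {κ : Fin 2 → ZMod e} {s : Fin 2 → ℤ}
    (hs : ∀ a, (s a : ZMod e) = κ a) {lam : Fin 2 → ℕ → ℕ} (hlam : IsBipartition lam)
    (h : Reducible e (Bead (lam 0) (s 0)) (Bead (lam 1) (s 1))) : IsRestricted e κ lam := by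
  induction hn : (Diagram lam).ncard using Nat.strong_induction_on generalizing lam with
  | _ n ih =>
  subst hn
  set U := Bead (lam 0) (s 0) with hU
  set V := Bead (lam 1) (s 1) with hV
  have he0 : 0 < e := by omega
  by_cases hnb : ∃ i, (∃ x, IsRemovable lam x ∧ res e κ x = i) ∧
      ∀ b : ℤ, (b : ZMod e) = i → U b → ¬ V b → V (b - 1) → U (b - 1)
  · obtain ⟨i, hi, hnb⟩ := hnb
    obtain ⟨mu, hmu, heq, hsort, -, hlt⟩ := exists_removeAll he hs i hlam (by
      rintro ⟨r, c, a⟩ ⟨r', c', a'⟩ hx hxi hy hyi hxy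
      rw [res_eq_cast hs] at hxi hyi
      obtain ⟨hx1, hx2⟩ := bead_of_isRemovable hlam hx (s a)
      obtain ⟨hy1, hy2⟩ := bead_of_isAddable hlam hy (s a')
      set p : ℤ := (c : ℤ) - r + s a with hp
      set q : ℤ := (c' : ℤ) - r' + s a' with hq
      have hpq : (e : ℤ) ∣ p - q := (ZMod.intCast_eq_intCast_iff_dvd_sub _ _ _).1 (hyi.trans hxi.symm)
      have hpq' : (e : ℤ) ∣ q - 1 - (p - 1) := by
        rw [show q - 1 - (p - 1) = -(p - q) by ring]; exact (dvd_neg).2 hpq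
      simp only [Above] at hxy
      rcases hxy with hxy | ⟨haa, hxy⟩
      · obtain ⟨rfl, rfl⟩ : a = 0 ∧ a' = 1 := by omega
        rcases lt_trichotomy p q with h1 | h1 | h1
        · exact hx2 (h.flush.of_dvd he0 (.inr hy2) (by omega) hpq').1
        · rw [← h1] at hy1 hy2
          exact hx2 (hnb p hxi hx1 hy1 hy2)
        · exact hy1 (h.flush.of_dvd he0 (.inl hx1) h1 hpq).2
      · subst haa
        have h1 := (row_lt_iff hlam he (.inl hx) (.inr hy) (by
          rw [show (c : ℤ) - r - (c' - r') = p - q by rw [hp, hq]; ring]; exact hpq)).1.1 hxy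
        have h2 : q < p := by omega
        fin_cases a
        · exact hy1 (h.flush.of_dvd he0 (.inl hx1) h2 hpq).1
        · exact hy1 (h.flush.of_dvd he0 (.inr hx1) h2 hpq).2)
    refine .trans _ _ _ heq (ih _ (hlt hi) hmu (h.sorted (fun z => cast_sub_one_ne he) ?_
      (hsort 0) (hsort 1)) rfl)
    intro z
    simp
  · have h0 : lam = fun _ _ => 0 := by
      refine eq_zero_of_not_isRemovable hlam fun x hx => hnb ?_
      by_contra hc
      push Not at hc
      obtain ⟨b, -, hb1, hb2, hb3, hb4⟩ := hc _ ⟨x, hx, rfl⟩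
      obtain ⟨y, hy1, hy2, hy⟩ := h.exists_step he0 ⟨hb1, hb2⟩ ⟨hb3, hb4⟩
      obtain ⟨r, c, hr, hrc⟩ := exists_isRemovable hlam hy1 hy2
      obtain ⟨b', hb0, hb1, hb2, hb3, hb4⟩ := hc _ ⟨_, hr, rfl⟩
      rw [res_eq_cast hs, hrc] at hb0
      exact hy b' ⟨hb1, hb2⟩ ⟨hb3, hb4⟩ ((ZMod.intCast_eq_intCast_iff_dvd_sub _ _ _).1 hb0.symm)
    rw [h0]
    exact .refl _

/-- The number of beads at positions at least `y`. -/
noncomputable def beadsFrom (f : ℕ → ℕ) (s y : ℤ) : ℕ := Set.ncard {r : ℕ | y ≤ (f r : ℤ) - r - 1 + s}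

theorem lt_beadsFrom {f : ℕ → ℕ} (hf : IsPartition f) {s y : ℤ} {r : ℕ} :
    r < beadsFrom f s y ↔ y ≤ (f r : ℤ) - r - 1 + s := by
  classical
  have hex : ∃ r : ℕ, ¬ y ≤ (f r : ℤ) - r - 1 + s := by
    obtain ⟨N, hN⟩ := hf.2
    refine ⟨N + (s - y).toNat, ?_⟩
    rw [hN _ (by omega)]
    push_cast
    omega
  have h : {r : ℕ | y ≤ (f r : ℤ) - r - 1 + s} = Set.Iio (Nat.find hex) := by
    ext r
    simp only [Set.mem_ofPred_eq, Set.mem_Iio, Nat.lt_find_iff, not_not]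
    refine ⟨fun h m hm => ?_, fun h => h r le_rfl⟩
    have := hf.anti hm
    omega
  rw [beadsFrom, h, ← Finset.coe_Iio, Set.ncard_coe_finset, Nat.card_Iio, ← Set.mem_Iio, ← h]
  rfl

open Classical in
theorem beadsFrom_eq {f : ℕ → ℕ} (hf : IsPartition f) (s y : ℤ) :
    beadsFrom f s y = beadsFrom f s (y + 1) + if Bead f s y then 1 else 0 := by
  set m := beadsFrom f s y with hm
  set n := beadsFrom f s (y + 1) with hn
  have h1 : ∀ r, r < m ↔ y ≤ (f r : ℤ) - r - 1 + s := fun r => lt_beadsFrom hf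
  have h2 : ∀ r, r < n ↔ y + 1 ≤ (f r : ℤ) - r - 1 + s := fun r => lt_beadsFrom hf
  have hnm : n ≤ m := by
    by_contra hc
    have := h1 m
    have := h2 m
    omega
  split_ifs with h
  · obtain ⟨r, hr⟩ := h
    have h3 : r < m := (h1 r).2 (by omega)
    have h4 : ¬ r < n := fun h => by have := (h2 r).1 h; omega
    by_contra hc
    have h5 := h1 (n + 1)
    have h6 := h2 n
    have h7 := h1 n
    have h8 := hf.pos_lt (Nat.lt_add_one n)
    push_cast at *
    omega
  · by_contra hc
    refine h ⟨n, ?_⟩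
    have := h1 n
    have := h2 n
    omega

/-- All the changes between beads and empty positions happen in the interval `[o, o + T)`. -/
structure Window (f : ℕ → ℕ) (s o : ℤ) (T : ℕ) : Prop where
  below : ∀ b < o, Bead f s b
  above : ∀ b, o + T ≤ b → ¬ Bead f s b
  le : o ≤ s
  ge : s ≤ o + T

theorem Window.beadsFrom_of_le {f : ℕ → ℕ} {s o : ℤ} {T : ℕ} (h : Window f s o T) (hf : IsPartition f)
    {y : ℤ} (hy : y ≤ o) : (beadsFrom f s y : ℤ) = s - y := by
  obtain ⟨N, hN⟩ := hf.2
  have hle := h.le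
  have h1 : ∀ y ≤ o, y ≤ s - N → (beadsFrom f s y : ℤ) = s - y := by
    intro y hyo hy
    obtain ⟨n, hn⟩ := Int.eq_ofNat_of_zero_le (show 0 ≤ s - y by omega)
    have h2 : ¬ n < beadsFrom f s y := by
      rw [lt_beadsFrom hf, hN n (by omega)]
      push_cast
      omega
    have h3 : ∀ k, n = k + 1 → k < beadsFrom f s y := by
      rintro k rfl
      rw [lt_beadsFrom hf]
      push_cast at hn
      omega
    have h4 := h3 (n - 1)
    omega
  have h2 : ∀ k : ℕ, o - k ≤ s - N → ∀ j : ℕ, j ≤ k → (beadsFrom f s (o - k + j) : ℤ) = s - (o - k + j) := by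
    intro k hk j hj
    induction j with
    | zero => simpa using h1 (o - k) (by omega) hk
    | succ j ih =>
      have h3 := ih (by omega)
      rw [beadsFrom_eq hf, if_pos (h.below _ (by omega))] at h3
      push_cast at h3 ⊢
      rw [← add_assoc]
      omega
  have h3 := h2 ((o - y).toNat + (o - (s - N)).toNat) (by push_cast; omega) (o - (s - N)).toNat (by omega)
  rwa [show o - (((o - y).toNat + (o - (s - N)).toNat : ℕ) : ℤ) + (o - (s - N)).toNat = y by
    push_cast; omega] at h3

theorem Window.beadsFrom_eq_zero {f : ℕ → ℕ} {s o : ℤ} {T : ℕ} (h : Window f s o T) (hf : IsPartition f)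
    {y : ℤ} (hy : o + T ≤ y) : beadsFrom f s y = 0 := by
  by_contra hc
  have h1 := (lt_beadsFrom hf).1 (Nat.pos_of_ne_zero hc)
  exact h.above _ (hy.trans h1) ⟨0, rfl⟩

/-- The number of nodes `(r, c)` with `c - r + s = y`. -/
noncomputable def diag (f : ℕ → ℕ) (s y : ℤ) : ℤ := beadsFrom f s y - max (s - y) 0

open Classical in
theorem diag_sub {f : ℕ → ℕ} (hf : IsPartition f) (s y : ℤ) : diag f s y - diag f s (y + 1) =
    (if Bead f s y then 1 else 0) - if y < s then 1 else 0 := by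
  rw [diag, diag, beadsFrom_eq hf]
  push_cast
  split_ifs <;> omega

theorem Window.diag_of_le {f : ℕ → ℕ} {s o : ℤ} {T : ℕ} (h : Window f s o T) (hf : IsPartition f)
    {y : ℤ} (hy : y ≤ o) : diag f s y = 0 := by
  rw [diag, h.beadsFrom_of_le hf hy]
  have := h.le
  omega

theorem Window.diag_of_ge {f : ℕ → ℕ} {s o : ℤ} {T : ℕ} (h : Window f s o T) (hf : IsPartition f)
    {y : ℤ} (hy : o + T ≤ y) : diag f s y = 0 := by
  rw [diag, h.beadsFrom_eq_zero hf hy]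
  have := h.ge
  omega

theorem ncard_diag {f : ℕ → ℕ} (hf : IsPartition f) (s y : ℤ) :
    (Set.ncard {p : ℕ × ℕ | p.2 < f p.1 ∧ (p.2 : ℤ) - p.1 + s = y} : ℤ) = diag f s y := by
  have h : Set.ncard {p : ℕ × ℕ | p.2 < f p.1 ∧ (p.2 : ℤ) - p.1 + s = y} =
      (Finset.Ico (s - y).toNat (beadsFrom f s y)).card := by
    rw [← Set.ncard_coe_finset]
    refine Set.ncard_congr (fun p _ => p.1) ?_ ?_ ?_
    · rintro ⟨r, c⟩ ⟨h1, h2⟩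
      simp only [Finset.coe_Ico, Set.mem_Ico, lt_beadsFrom hf] at *
      omega
    · rintro ⟨r, c⟩ ⟨r', c'⟩ ⟨h1, h2⟩ ⟨h1', h2'⟩ h
      simp only at *
      simp only [Prod.mk.injEq]
      omega
    · intro r hr
      simp only [Finset.coe_Ico, Set.mem_Ico, lt_beadsFrom hf] at hr
      refine ⟨(r, (y - s + r).toNat), ⟨?_, ?_⟩, rfl⟩ <;> simp only <;> omega
  have h' : (s - y).toNat ≤ beadsFrom f s y := by
    by_contra hc
    have := (lt_beadsFrom hf (s := s) (y := y) (r := beadsFrom f s y)).2 (by omega)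
    omega
  rw [h, Nat.card_Ico, diag]
  omega

theorem finite_nodes {f : ℕ → ℕ} (hf : IsPartition f) (P : ℕ × ℕ → Prop) :
    {p : ℕ × ℕ | p.2 < f p.1 ∧ P p}.Finite := by
  obtain ⟨N, hN⟩ := hf.2
  refine ((Set.finite_Iio N).prod (Set.finite_Iio (f 0))).subset ?_
  rintro ⟨r, c⟩ ⟨h1, -⟩
  have h2 := hf.anti (Nat.zero_le r)
  have h3 := hN r
  simp only [Set.mem_prod, Set.mem_Iio] at *
  omega

theorem Window.node_mem {f : ℕ → ℕ} {s o : ℤ} {T : ℕ} (h : Window f s o T) (hf : IsPartition f)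
    {p : ℕ × ℕ} (hp : p.2 < f p.1) : o ≤ (p.2 : ℤ) - p.1 + s ∧ (p.2 : ℤ) - p.1 + s < o + T := by
  have h0 : diag f s ((p.2 : ℤ) - p.1 + s) ≠ 0 := by
    rw [← ncard_diag hf]
    have := (Set.ncard_pos (finite_nodes hf fun q => (q.2 : ℤ) - q.1 + s = (p.2 : ℤ) - p.1 + s)).2
      ⟨p, hp, rfl⟩
    exact_mod_cast this.ne'
  by_contra hc
  rcases lt_or_ge ((p.2 : ℤ) - p.1 + s) o with h1 | h1
  · exact h0 (h.diag_of_le hf h1.le)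
  · exact h0 (h.diag_of_ge hf (by omega))

open Classical in
theorem Window.ncard_nodes {f : ℕ → ℕ} {s o : ℤ} {T : ℕ} (h : Window f s o T) (hf : IsPartition f)
    (P : ℤ → Prop) : (Set.ncard {p : ℕ × ℕ | p.2 < f p.1 ∧ P ((p.2 : ℤ) - p.1 + s)} : ℤ) =
      ∑ t ∈ (Finset.range T).filter fun t : ℕ => P (o + t), diag f s (o + t) := by
  have hfin := finite_nodes hf fun p => P ((p.2 : ℤ) - p.1 + s)
  have hmaps : ∀ p ∈ hfin.toFinset, ((p.2 : ℤ) - p.1 + s - o).toNat ∈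
      (Finset.range T).filter fun t : ℕ => P (o + t) := by
    intro p hp
    simp only [Set.Finite.mem_toFinset, Set.mem_ofPred_eq] at hp
    have h0 := h.node_mem hf hp.1
    simp only [Finset.mem_filter, Finset.mem_range]
    refine ⟨by omega, ?_⟩
    rw [show o + (((p.2 : ℤ) - p.1 + s - o).toNat : ℤ) = (p.2 : ℤ) - p.1 + s by omega]
    exact hp.2
  rw [Set.ncard_eq_toFinset_card _ hfin, Finset.card_eq_sum_card_fiberwise hmaps]
  push_cast
  refine Finset.sum_congr rfl fun t ht => ?_
  rw [← ncard_diag hf, ← Set.ncard_coe_finset]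
  congr 2
  ext p
  simp only [Finset.mem_filter, Finset.mem_range] at ht
  simp only [Finset.coe_filter, Set.Finite.mem_toFinset, Set.mem_ofPred_eq]
  constructor
  · rintro ⟨⟨h1, h2⟩, h3⟩
    have := h.node_mem hf h1
    exact ⟨h1, by omega⟩
  · rintro ⟨h1, h2⟩
    rw [h2]
    exact ⟨⟨h1, ht.2⟩, by omega⟩

theorem sum_runner {M : Type*} [AddCommMonoid M] {e : ℕ} (he : 0 < e) (L : ℕ) (F : ℕ → M) {x : ℕ}
    (hx : x < e) : ∑ t ∈ Finset.range (e * L) with t % e = x, F t =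
      ∑ l ∈ Finset.range L, F (x + e * l) := by
  refine Finset.sum_nbij' (fun t => t / e) (fun l => x + e * l) ?_ ?_ ?_ ?_ ?_
  · intro t ht
    simp only [Finset.mem_filter, Finset.mem_range] at *
    exact Nat.div_lt_of_lt_mul ht.1
  · intro l hl
    simp only [Finset.mem_filter, Finset.mem_range] at *
    refine ⟨?_, by simp [Nat.mod_eq_of_lt hx]⟩
    calc x + e * l < e * (l + 1) := by rw [mul_add]; omega
      _ ≤ e * L := Nat.mul_le_mul_left e hl
  · intro t ht
    simp only [Finset.mem_filter, Finset.mem_range] at *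
    rw [← ht.2, Nat.mod_add_div]
  · intro l hl
    simp [Nat.add_mul_div_left _ _ he, Nat.div_eq_of_lt hx]
  · intro t ht
    simp only [Finset.mem_filter, Finset.mem_range] at *
    rw [← ht.2, Nat.mod_add_div]

theorem sum_range_mul {M : Type*} [AddCommMonoid M] {e : ℕ} (he : 0 < e) (L : ℕ) (F : ℕ → M) :
    ∑ t ∈ Finset.range (e * L), F t = ∑ x ∈ Finset.range e, ∑ l ∈ Finset.range L, F (x + e * l) := by
  rw [← Finset.sum_fiberwise_of_maps_to (g := fun t => t % e) (t := Finset.range e)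
    (fun t _ => Finset.mem_range.2 (Nat.mod_lt _ he))]
  exact Finset.sum_congr rfl fun x hx => sum_runner he L F (Finset.mem_range.1 hx)

theorem sum_range_cast {M : Type*} [AddCommMonoid M] {e : ℕ} (he : 0 < e) (F : ZMod e → M)
    (o : ZMod e) : ∑ j ∈ Finset.range e, F j = ∑ j ∈ Finset.range e, F (o + j) := by
  have : NeZero e := ⟨he.ne'⟩
  have key : ∀ F : ZMod e → M, ∑ j ∈ Finset.range e, F j = ∑ z, F z := by
    intro F
    refine Finset.sum_nbij' (fun j => (j : ZMod e)) (fun z => z.val) ?_ ?_ ?_ ?_ ?_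
    · simp
    · intro z _
      simpa using z.val_lt
    · intro j hj
      simpa using ZMod.val_cast_of_lt (Finset.mem_range.1 hj)
    · simp
    · simp
  rw [key, key fun z => F (o + z)]
  exact (Fintype.sum_equiv (Equiv.addLeft o) _ _ fun z => rfl).symm

section Telescope

variable {e L : ℕ} {G γ : ℕ → ℤ}

theorem runner_sub (hG : ∀ t, G t - G (t + 1) = γ t) (x : ℕ) :
    ∑ l ∈ Finset.range L, G (x + e * l) - ∑ l ∈ Finset.range L, G (x + 1 + e * l) =
      ∑ l ∈ Finset.range L, γ (x + e * l) := by
  rw [← Finset.sum_sub_distrib]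
  refine Finset.sum_congr rfl fun l _ => ?_
  rw [← hG, add_right_comm]

theorem runner_period (h0 : G 0 = 0) (hL : G (e * L) = 0) :
    ∑ l ∈ Finset.range L, G (e + e * l) = ∑ l ∈ Finset.range L, G (0 + e * l) := by
  have h1 := Finset.sum_range_succ (fun l => G (e * l)) L
  have h2 := Finset.sum_range_succ' (fun l => G (e * l)) L
  simp only [mul_zero, h0, hL] at h1 h2
  simp only [zero_add]
  rw [← add_zero (∑ l ∈ Finset.range L, G (e * l)), ← h1, h2, add_zero]
  exact Finset.sum_congr rfl fun l _ => by rw [mul_add, mul_one, add_comm]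

theorem runner_zero (hG : ∀ t, G t - G (t + 1) = γ t) (hL : G (e * L) = 0) :
    ∑ l ∈ Finset.range L, G (0 + e * l) =
      ∑ x ∈ Finset.range e, ∑ l ∈ Finset.range L, γ (x + e * l) * (l + 1) := by
  have h1 : ∀ l, ∑ x ∈ Finset.range e, γ (x + e * l) = G (e * l) - G (e * (l + 1)) := by
    intro l
    have := Finset.sum_range_sub' (fun x => G (x + e * l)) e
    simp only [zero_add] at this
    rw [mul_add, mul_one, add_comm (e * l), ← this]
    refine Finset.sum_congr rfl fun x _ => ?_
    rw [← hG, add_right_comm]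
  have h2 : ∀ K : ℕ, ∑ l ∈ Finset.range K, (G (e * l) - G (e * (l + 1))) * (l + 1) =
      ∑ l ∈ Finset.range K, G (e * l) - K * G (e * K) := by
    intro K
    induction K with
    | zero => simp
    | succ K ih =>
      rw [Finset.sum_range_succ, ih, Finset.sum_range_succ]
      push_cast
      ring
  rw [Finset.sum_comm]
  simp only [← Finset.sum_mul, h1, h2, hL, zero_add]
  simp

end Telescope

theorem sum_initial {L n : ℕ} (h : n ≤ L) (F : ℕ → ℤ) :
    ∑ l ∈ Finset.range L, (if (l : ℤ) < n then 1 else 0) * F l = ∑ l ∈ Finset.range n, F l := by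
  have hfil : (Finset.range L).filter (fun l : ℕ => (l : ℤ) < n) = Finset.range n := by
    ext l
    simp
    omega
  simp only [ite_mul, one_mul, zero_mul]
  rw [← Finset.sum_filter, hfil]

theorem sum_initial_one {L n : ℕ} (h : n ≤ L) :
    ∑ l ∈ Finset.range L, (if (l : ℤ) < n then (1 : ℤ) else 0) = n := by
  simpa using sum_initial h fun _ => 1

theorem sum_range_succ_mul_two (n : ℕ) :
    ∑ l ∈ Finset.range n, ((l : ℤ) + 1) * 2 = n * (n + 1) := by
  induction n with
  | zero => simp
  | succ n ih =>
    rw [Finset.sum_range_succ, ih]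
    push_cast
    ring

theorem two_mul_sum_runner {χ : ℕ → ℤ} {L : ℕ} {u : ℤ} (hχ : ∀ l, χ l = 0 ∨ χ l = 1)
    (hu : ∑ l ∈ Finset.range L, χ l = u) :
    (0 ≤ u ∧ u ≤ L) ∧ u * (u + 1) ≤ 2 * ∑ l ∈ Finset.range L, χ l * (l + 1) ∧
      (2 * ∑ l ∈ Finset.range L, χ l * (l + 1) = u * (u + 1) →
        ∀ l < L, χ l = if (l : ℤ) < u then 1 else 0) := by
  have h0 : 0 ≤ u := hu ▸ Finset.sum_nonneg fun l _ => by rcases hχ l with h | h <;> omega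
  have h1 : u ≤ L := by
    rw [← hu]
    calc ∑ l ∈ Finset.range L, χ l ≤ ∑ l ∈ Finset.range L, 1 :=
          Finset.sum_le_sum fun l _ => by rcases hχ l with h | h <;> omega
      _ = L := by simp
  obtain ⟨n, rfl⟩ := Int.eq_ofNat_of_zero_le h0
  have h2 := sum_initial (n := n) (L := L) (by omega)
  have h4 := sum_initial_one (n := n) (L := L) (by omega)
  have h5 : 2 * ∑ l ∈ Finset.range L, χ l * (l + 1) - n * (n + 1) =
      ∑ l ∈ Finset.range L, (χ l - if (l : ℤ) < n then 1 else 0) * (2 * l + 1 - 2 * n) := by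
    rw [← sum_range_succ_mul_two, ← h2, Finset.mul_sum, ← Finset.sum_sub_distrib, ← sub_eq_zero, ← Finset.sum_sub_distrib]
    calc _ = ∑ l ∈ Finset.range L, (1 + 2 * (n : ℤ)) * (χ l - if (l : ℤ) < n then 1 else 0) :=
          Finset.sum_congr rfl fun l _ => by ring
      _ = 0 := by rw [← Finset.mul_sum, Finset.sum_sub_distrib, hu, h4, sub_self, mul_zero]
  have h6 : ∀ l ∈ Finset.range L,
      0 ≤ (χ l - if (l : ℤ) < n then 1 else 0) * (2 * l + 1 - 2 * n) := by
    intro l _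
    rcases hχ l with h | h <;> rw [h] <;> split_ifs <;> nlinarith
  refine ⟨⟨h0, h1⟩, ?_, fun h7 l hl => ?_⟩
  · have := Finset.sum_nonneg h6
    omega
  · rw [h7, sub_self] at h5
    have h8 := (Finset.sum_eq_zero_iff_of_nonneg h6).1 h5.symm l (Finset.mem_range.2 hl)
    rcases mul_eq_zero.1 h8 with h | h <;> omega

theorem ncard_diagram {lam : Fin 2 → ℕ → ℕ} (hlam : IsBipartition lam) (Q : Node → Prop) :
    Set.ncard {x : Node | x ∈ Diagram lam ∧ Q x} =
      Set.ncard {p : ℕ × ℕ | p.2 < lam 0 p.1 ∧ Q (p.1, p.2, 0)} +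
        Set.ncard {p : ℕ × ℕ | p.2 < lam 1 p.1 ∧ Q (p.1, p.2, 1)} := by
  have hinj : ∀ a : Fin 2, Function.Injective fun p : ℕ × ℕ => ((p.1, p.2, a) : Node) := by
    rintro a ⟨r, c⟩ ⟨r', c'⟩ h
    simpa using h
  rw [← Set.ncard_image_of_injective _ (hinj 0), ← Set.ncard_image_of_injective _ (hinj 1),
    ← Set.ncard_union_eq ?_ ((finite_nodes (hlam 0) _).image _) ((finite_nodes (hlam 1) _).image _)]
  · congr 1
    ext ⟨r, c, a⟩
    fin_cases a <;> simp [Diagram]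
  · rw [Set.disjoint_left]
    rintro _ ⟨p, -, rfl⟩ ⟨q, -, h⟩
    simp at h

theorem cnt_eq_sum {e : ℕ} (he : 0 < e) {κ : Fin 2 → ZMod e} {s : Fin 2 → ℤ}
    (hs : ∀ a, (s a : ZMod e) = κ a) {lam : Fin 2 → ℕ → ℕ} (hlam : IsBipartition lam) {o : ℤ} {L : ℕ}
    (hW : ∀ a, Window (lam a) (s a) o (e * L)) {x : ℕ} (hx : x < e) :
    (cnt e κ lam ((o : ZMod e) + x) : ℤ) =
      ∑ l ∈ Finset.range L, (diag (lam 0) (s 0) (o + (x + e * l : ℕ)) +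
        diag (lam 1) (s 1) (o + (x + e * l : ℕ))) := by
  have h1 : ∀ a, (Set.ncard {p : ℕ × ℕ | p.2 < lam a p.1 ∧ res e κ (p.1, p.2, a) = (o : ZMod e) + x} : ℤ)
      = ∑ l ∈ Finset.range L, diag (lam a) (s a) (o + (x + e * l : ℕ)) := by
    intro a
    simp only [res_eq_cast hs]
    rw [(hW a).ncard_nodes (hlam a) fun z => (z : ZMod e) = (o : ZMod e) + x,
      ← sum_runner he L (fun t => diag (lam a) (s a) (o + t)) hx]
    refine Finset.sum_congr ?_ fun _ _ => rfl
    ext t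
    simp only [Finset.mem_filter]
    refine and_congr_right fun _ => ?_
    push_cast
    rw [add_right_inj, ZMod.natCast_eq_natCast_iff', Nat.mod_eq_of_lt hx]
  rw [cnt, ncard_diagram hlam]
  push_cast
  rw [h1, h1, ← Finset.sum_add_distrib]
  push_cast
  rfl

open Classical in
/-- The indicator function of the beads. -/
noncomputable def beadInd (f : ℕ → ℕ) (s b : ℤ) : ℤ := if Bead f s b then 1 else 0

/-- The indicator function of the beads for the empty partition. -/
def vacInd (s b : ℤ) : ℤ := if b < s then 1 else 0

theorem diag_sub_eq {f : ℕ → ℕ} (hf : IsPartition f) (s y : ℤ) :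
    diag f s y - diag f s (y + 1) = beadInd f s y - vacInd s y := diag_sub hf s y

section Content

variable {e : ℕ} {κ : Fin 2 → ZMod e} {s : Fin 2 → ℤ} {lam : Fin 2 → ℕ → ℕ} {o : ℤ} {L : ℕ}

theorem diag_step (hlam : IsBipartition lam) (t : ℕ) :
    (diag (lam 0) (s 0) (o + t) + diag (lam 1) (s 1) (o + t)) -
      (diag (lam 0) (s 0) (o + (t + 1 : ℕ)) + diag (lam 1) (s 1) (o + (t + 1 : ℕ))) =
    (beadInd (lam 0) (s 0) (o + t) - vacInd (s 0) (o + t)) +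
      (beadInd (lam 1) (s 1) (o + t) - vacInd (s 1) (o + t)) := by
  rw [← diag_sub_eq (hlam 0), ← diag_sub_eq (hlam 1)]
  push_cast
  rw [← add_assoc]
  ring

theorem cnt_sub_cnt (he : 0 < e) (hs : ∀ a, (s a : ZMod e) = κ a) (hlam : IsBipartition lam)
    (hW : ∀ a, Window (lam a) (s a) o (e * L)) {x : ℕ} (hx : x < e) :
    (cnt e κ lam ((o : ZMod e) + x) : ℤ) - cnt e κ lam ((o : ZMod e) + x + 1) =
      ∑ l ∈ Finset.range L, ((beadInd (lam 0) (s 0) (o + (x + e * l : ℕ)) -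
        vacInd (s 0) (o + (x + e * l : ℕ))) + (beadInd (lam 1) (s 1) (o + (x + e * l : ℕ)) -
        vacInd (s 1) (o + (x + e * l : ℕ)))) := by
  have h1 := runner_sub (e := e) (L := L) (diag_step (s := s) (o := o) hlam) x
  rw [← h1, ← cnt_eq_sum he hs hlam hW hx]
  congr 1
  rcases Nat.lt_or_ge (x + 1) e with h | h
  · rw [← cnt_eq_sum he hs hlam hW h]
    push_cast
    rw [add_assoc]
  · obtain rfl : e = x + 1 := by omega
    rw [add_assoc, ← Nat.cast_succ, Nat.succ_eq_add_one, ZMod.natCast_self, ← Nat.cast_zero,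
      cnt_eq_sum he hs hlam hW he]
    refine (runner_period (e := x + 1) (L := L)
      (G := fun t => diag (lam 0) (s 0) (o + t) + diag (lam 1) (s 1) (o + t)) ?_ ?_).symm
    · simp only [Nat.cast_zero, add_zero]
      rw [(hW 0).diag_of_le (hlam 0) le_rfl, (hW 1).diag_of_le (hlam 1) le_rfl, add_zero]
    · rw [(hW 0).diag_of_ge (hlam 0) le_rfl, (hW 1).diag_of_ge (hlam 1) le_rfl, add_zero]

theorem cnt_eq_weighted (he : 0 < e) (hs : ∀ a, (s a : ZMod e) = κ a) (hlam : IsBipartition lam)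
    (hW : ∀ a, Window (lam a) (s a) o (e * L)) : (cnt e κ lam o : ℤ) =
      ∑ x ∈ Finset.range e, ∑ l ∈ Finset.range L, ((beadInd (lam 0) (s 0) (o + (x + e * l : ℕ)) -
        vacInd (s 0) (o + (x + e * l : ℕ))) + (beadInd (lam 1) (s 1) (o + (x + e * l : ℕ)) -
        vacInd (s 1) (o + (x + e * l : ℕ)))) * (l + 1) := by
  have h1 := cnt_eq_sum he hs hlam hW he
  rw [Nat.cast_zero, add_zero] at h1
  rw [h1]
  refine runner_zero (G := fun t => diag (lam 0) (s 0) (o + t) + diag (lam 1) (s 1) (o + t))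
    (diag_step (s := s) (o := o) hlam) ?_
  rw [(hW 0).diag_of_ge (hlam 0) le_rfl, (hW 1).diag_of_ge (hlam 1) le_rfl, add_zero]

end Content

theorem Window.sum_eq_zero {f : ℕ → ℕ} {s o : ℤ} {T : ℕ} (h : Window f s o T) (hf : IsPartition f) :
    ∑ t ∈ Finset.range T, (beadInd f s (o + t) - vacInd s (o + t)) = 0 := by
  have h1 := Finset.sum_range_sub' (fun t : ℕ => diag f s (o + t)) T
  rw [h.diag_of_ge hf le_rfl, h.diag_of_le hf (y := o + (0 : ℕ)) (by simp), sub_zero] at h1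
  rw [← h1]
  refine Finset.sum_congr rfl fun t _ => ?_
  rw [← diag_sub_eq hf]
  push_cast
  rw [add_assoc]

theorem two_mul_wt {e : ℕ} (he : 0 < e) {κ : Fin 2 → ZMod e} {lam : Fin 2 → ℕ → ℕ} (o : ZMod e) :
    2 * wt e κ lam = 2 * (cnt e κ lam (κ 0) + cnt e κ lam (κ 1)) -
      ∑ x ∈ Finset.range e, ((cnt e κ lam (o + x) : ℚ) - cnt e κ lam (o + x + 1)) ^ 2 := by
  rw [wt, sum_range_cast he (fun z => ((cnt e κ lam z : ℚ) - cnt e κ lam (z + 1)) ^ 2) o]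
  ring

theorem weight_one_runners {e d : ℕ} (hd : d ≤ e) {M c c' : ℤ} {A B u v : ℕ → ℤ}
    (hA : ∀ x < e, u x * (u x + 1) ≤ 2 * A x) (hB : ∀ x < e, v x * (v x + 1) ≤ 2 * B x)
    (hu : ∑ x ∈ Finset.range e, (u x - (M + if x < d then 1 else 0)) = 0)
    (hv : ∑ x ∈ Finset.range e, (v x - M) = 0)
    (hc : 2 * c = ∑ x ∈ Finset.range e, ((2 * A x - (M + if x < d then 1 else 0) *
      (M + (if x < d then 1 else 0) + 1)) + (2 * B x - M * (M + 1))))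
    (hc' : c - c' = ∑ x ∈ Finset.range d, ((u x - (M + if x < d then 1 else 0)) + (v x - M)))
    (hwt : 2 * (c' + c) - ∑ x ∈ Finset.range e,
      ((u x - (M + if x < d then 1 else 0)) + (v x - M)) ^ 2 = 2) :
    (∀ x < e, 2 * A x = u x * (u x + 1) ∧ 2 * B x = v x * (v x + 1)) ∧
      ∃ x < e, (u x - v x = 2 ∨ u x - v x = -1) ∧
        ∀ y < e, y ≠ x → u y - v y = 0 ∨ u y - v y = 1 := by
  have h1 : ∑ x ∈ Finset.range e, (2 * (2 * A x - u x * (u x + 1)) +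
      2 * (2 * B x - v x * (v x + 1)) + (u x - v x) * (u x - v x - 1)) = 2 := by
    have h2 : ∑ x ∈ Finset.range d, ((u x - (M + if x < d then 1 else 0)) + (v x - M)) =
        ∑ x ∈ Finset.range e, (if x < d then 1 else 0) *
          ((u x - (M + if x < d then 1 else 0)) + (v x - M)) := by
      have hfil : (Finset.range e).filter (fun x => x < d) = Finset.range d := by
        ext x
        simp
        omega
      simp only [ite_mul (α := ℤ), one_mul, zero_mul]
      rw [← Finset.sum_filter (fun x => x < d), hfil]
    have h3 : 2 * (c' + c) = 2 * (2 * c) - 2 * (c - c') := by ring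
    rw [h3, hc, hc', h2, Finset.mul_sum, Finset.mul_sum, ← Finset.sum_sub_distrib,
      ← Finset.sum_sub_distrib] at hwt
    have h4 : (4 * M + 3) * ∑ x ∈ Finset.range e, (u x - (M + if x < d then 1 else 0)) +
        (4 * M + 1) * ∑ x ∈ Finset.range e, (v x - M) = 0 := by rw [hu, hv]; ring
    rw [Finset.mul_sum, Finset.mul_sum, ← Finset.sum_add_distrib] at h4
    have h5 := congrArg₂ HSub.hSub hwt h4
    rw [← Finset.sum_sub_distrib, sub_zero] at h5
    refine Eq.trans ?_ h5
    refine Finset.sum_congr rfl fun x _ => ?_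
    split_ifs <;> ring
  have hγ : ∀ z : ℤ, 0 ≤ z * (z - 1) ∧ (z = 0 ∨ z = 1 ∨ 2 ≤ z * (z - 1)) ∧
      (z * (z - 1) = 2 → z = 2 ∨ z = -1) := by
    intro z
    refine ⟨?_, ?_, fun h => ?_⟩
    · rcases le_or_gt z 0 with h | h <;> nlinarith
    · rcases lt_trichotomy z 0 with h | h | h
      · right; right; nlinarith
      · exact .inl h
      · rcases (show 1 ≤ z by omega).lt_or_eq with h | h
        · right; right; nlinarith
        · exact .inr (.inl h.symm)
    · have : (z - 2) * (z + 1) = 0 := by linarith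
      rcases mul_eq_zero.1 this with h | h <;> omega
  have hpar : ∀ a z : ℤ, z * (z + 1) ≤ 2 * a → 2 * a = z * (z + 1) ∨ 2 ≤ 2 * a - z * (z + 1) := by
    intro a z h
    obtain ⟨k, hk⟩ := Int.even_mul_succ_self z
    omega
  have hnn : ∀ x ∈ Finset.range e, 0 ≤ 2 * (2 * A x - u x * (u x + 1)) +
      2 * (2 * B x - v x * (v x + 1)) + (u x - v x) * (u x - v x - 1) := by
    intro x hx
    have := hA x (Finset.mem_range.1 hx)
    have := hB x (Finset.mem_range.1 hx)
    have := (hγ (u x - v x)).1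
    linarith
  have hle : ∀ x < e, 2 * (2 * A x - u x * (u x + 1)) +
      2 * (2 * B x - v x * (v x + 1)) + (u x - v x) * (u x - v x - 1) ≤ 2 := fun x hx =>
    (Finset.single_le_sum hnn (Finset.mem_range.2 hx)).trans_eq h1
  have hfl : ∀ x < e, 2 * A x = u x * (u x + 1) ∧ 2 * B x = v x * (v x + 1) := by
    intro x hx
    have h2 := hle x hx
    have h3 := hA x hx
    have h4 := hB x hx
    have h5 := (hγ (u x - v x)).1
    have h6 := hpar _ _ h3
    have h7 := hpar _ _ h4
    constructor
    · rcases h6 with h6 | h6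
      · exact h6
      · linarith
    · rcases h7 with h7 | h7
      · exact h7
      · linarith
  refine ⟨hfl, ?_⟩
  have h2 : ∑ x ∈ Finset.range e, (u x - v x) * (u x - v x - 1) = 2 := by
    rw [← h1]
    refine Finset.sum_congr rfl fun x hx => ?_
    obtain ⟨h3, h4⟩ := hfl x (Finset.mem_range.1 hx)
    rw [h3, h4]
    ring
  obtain ⟨x, hx, hx0⟩ : ∃ x ∈ Finset.range e, (u x - v x) * (u x - v x - 1) ≠ 0 := by
    by_contra hcon
    push Not at hcon
    rw [Finset.sum_eq_zero hcon] at h2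
    omega
  have h3 := Finset.add_sum_erase _ (fun x => (u x - v x) * (u x - v x - 1)) hx
  have h4 : ∀ y ∈ (Finset.range e).erase x, 0 ≤ (u y - v y) * (u y - v y - 1) :=
    fun y _ => (hγ _).1
  have h5 := Finset.sum_nonneg h4
  have h6 : 2 ≤ (u x - v x) * (u x - v x - 1) := by
    rcases (hγ (u x - v x)).2.1 with h | h | h
    · rw [h] at hx0; simp at hx0
    · rw [h] at hx0; simp at hx0
    · exact h
  simp only [h2] at h3
  refine ⟨x, Finset.mem_range.1 hx, (hγ _).2.2 (by omega), fun y hy hyx => ?_⟩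
  have h7 := (Finset.sum_eq_zero_iff_of_nonneg h4).1 (by omega) y
    (Finset.mem_erase.2 ⟨hyx, Finset.mem_range.2 hy⟩)
  rcases (hγ (u y - v y)).2.1 with h | h | h
  · exact .inl h
  · exact .inr h
  · omega

/-- The beads fill the tops of all runners, `u x` of them on runner `x`. -/
def Runners (e : ℕ) (W : ℤ → Prop) (o : ℤ) (u : ℕ → ℤ) : Prop :=
  ∀ b, W b ↔ (b - o) / e < u ((b - o) % e).toNat

theorem beadInd_eq (f : ℕ → ℕ) (s b : ℤ) : beadInd f s b = 0 ∨ beadInd f s b = 1 := by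
  unfold beadInd
  split_ifs <;> simp

theorem beadInd_eq_one {f : ℕ → ℕ} {s b : ℤ} : beadInd f s b = 1 ↔ Bead f s b := by
  simp [beadInd]

theorem Window.runners {e : ℕ} (he : 0 < e) {f : ℕ → ℕ} {s o : ℤ} {L : ℕ} (h : Window f s o (e * L))
    (heq : ∀ x < e, 2 * ∑ l ∈ Finset.range L, beadInd f s (o + (x + e * l : ℕ)) * (l + 1) =
      (∑ l ∈ Finset.range L, beadInd f s (o + (x + e * l : ℕ))) *
        (∑ l ∈ Finset.range L, beadInd f s (o + (x + e * l : ℕ)) + 1)) :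
    Runners e (Bead f s) o fun x => ∑ l ∈ Finset.range L, beadInd f s (o + (x + e * l : ℕ)) := by
  intro b
  have he' : (0 : ℤ) < e := by exact_mod_cast he
  have h0 := Int.emod_nonneg (b - o) he'.ne'
  have h1 := Int.emod_lt_of_pos (b - o) he'
  have h2 := Int.emod_add_mul_ediv (b - o) e
  set q := (b - o) / e
  obtain ⟨x, hx⟩ := Int.eq_ofNat_of_zero_le h0
  rw [hx] at h1 h2
  rw [hx, Int.toNat_natCast]
  beta_reduce
  have hxe : x < e := by omega
  obtain ⟨⟨h3, h4⟩, -, h5⟩ := two_mul_sum_runner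
    (χ := fun l => beadInd f s (o + (x + e * l : ℕ))) (L := L) (fun l => beadInd_eq _ _ _) rfl
  rcases lt_or_ge q 0 with hq | hq
  · refine iff_of_true (h.below _ ?_) (by omega)
    nlinarith
  rcases lt_or_ge q L with hq' | hq'
  · obtain ⟨l, hl⟩ := Int.eq_ofNat_of_zero_le hq
    have h6 := h5 (heq x hxe) l (by omega)
    have h7 : o + (x + e * l : ℕ) = b := by
      push_cast
      rw [← hl]
      linarith
    simp only [h7] at h6
    rw [← beadInd_eq_one, h6, hl]
    simp
  · refine iff_of_false (h.above _ ?_) (by omega)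
    push_cast
    nlinarith

theorem vacInd_runner {e : ℕ} {o : ℤ} {d M x l : ℕ} (hx : x < e) (hd : d < e) :
    vacInd (o + (e * M + d : ℕ)) (o + (x + e * l : ℕ)) =
      if (l : ℤ) < (M + if x < d then 1 else 0 : ℕ) then 1 else 0 := by
  unfold vacInd
  congr 1
  have key : x + e * l < e * M + d ↔ l < M + if x < d then 1 else 0 := by
    split_ifs with h
    · constructor
      · intro h'
        by_contra hc
        have := Nat.mul_le_mul_left e (show M + 1 ≤ l by omega)
        rw [mul_add] at this
        omega
      · intro h'
        have := Nat.mul_le_mul_left e (show l ≤ M by omega)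
        omega
    · constructor
      · intro h'
        by_contra hc
        have := Nat.mul_le_mul_left e (show M ≤ l by omega)
        omega
      · intro h'
        have := Nat.mul_le_mul_left e (show l + 1 ≤ M by omega)
        rw [mul_add] at this
        omega
  rw [eq_iff_iff, add_lt_add_iff_left]
  exact_mod_cast key

theorem sum_beadInd_sub_vacInd {e : ℕ} {o : ℤ} {d M L x : ℕ} (hx : x < e) (hd : d < e) (hL : M < L)
    (f : ℕ → ℕ) (s : ℤ) (hs : s = o + (e * M + d : ℕ)) :
    ∑ l ∈ Finset.range L, (beadInd f s (o + (x + e * l : ℕ)) - vacInd s (o + (x + e * l : ℕ))) =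
        ∑ l ∈ Finset.range L, beadInd f s (o + (x + e * l : ℕ)) - (M + if x < d then 1 else 0) ∧
      2 * ∑ l ∈ Finset.range L, (beadInd f s (o + (x + e * l : ℕ)) -
          vacInd s (o + (x + e * l : ℕ))) * (l + 1) =
        2 * ∑ l ∈ Finset.range L, beadInd f s (o + (x + e * l : ℕ)) * (l + 1) -
          (M + if x < d then 1 else 0) * (M + (if x < d then 1 else 0) + 1) := by
  have hn : (M + if x < d then 1 else 0) ≤ L := by split_ifs <;> omega
  have h1 := sum_initial_one hn
  have h2 := sum_initial hn fun l => ((l : ℤ) + 1) * 2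
  rw [sum_range_succ_mul_two] at h2
  have h3 : ∀ l, vacInd s (o + (x + e * l : ℕ)) = _ := fun l => hs ▸ vacInd_runner hx hd
  constructor
  · rw [Finset.sum_sub_distrib]
    simp only [h3]
    rw [h1]
    push_cast
    rfl
  · simp only [sub_mul]
    rw [Finset.sum_sub_distrib, mul_sub]
    simp only [h3]
    congr 1
    rw [Finset.mul_sum]
    push_cast at h2 ⊢
    rw [← h2]
    exact Finset.sum_congr rfl fun l _ => by ring

theorem exists_runners {e : ℕ} (he : 0 < e) {κ : Fin 2 → ZMod e} {lam : Fin 2 → ℕ → ℕ}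
    (hlam : IsBipartition lam) (hwt : wt e κ lam = 1) : ∃ (s : Fin 2 → ℤ) (o : ℤ) (d : ℕ)
      (u v : ℕ → ℤ), (∀ a, (s a : ZMod e) = κ a) ∧ s 0 = s 1 + d ∧ d < e ∧
      Runners e (Bead (lam 0) (s 0)) o u ∧ Runners e (Bead (lam 1) (s 1)) o v ∧
      ∑ x ∈ Finset.range e, (u x - v x) = d ∧
      ∃ x < e, (u x - v x = 2 ∨ u x - v x = -1) ∧
        ∀ y < e, y ≠ x → u y - v y = 0 ∨ u y - v y = 1 := by
  have : NeZero e := ⟨he.ne'⟩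
  obtain ⟨s₁, hs₁⟩ := ZMod.intCast_surjective (κ 1)
  obtain ⟨d, hd⟩ : ∃ d, d = (κ 0 - κ 1).val := ⟨_, rfl⟩
  have hde : d < e := hd ▸ ZMod.val_lt _
  have hdκ : (d : ZMod e) = κ 0 - κ 1 := by rw [hd, ZMod.natCast_zmod_val]
  obtain ⟨s, hs0, hs1⟩ : ∃ s : Fin 2 → ℤ, s 0 = s 1 + d ∧ s 1 = s₁ := ⟨![s₁ + d, s₁], rfl, rfl⟩
  have hs : ∀ a, (s a : ZMod e) = κ a := by
    rw [Fin.forall_fin_two]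
    constructor
    · rw [hs0, hs1]
      push_cast
      rw [hs₁, hdκ]
      ring
    · rw [hs1, hs₁]
  obtain ⟨B, hB⟩ := exists_beads_bound hlam s
  obtain ⟨M, hM⟩ : ∃ M, M = B + s₁.natAbs := ⟨_, rfl⟩
  obtain ⟨L, hL⟩ : ∃ L, L = M + (M + 1) := ⟨_, rfl⟩
  obtain ⟨o, ho⟩ : ∃ o, o = s 1 - e * M := ⟨_, rfl⟩
  have heM : (M : ℤ) ≤ e * M := by
    have := Nat.le_mul_of_pos_left M he
    exact_mod_cast this
  have heL : (e : ℤ) * L = e * M + (e * M + e) := by rw [hL]; push_cast; ring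
  have hW : ∀ a, Window (lam a) (s a) o (e * L) := by
    have hsa : ∀ a, o ≤ s a ∧ s a ≤ o + e * L := by
      rw [Fin.forall_fin_two]
      omega
    intro a
    have h1 := (hB (-o) (by omega) a).1
    have h2 := (hB (o + e * L) (by omega) a).2
    rw [neg_neg] at h1
    exact ⟨h1, by push_cast; exact h2, (hsa a).1, by push_cast; exact (hsa a).2⟩
  have hs0' : s 0 = o + (e * M + d : ℕ) := by push_cast; omega
  have hs1' : s 1 = o + (e * M + 0 : ℕ) := by push_cast; omega
  have hoκ : (o : ZMod e) = κ 1 := by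
    rw [ho]
    push_cast
    rw [hs, ZMod.natCast_self, zero_mul, sub_zero]
  have hoκ' : (o : ZMod e) + d = κ 0 := by rw [hoκ, hdκ]; ring
  set u : ℕ → ℤ := fun x => ∑ l ∈ Finset.range L, beadInd (lam 0) (s 0) (o + (x + e * l : ℕ)) with hu
  set v : ℕ → ℤ := fun x => ∑ l ∈ Finset.range L, beadInd (lam 1) (s 1) (o + (x + e * l : ℕ)) with hv
  set A : ℕ → ℤ := fun x => ∑ l ∈ Finset.range L,
    beadInd (lam 0) (s 0) (o + (x + e * l : ℕ)) * (l + 1) with hA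
  set A' : ℕ → ℤ := fun x => ∑ l ∈ Finset.range L,
    beadInd (lam 1) (s 1) (o + (x + e * l : ℕ)) * (l + 1) with hA'
  have hU := fun x (hx : x < e) => sum_beadInd_sub_vacInd hx hde (show M < L by omega) (lam 0) _ hs0'
  have hV := fun x (hx : x < e) => sum_beadInd_sub_vacInd hx he (show M < L by omega) (lam 1) _ hs1'
  simp only [not_lt_zero, if_false, add_zero] at hV
  have hrun := fun (f : ℕ → ℕ) (s : ℤ) (x : ℕ) => two_mul_sum_runner (L := L)
    (χ := fun l => beadInd f s (o + (x + e * l : ℕ))) (fun l => beadInd_eq _ _ _) rfl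
  have hsum0 : ∑ x ∈ Finset.range e, (u x - ((M : ℤ) + if x < d then 1 else 0)) = 0 := by
    refine Eq.trans ?_ ((hW 0).sum_eq_zero (hlam 0))
    rw [sum_range_mul he]
    exact Finset.sum_congr rfl fun x hx => ((hU x (Finset.mem_range.1 hx)).1).symm
  have hsum1 : ∑ x ∈ Finset.range e, (v x - (M : ℤ)) = 0 := by
    refine Eq.trans ?_ ((hW 1).sum_eq_zero (hlam 1))
    rw [sum_range_mul he]
    exact Finset.sum_congr rfl fun x hx => ((hV x (Finset.mem_range.1 hx)).1).symm
  have hsub : ∀ x < e, (cnt e κ lam ((o : ZMod e) + x) : ℤ) - cnt e κ lam ((o : ZMod e) + x + 1) =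
      (u x - ((M : ℤ) + if x < d then 1 else 0)) + (v x - M) := by
    intro x hx
    rw [cnt_sub_cnt he hs hlam hW hx, Finset.sum_add_distrib, (hU x hx).1, (hV x hx).1]
  have key := weight_one_runners (M := M) (c := cnt e κ lam (κ 1)) (c' := cnt e κ lam (κ 0))
    (A := A) (B := A') (u := u) (v := v) hde.le (fun x _ => (hrun _ _ x).2.1)
    (fun x _ => (hrun _ _ x).2.1) hsum0 hsum1
  suffices hsuf : _ ∧ _ ∧ _ by
    obtain ⟨h1, h2⟩ := key hsuf.1 hsuf.2.1 hsuf.2.2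
    refine ⟨s, o, d, u, v, hs, hs0, hde, (hW 0).runners he fun x hx => (h1 x hx).1,
      (hW 1).runners he fun x hx => (h1 x hx).2, ?_, h2⟩
    have h3 := congrArg₂ HSub.hSub hsum0 hsum1
    rw [← Finset.sum_sub_distrib, sub_zero] at h3
    have h4 : ∑ x ∈ Finset.range e, (if x < d then (1 : ℤ) else 0) = d := by
      simpa using sum_initial_one hde.le
    rw [← h4, ← sub_eq_zero, ← Finset.sum_sub_distrib]
    refine Eq.trans ?_ h3
    exact Finset.sum_congr rfl fun x _ => by ring
  refine ⟨?_, ?_, ?_⟩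
  · rw [← hoκ, cnt_eq_weighted he hs hlam hW, Finset.mul_sum]
    refine Finset.sum_congr rfl fun x hx => ?_
    have h3 := congrArg₂ HAdd.hAdd (hU x (Finset.mem_range.1 hx)).2 (hV x (Finset.mem_range.1 hx)).2
    rw [← mul_add, ← Finset.sum_add_distrib] at h3
    simp only [← add_mul] at h3
    exact h3
  · have h3 := Finset.sum_range_sub' (fun x : ℕ => (cnt e κ lam ((o : ZMod e) + x) : ℤ)) d
    rw [hoκ', Nat.cast_zero, add_zero, hoκ] at h3
    rw [← h3]
    refine Finset.sum_congr rfl fun x hx => ?_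
    rw [← hsub x ((Finset.mem_range.1 hx).trans hde), hoκ]
    push_cast
    rw [add_assoc]
  · have h3 := two_mul_wt he (κ := κ) (lam := lam) o
    rw [hwt] at h3
    have h4 : ∀ x ∈ Finset.range e, ((u x - ((M : ℤ) + if x < d then 1 else 0)) + (v x - M)) ^ 2 =
        ((cnt e κ lam ((o : ZMod e) + x) : ℤ) - cnt e κ lam ((o : ZMod e) + x + 1)) ^ 2 :=
      fun x hx => by rw [hsub x (Finset.mem_range.1 hx)]
    rw [Finset.sum_congr rfl h4]
    have h5 : (2 : ℚ) = ((2 : ℤ) : ℚ) := by norm_num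
    rw [mul_one, h5] at h3
    exact_mod_cast h3.symm

section Runners

variable {e : ℕ} {U V : ℤ → Prop} {o : ℤ} {u v : ℕ → ℤ}

theorem emod_toNat_lt (he : 0 < e) (z : ℤ) : (z % e).toNat < e := by
  have he' : (0 : ℤ) < e := by exact_mod_cast he
  have h0 := Int.emod_nonneg z he'.ne'
  have h1 := Int.emod_lt_of_pos z he'
  omega

theorem Runners.sub_apply (hU : Runners e U o u) (he : 0 < e) (b : ℤ) :
    U (b - e) ↔ (b - o) / e - 1 < u ((b - o) % e).toNat := by
  have he' : (e : ℤ) ≠ 0 := by exact_mod_cast he.ne'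
  rw [hU, show b - e - o = (b - o) + e * (-1) by ring, Int.add_mul_ediv_left _ _ he',
    Int.add_mul_emod_self_left, sub_eq_add_neg ((b - o) / e)]

theorem Runners.flush (hU : Runners e U o u) (hV : Runners e V o v) (he : 0 < e)
    (h : ∀ x < e, |u x - v x| ≤ 1) : Flush e U V := by
  intro b hb
  have hx := abs_le.1 (h _ (emod_toNat_lt he (b - o)))
  rw [hU, hV] at hb
  rw [hU.sub_apply he, hV.sub_apply he]
  omega

theorem Runners.subsingleton (hU : Runners e U o u) (hV : Runners e V o v) (he : 0 < e)
    (h : ∀ x < e, u x - v x ≤ 1)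
    (h' : ∀ x < e, ∀ y < e, u x - v x = 1 → u y - v y = 1 → x = y) :
    ∀ p p', U p ∧ ¬ V p → U p' ∧ ¬ V p' → p = p' := by
  intro p p' hp hp'
  have he' : (0 : ℤ) < e := by exact_mod_cast he
  rw [hU, hV] at hp hp'
  have h1 := emod_toNat_lt he (p - o)
  have h2 := emod_toNat_lt he (p' - o)
  have h3 := h _ h1
  have h4 := h _ h2
  have h5 := h' _ h1 _ h2 (by omega) (by omega)
  rw [h5] at hp h3
  have h6 := Int.emod_nonneg (p - o) he'.ne'
  have h7 := Int.emod_nonneg (p' - o) he'.ne'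
  have h8 := Int.emod_add_mul_ediv (p - o) e
  have h9 := Int.emod_add_mul_ediv (p' - o) e
  rw [show (p - o) / e = (p' - o) / e by omega] at h8
  omega

theorem Runners.nonempty (hU : Runners e U o u) (hV : Runners e V o v) {x : ℕ} (hx : x < e)
    (h : v x < u x) : ∃ p, U p ∧ ¬ V p := by
  have he' : (e : ℤ) ≠ 0 := by omega
  refine ⟨o + (x + e * v x), ?_⟩
  rw [hU, hV, add_sub_cancel_left, Int.add_mul_ediv_left _ _ he', Int.add_mul_emod_self_left,
    Int.emod_eq_of_lt (by omega) (by omega), Int.ediv_eq_zero_of_lt (by omega) (by omega)]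
  simpa using h

end Runners

/-- A choice of charges for which the beads of the two components are as close as possible. -/
structure Frame (e : ℕ) (κ : Fin 2 → ZMod e) (lam : Fin 2 → ℕ → ℕ) (s : Fin 2 → ℤ) : Prop where
  charge : ∀ a, (s a : ZMod e) = κ a
  le : s 1 ≤ s 0 + e
  flush : Flush e (Bead (lam 0) (s 0)) (Bead (lam 1) (s 1))
  subsingleton : (∀ p p', Bead (lam 0) (s 0) p ∧ ¬ Bead (lam 1) (s 1) p →
      Bead (lam 0) (s 0) p' ∧ ¬ Bead (lam 1) (s 1) p' → p = p') ∨
    ∀ q q', Bead (lam 1) (s 1) q ∧ ¬ Bead (lam 0) (s 0) q →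
      Bead (lam 1) (s 1) q' ∧ ¬ Bead (lam 0) (s 0) q' → q = q'
  left : ∃ p, Bead (lam 0) (s 0) p ∧ ¬ Bead (lam 1) (s 1) p
  right : ∃ q, Bead (lam 1) (s 1) q ∧ ¬ Bead (lam 0) (s 0) q

theorem exists_frame {e : ℕ} (he : 0 < e) {κ : Fin 2 → ZMod e} {lam : Fin 2 → ℕ → ℕ}
    (hlam : IsBipartition lam) (hwt : wt e κ lam = 1) : ∃ s, Frame e κ lam s := by
  obtain ⟨s, o, d, u, v, hs, hs01, hde, hU, hV, hsum, x, hx, hx', hy⟩ := exists_runners he hlam hwt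
  rcases hx' with hx' | hx'
  · obtain ⟨t, ht0, ht1⟩ : ∃ t : Fin 2 → ℤ, t 0 = s 0 - e ∧ t 1 = s 1 := ⟨![s 0 - e, s 1], rfl, rfl⟩
    have hU' : Runners e (Bead (lam 0) (t 0)) o fun y => u y - 1 := by
      intro b
      have hb : Bead (lam 0) (t 0) b ↔ Bead (lam 0) (s 0) (b + e) := by
        unfold Bead
        exact exists_congr fun r => by rw [ht0]; omega
      have h1 := hU.sub_apply he (b + e + e)
      have he' : (e : ℤ) ≠ 0 := by exact_mod_cast he.ne'
      rw [add_sub_cancel_right, show b + e + e - o = b - o + e * 2 by ring,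
        Int.add_mul_ediv_left _ _ he', Int.add_mul_emod_self_left] at h1
      rw [hb, h1]
      beta_reduce
      omega
    rw [← ht1] at hV
    have hγ : ∀ y < e, u y - 1 - v y = -1 ∨ u y - 1 - v y = 0 ∨ (u y - 1 - v y = 1 ∧ y = x) := by
      intro y hye
      by_cases hyx : y = x
      · subst hyx; omega
      · have := hy y hye hyx
        omega
    have hneg : ∃ y < e, u y - 1 - v y < 0 := by
      by_contra hc
      push Not at hc
      have h1 := Finset.sum_nonneg fun y hy => hc y (Finset.mem_range.1 hy)
      have h2 : ∑ y ∈ Finset.range e, (u y - 1 - v y) = d - e := by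
        rw [← hsum]
        simp only [sub_right_comm _ (1 : ℤ)]
        rw [Finset.sum_sub_distrib _ fun _ => (1 : ℤ)]
        simp
      omega
    obtain ⟨y, hye, hy0⟩ := hneg
    refine ⟨t, ?_, by omega, hU'.flush hV he ?_, .inl (hU'.subsingleton hV he ?_ ?_),
      hU'.nonempty hV hx (by omega), hV.nonempty hU' hye (by omega)⟩
    · rw [Fin.forall_fin_two, ht0, ht1, ← hs, ← hs]
      simp
    · intro y hye
      have := hγ y hye
      rw [abs_le]
      omega
    · intro y hye
      have := hγ y hye
      omega
    · intro y hye z hze h1 h2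
      have := hγ y hye
      have := hγ z hze
      beta_reduce at h1 h2
      omega
  · have hγ : ∀ y < e, u y - v y = 1 ∨ u y - v y = 0 ∨ (u y - v y = -1 ∧ y = x) := by
      intro y hye
      by_cases hyx : y = x
      · subst hyx; omega
      · have := hy y hye hyx
        omega
    have hpos : ∃ y < e, v y < u y := by
      by_contra hc
      push Not at hc
      have h1 : ∑ y ∈ Finset.range e, (u y - v y) < 0 :=
        Finset.sum_neg' (fun y hy => by have := hc y (Finset.mem_range.1 hy); omega)
          ⟨x, Finset.mem_range.2 hx, by omega⟩
      omega
    obtain ⟨y, hye, hy0⟩ := hpos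
    refine ⟨s, hs, by omega, hU.flush hV he ?_, .inr (hV.subsingleton hU he ?_ ?_),
      hU.nonempty hV hye hy0, hV.nonempty hU hx (by omega)⟩
    · intro y hye
      have := hγ y hye
      rw [abs_le]
      omega
    · intro y hye
      have := hγ y hye
      omega
    · intro y hye z hze h1 h2
      have := hγ y hye
      have := hγ z hze
      omega

theorem exists_slide {C : (ℤ → Prop) → Prop} {ε : ℤ} (hε : ε ≠ 0)
    (hstep : ∀ W b, C W → W b → ¬ W (b + ε) →
      ∃ W', C W' ∧ ∀ z, W' z ↔ (W z ∧ z ≠ b) ∨ z = b + ε)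
    (n : ℕ) {W : ℤ → Prop} {p : ℤ} (hW : C W) (hp : W p) (hq : ¬ W (p + ε * (n + 1))) :
    ∃ W', C W' ∧ ∀ z, W' z ↔ (W z ∧ z ≠ p) ∨ z = p + ε * (n + 1) := by
  induction n generalizing W with
  | zero =>
    simp only [Nat.cast_zero, zero_add, mul_one] at hq ⊢
    exact hstep W p hW hp hq
  | succ n ih =>
    have h1 : p + ε * ((n + 1 : ℕ) + 1) = p + ε * (n + 1) + ε := by push_cast; ring
    rw [h1] at hq ⊢
    have h2 : p ≠ p + ε * (n + 1) := by
      have : ε * ((n : ℤ) + 1) ≠ 0 := mul_ne_zero hε (by omega)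
      omega
    have h3 : p ≠ p + ε * (n + 1) + ε := by
      rw [← h1]
      have : ε * (((n + 1 : ℕ) : ℤ) + 1) ≠ 0 := mul_ne_zero hε (by omega)
      omega
    have h4 : p + ε * (n + 1) ≠ p + ε * (n + 1) + ε := by omega
    have h5 := fun W => hstep W (p + ε * (n + 1))
    generalize p + ε * ((n : ℤ) + 1) + ε = q at *
    generalize p + ε * ((n : ℤ) + 1) = m at *
    by_cases hm : W m
    · obtain ⟨W₁, hW₁, h6⟩ := h5 W hW hm hq
      obtain ⟨W₂, hW₂, h7⟩ := ih hW₁ ((h6 p).2 (.inl ⟨hp, h2⟩)) fun h => by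
        rw [h6] at h
        tauto
      refine ⟨W₂, hW₂, fun z => ?_⟩
      rw [h7, h6]
      rcases eq_or_ne z m with rfl | h8
      · tauto
      · rcases eq_or_ne z q with rfl | h9 <;> tauto
    · obtain ⟨W₁, hW₁, h6⟩ := ih hW hp hm
      obtain ⟨W₂, hW₂, h7⟩ := h5 W₁ hW₁ ((h6 m).2 (.inr rfl)) fun h => by
        rw [h6] at h
        tauto
      refine ⟨W₂, hW₂, fun z => ?_⟩
      rw [h7, h6]
      rcases eq_or_ne z m with rfl | h8 <;> tauto

theorem IsPartition.exists_up {f : ℕ → ℕ} (hf : IsPartition f) {s b : ℤ} (h : Bead f s b)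
    (h' : ¬ Bead f s (b + 1)) : ∃ g, IsPartition g ∧
      ∀ z, Bead g s z ↔ (Bead f s z ∧ z ≠ b) ∨ z = b + 1 := by
  have hlam : IsBipartition fun _ => f := fun _ => hf
  obtain ⟨r, c, hrc, hb⟩ := exists_isAddable hlam (a := 0) h' (by rwa [add_sub_cancel_right])
  obtain ⟨h1, h2⟩ := (isAddable_iff hlam).1 hrc
  refine ⟨_, hf.increase h2, fun z => ?_⟩
  rw [bead_increase hf, show (f r : ℤ) - r + s = b + 1 by omega, add_sub_cancel_right]

theorem IsPartition.exists_down {f : ℕ → ℕ} (hf : IsPartition f) {s b : ℤ} (h : Bead f s b)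
    (h' : ¬ Bead f s (b - 1)) : ∃ g, IsPartition g ∧
      ∀ z, Bead g s z ↔ (Bead f s z ∧ z ≠ b) ∨ z = b - 1 := by
  have hlam : IsBipartition fun _ => f := fun _ => hf
  obtain ⟨r, c, hrc, hb⟩ := exists_isRemovable hlam (a := 0) h h'
  obtain ⟨h1, h2⟩ := (isRemovable_iff hlam).1 hrc
  refine ⟨_, hf.decrease h1 h2, fun z => ?_⟩
  rw [bead_decrease hf h1, hb]

theorem IsPartition.exists_slide {f : ℕ → ℕ} (hf : IsPartition f) {s p q : ℤ} (h : Bead f s p)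
    (h' : ¬ Bead f s q) : ∃ g, IsPartition g ∧
      ∀ z, Bead g s z ↔ (Bead f s z ∧ z ≠ p) ∨ z = q := by
  have key : ∀ ε : ℤ, ε = 1 ∨ ε = -1 → ∀ n : ℕ, q = p + ε * (n + 1) → ∃ g, IsPartition g ∧
      ∀ z, Bead g s z ↔ (Bead f s z ∧ z ≠ p) ∨ z = q := by
    intro ε hε n hn
    have hstep : ∀ (W : ℤ → Prop) (b : ℤ), (∃ g, IsPartition g ∧ ∀ z, W z ↔ Bead g s z) → W b →
        ¬ W (b + ε) → ∃ W' : ℤ → Prop, (∃ g, IsPartition g ∧ ∀ z, W' z ↔ Bead g s z) ∧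
          ∀ z, W' z ↔ (W z ∧ z ≠ b) ∨ z = b + ε := by
      rintro W b ⟨g, hg, hW⟩ hb hb'
      rw [hW] at hb hb'
      simp only [hW]
      rcases hε with rfl | rfl
      · obtain ⟨g', hg', h1⟩ := hg.exists_up hb hb'
        exact ⟨_, ⟨g', hg', fun z => Iff.rfl⟩, h1⟩
      · obtain ⟨g', hg', h1⟩ := hg.exists_down hb hb'
        exact ⟨_, ⟨g', hg', fun z => Iff.rfl⟩, h1⟩
    obtain ⟨W, ⟨g, hg, hW⟩, hW'⟩ := Wt3.exists_slide (by omega) hstep n (W := Bead f s) (p := p)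
      ⟨f, hf, fun _ => Iff.rfl⟩ h (hn ▸ h')
    exact ⟨g, hg, fun z => by rw [← hW, hW', hn]⟩
  rcases lt_trichotomy p q with hpq | rfl | hpq
  · exact key 1 (.inl rfl) (q - p - 1).toNat (by omega)
  · exact absurd h h'
  · exact key (-1) (.inr rfl) (p - q - 1).toNat (by omega)

theorem exists_swap {lam : Fin 2 → ℕ → ℕ} (hlam : IsBipartition lam) {s : Fin 2 → ℤ} {p q : ℤ}
    (hp : Bead (lam 0) (s 0) p ∧ ¬ Bead (lam 1) (s 1) p)
    (hq : Bead (lam 1) (s 1) q ∧ ¬ Bead (lam 0) (s 0) q) :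
    ∃ mu, IsBipartition mu ∧
      (∀ z, Bead (mu 0) (s 0) z ↔ (Bead (lam 0) (s 0) z ∧ z ≠ p) ∨ z = q) ∧
      ∀ z, Bead (mu 1) (s 1) z ↔ (Bead (lam 1) (s 1) z ∧ z ≠ q) ∨ z = p := by
  obtain ⟨f, hf, hf'⟩ := (hlam 0).exists_slide hp.1 hq.2
  obtain ⟨g, hg, hg'⟩ := (hlam 1).exists_slide hq.1 hp.2
  exact ⟨![f, g], by intro a; fin_cases a <;> assumption, hf', hg'⟩

theorem exists_windows {e : ℕ} (he : 0 < e) {lam mu : Fin 2 → ℕ → ℕ} (hlam : IsBipartition lam)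
    (hmu : IsBipartition mu) (s : Fin 2 → ℤ) : ∃ o L, (∀ a, Window (lam a) (s a) o (e * L)) ∧
      ∀ a, Window (mu a) (s a) o (e * L) := by
  obtain ⟨B, hB⟩ := exists_beads_bound hlam s
  obtain ⟨B', hB'⟩ := exists_beads_bound hmu s
  obtain ⟨K, hK⟩ : ∃ K, K = B + B' + (s 0).natAbs + (s 1).natAbs := ⟨_, rfl⟩
  have heK : (K : ℤ) + K ≤ (e * (K + K) : ℕ) := by
    have := Nat.le_mul_of_pos_left (K + K) he
    exact_mod_cast this
  have hsa : ∀ a, -(K : ℤ) ≤ s a ∧ s a ≤ -(K : ℤ) + (e * (K + K) : ℕ) := by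
    rw [Fin.forall_fin_two]
    omega
  refine ⟨-K, K + K, fun a => ⟨?_, ?_, (hsa a).1, (hsa a).2⟩,
    fun a => ⟨?_, ?_, (hsa a).1, (hsa a).2⟩⟩
  · exact (hB K (by omega) a).1
  · exact fun b hb => (hB K (by omega) a).2 b (by omega)
  · exact (hB' K (by omega) a).1
  · exact fun b hb => (hB' K (by omega) a).2 b (by omega)

theorem nonneg_of_top {G : ℤ → ℤ} {M : ℤ} (h0 : ∀ y, M ≤ y → G y = 0) {y : ℤ}
    (h : ∀ z, y ≤ z → G (z + 1) ≤ G z) : 0 ≤ G y := by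
  have key : ∀ n : ℕ, G (y + n) ≤ G y := by
    intro n
    induction n with
    | zero => simp
    | succ n ih =>
      have := h (y + n) (by omega)
      push_cast
      rw [← add_assoc]
      omega
  have := key (M - y).toNat
  rwa [h0 _ (by omega)] at this

theorem nonneg_of_bottom {G : ℤ → ℤ} {M : ℤ} (h0 : ∀ y ≤ M, G y = 0) {y : ℤ}
    (h : ∀ z < y, G z ≤ G (z + 1)) : 0 ≤ G y := by
  have := nonneg_of_top (G := fun z => G (-z)) (M := -M) (y := -y)
    (fun z hz => h0 _ (by omega)) fun z hz => by
      have := h (-(z + 1)) (by omega)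
      rwa [show -(z + 1) + 1 = -z by ring] at this
  rwa [neg_neg] at this

theorem le_of_beads {f g : ℕ → ℕ} {s o : ℤ} {T : ℕ} (hf : IsPartition f) (hg : IsPartition g)
    (hfW : Window f s o T) (hgW : Window g s o T) {m : ℤ}
    (h : ∀ z, m ≤ z → Bead g s z → Bead f s z) (h' : ∀ z < m, Bead f s z → Bead g s z) (j : ℕ) :
    g j ≤ f j := by
  have hstep : ∀ z, (diag f s z - diag g s z) - (diag f s (z + 1) - diag g s (z + 1)) =
      beadInd f s z - beadInd g s z := fun z => by
    have h1 := diag_sub_eq hf s z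
    have h2 := diag_sub_eq hg s z
    linarith
  have hle : ∀ y, 0 ≤ diag f s y - diag g s y := by
    intro y
    rcases le_or_gt m y with hm | hm
    · refine nonneg_of_top (G := fun z => diag f s z - diag g s z) (M := o + T) (fun z hz => ?_)
        fun z hz => ?_
      · rw [hfW.diag_of_ge hf hz, hgW.diag_of_ge hg hz, sub_zero]
      · have h1 := hstep z
        have h2 := h z (hm.trans hz)
        unfold beadInd at h1
        split_ifs at h1 <;> first | omega | tauto
    · refine nonneg_of_bottom (G := fun z => diag f s z - diag g s z) (M := o) (fun z hz => ?_)
        fun z hz => ?_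
      · rw [hfW.diag_of_le hf hz, hgW.diag_of_le hg hz, sub_zero]
      · have h1 := hstep z
        have h2 := h' z (hz.trans hm)
        unfold beadInd at h1
        split_ifs at h1 <;> first | omega | tauto
  have h1 := hle ((g j : ℤ) - j - 1 + s)
  unfold diag at h1
  have h2 : j < beadsFrom f s ((g j : ℤ) - j - 1 + s) := by
    have := (lt_beadsFrom hg (r := j)).2 (le_refl ((g j : ℤ) - j - 1 + s))
    omega
  have := (lt_beadsFrom hf).1 h2
  omega

section SameBeads

variable {lam mu : Fin 2 → ℕ → ℕ} {s : Fin 2 → ℤ} {o : ℤ} {T : ℕ}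

theorem diag_add_eq (hlam : IsBipartition lam) (hmu : IsBipartition mu)
    (hW : ∀ a, Window (lam a) (s a) o T) (hW' : ∀ a, Window (mu a) (s a) o T)
    (h : ∀ b, beadInd (lam 0) (s 0) b + beadInd (lam 1) (s 1) b =
      beadInd (mu 0) (s 0) b + beadInd (mu 1) (s 1) b) (y : ℤ) :
    diag (lam 0) (s 0) y + diag (lam 1) (s 1) y = diag (mu 0) (s 0) y + diag (mu 1) (s 1) y := by
  have hstep : ∀ z, (diag (lam 0) (s 0) z + diag (lam 1) (s 1) z) -
      (diag (mu 0) (s 0) z + diag (mu 1) (s 1) z) =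
      (diag (lam 0) (s 0) (z + 1) + diag (lam 1) (s 1) (z + 1)) -
      (diag (mu 0) (s 0) (z + 1) + diag (mu 1) (s 1) (z + 1)) := fun z => by
    have h1 := diag_sub_eq (hlam 0) (s 0) z
    have h2 := diag_sub_eq (hlam 1) (s 1) z
    have h3 := diag_sub_eq (hmu 0) (s 0) z
    have h4 := diag_sub_eq (hmu 1) (s 1) z
    linarith [h z]
  have htop : ∀ z, o + T ≤ z → (diag (lam 0) (s 0) z + diag (lam 1) (s 1) z) -
      (diag (mu 0) (s 0) z + diag (mu 1) (s 1) z) = 0 := fun z hz => by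
    rw [(hW 0).diag_of_ge (hlam 0) hz, (hW 1).diag_of_ge (hlam 1) hz,
      (hW' 0).diag_of_ge (hmu 0) hz, (hW' 1).diag_of_ge (hmu 1) hz, sub_self]
  have h1 := nonneg_of_top htop (y := y) fun z _ => (hstep z).ge
  have h2 := nonneg_of_top (G := fun z => -((diag (lam 0) (s 0) z + diag (lam 1) (s 1) z) -
    (diag (mu 0) (s 0) z + diag (mu 1) (s 1) z))) (M := o + T) (y := y)
    (fun z hz => by rw [htop z hz, neg_zero]) fun z _ => by rw [hstep z]
  omega

theorem psize_add_eq (hlam : IsBipartition lam) (hmu : IsBipartition mu)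
    (hW : ∀ a, Window (lam a) (s a) o T) (hW' : ∀ a, Window (mu a) (s a) o T)
    (h : ∀ b, beadInd (lam 0) (s 0) b + beadInd (lam 1) (s 1) b =
      beadInd (mu 0) (s 0) b + beadInd (mu 1) (s 1) b) :
    psize (lam 0) + psize (lam 1) = psize (mu 0) + psize (mu 1) := by
  have key : ∀ {f : ℕ → ℕ} {s : ℤ}, IsPartition f → Window f s o T →
      (psize f : ℤ) = ∑ t ∈ Finset.range T, diag f s (o + t) := fun hf hW => by
    simpa [psize] using hW.ncard_nodes hf fun _ => True
  zify
  rw [key (hlam 0) (hW 0), key (hlam 1) (hW 1), key (hmu 0) (hW' 0), key (hmu 1) (hW' 1),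
    ← Finset.sum_add_distrib, ← Finset.sum_add_distrib]
  exact Finset.sum_congr rfl fun t _ => diag_add_eq hlam hmu hW hW' h _

theorem cnt_congr {e : ℕ} (he : 0 < e) {κ : Fin 2 → ZMod e} (hs : ∀ a, (s a : ZMod e) = κ a)
    (hlam : IsBipartition lam) (hmu : IsBipartition mu)
    (h : ∀ b, beadInd (lam 0) (s 0) b + beadInd (lam 1) (s 1) b =
      beadInd (mu 0) (s 0) b + beadInd (mu 1) (s 1) b) (i : ZMod e) :
    cnt e κ lam i = cnt e κ mu i := by
  have : NeZero e := ⟨he.ne'⟩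
  obtain ⟨o, L, hW, hW'⟩ := exists_windows he hlam hmu s
  have h1 : i = (o : ZMod e) + ((i - o).val : ℕ) := by rw [ZMod.natCast_zmod_val]; ring
  zify
  rw [h1, cnt_eq_sum he hs hlam hW (ZMod.val_lt _), cnt_eq_sum he hs hmu hW' (ZMod.val_lt _)]
  exact Finset.sum_congr rfl fun l _ => diag_add_eq hlam hmu hW hW' h _

end SameBeads

theorem psize_eq_psum {f : ℕ → ℕ} {N : ℕ} (hN : ∀ r, N ≤ r → f r = 0) : psize f = psum f N := by
  have h : psize f = ((Finset.range N).sigma fun j => Finset.range (f j)).card := by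
    rw [psize, ← Set.ncard_coe_finset]
    refine Set.ncard_congr (fun p _ => ⟨p.1, p.2⟩) ?_ ?_ ?_
    · rintro ⟨r, c⟩ h
      have h1 := hN r
      simp only [Set.mem_ofPred_eq] at h
      simp only [Finset.coe_sigma, Set.mem_sigma_iff, Finset.coe_range, Set.mem_Iio]
      omega
    · rintro ⟨r, c⟩ ⟨r', c'⟩ - - h
      simpa using h
    · rintro ⟨r, c⟩ h
      simp only [Finset.coe_sigma, Set.mem_sigma_iff, Finset.coe_range, Set.mem_Iio] at h
      exact ⟨(r, c), h.2, rfl⟩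
  rw [h, Finset.card_sigma]
  simp [psum]

theorem dominates_of_le {lam mu : Fin 2 → ℕ → ℕ} (hlam : IsBipartition lam) (hmu : IsBipartition mu)
    (hsize : psize (lam 0) + psize (lam 1) = psize (mu 0) + psize (mu 1))
    (h0 : ∀ j, mu 0 j ≤ lam 0 j) (h1 : ∀ j, lam 1 j ≤ mu 1 j) : Dominates lam mu := by
  refine fun r => ⟨Finset.sum_le_sum fun j _ => h0 j, ?_⟩
  obtain ⟨N, hN⟩ := (hlam 1).2
  obtain ⟨N', hN'⟩ := (hmu 1).2
  have h2 := psize_eq_psum (N := N + N' + r) fun k hk => hN k (by omega)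
  have h3 := psize_eq_psum (N := N + N' + r) fun k hk => hN' k (by omega)
  have h4 : psum (mu 1) r + psum (lam 1) (N + N' + r) ≤
      psum (mu 1) (N + N' + r) + psum (lam 1) r := by
    unfold psum
    simp only [Finset.range_eq_Ico]
    rw [← Finset.sum_Ico_consecutive (mu 1) (Nat.zero_le r)
      (show r ≤ N + N' + r by omega), ← Finset.sum_Ico_consecutive (lam 1) (Nat.zero_le r)
      (show r ≤ N + N' + r by omega)]
    have := Finset.sum_le_sum fun j (_ : j ∈ Finset.Ico r (N + N' + r)) => h1 j
    omega
  omega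

theorem not_dominates_of_le {lam mu : Fin 2 → ℕ → ℕ} (h : ∀ j, lam 0 j ≤ mu 0 j)
    (hne : lam 0 ≠ mu 0) : ¬ Dominates lam mu := by
  intro hd
  obtain ⟨j, hj⟩ := Function.ne_iff.1 hne
  have h1 := (hd (j + 1)).1
  have h2 : psum (lam 0) (j + 1) < psum (mu 0) (j + 1) :=
    Finset.sum_lt_sum (fun k _ => h k) ⟨j, Finset.self_mem_range_succ j, (h j).lt_of_ne hj⟩
  omega

theorem exists_not_dominates {e : ℕ} (he : 0 < e) {κ : Fin 2 → ZMod e} {lam : Fin 2 → ℕ → ℕ}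
    (hlam : IsBipartition lam) {s : Fin 2 → ℤ} (hs : ∀ a, (s a : ZMod e) = κ a) {p q : ℤ}
    (hp : Bead (lam 0) (s 0) p ∧ ¬ Bead (lam 1) (s 1) p)
    (hq : Bead (lam 1) (s 1) q ∧ ¬ Bead (lam 0) (s 0) q) (hpq : p < q) :
    ∃ mu, IsBipartition mu ∧ (∀ i, cnt e κ mu i = cnt e κ lam i) ∧ ¬ Dominates lam mu := by
  obtain ⟨mu, hmu, h0, h1⟩ := exists_swap hlam hp hq
  obtain ⟨o, L, hW, hW'⟩ := exists_windows he hlam hmu s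
  refine ⟨mu, hmu, fun i => (cnt_congr he hs hlam hmu (fun b => ?_) i).symm,
    not_dominates_of_le (le_of_beads (hmu 0) (hlam 0) (hW' 0) (hW 0) (m := p + 1) ?_ ?_) ?_⟩
  · have e0 := h0 b
    have e1 := h1 b
    have hpq' := hpq.ne
    unfold beadInd
    rcases eq_or_ne b p with rfl | hbp
    · split_ifs <;> first | rfl | tauto
    · rcases eq_or_ne b q with rfl | hbq <;> split_ifs <;> first | rfl | tauto
  · intro z hz hb
    exact (h0 z).2 (.inl ⟨hb, by omega⟩)
  · intro z hz hb
    rcases (h0 z).1 hb with h | h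
    · exact h.1
    · omega
  · intro heq
    refine hq.2 ?_
    rw [heq]
    exact (h0 q).2 (.inr rfl)

/-- On every runner of a flush pair there is at most one position that does not carry either beads
on both sides or no bead at all. -/
theorem Flush.exists_threshold {e : ℕ} (he : 0 < e) {U V : ℤ → Prop} (h : Flush e U V) {o : ℤ}
    {T : ℕ} (hT : ∀ b, o + T ≤ b → ¬ U b ∧ ¬ V b) (x : ℕ) : ∃ m : ℕ, ∀ l : ℕ,
      (l < m → U (o + (x + e * l : ℕ)) ∧ V (o + (x + e * l : ℕ))) ∧
      (m < l → ¬ U (o + (x + e * l : ℕ)) ∧ ¬ V (o + (x + e * l : ℕ))) := by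
  classical
  have hex : ∃ l : ℕ, ¬ (U (o + (x + e * l : ℕ)) ∧ V (o + (x + e * l : ℕ))) := by
    refine ⟨T, fun hc => (hT _ ?_).1 hc.1⟩
    have := Nat.le_mul_of_pos_left T he
    push_cast
    zify at this
    omega
  refine ⟨Nat.find hex, fun l => ⟨fun hl => not_not.1 (Nat.find_min hex hl), fun hl => ?_⟩⟩
  by_contra hc
  refine Nat.find_spec hex (h.of_dvd he (b := o + (x + e * l : ℕ)) (by tauto) ?_ ?_)
  · have := Nat.mul_lt_mul_of_pos_left hl he
    omega
  · refine ⟨(l : ℤ) - Nat.find hex, ?_⟩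
    push_cast
    ring

theorem eq_zero_of_weighted {e L : ℕ} {h : ℕ → ℕ → ℤ} {m : ℕ → ℕ}
    (hneg : ∀ x l, l < m x → h x l ≤ 0) (hpos : ∀ x l, m x < l → 0 ≤ h x l)
    (h0 : ∀ x < e, ∑ l ∈ Finset.range L, h x l = 0)
    (h1 : ∑ x ∈ Finset.range e, ∑ l ∈ Finset.range L, h x l * (l + 1) = 0)
    {x : ℕ} (hx : x < e) {l : ℕ} (hl : l < L) : h x l = 0 := by
  have h2 : ∑ x ∈ Finset.range e, ∑ l ∈ Finset.range L, h x l * ((l : ℤ) - m x) = 0 := by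
    rw [← h1]
    refine Finset.sum_congr rfl fun y hy => ?_
    rw [← sub_eq_zero, ← Finset.sum_sub_distrib]
    calc _ = ∑ l ∈ Finset.range L, h y l * (-(m y : ℤ) - 1) :=
          Finset.sum_congr rfl fun l _ => by ring
      _ = 0 := by rw [← Finset.sum_mul, h0 y (Finset.mem_range.1 hy), zero_mul]
  have hnn : ∀ x l, 0 ≤ h x l * ((l : ℤ) - m x) := by
    intro x l
    rcases lt_trichotomy l (m x) with h3 | h3 | h3
    · exact mul_nonneg_of_nonpos_of_nonpos (hneg x l h3) (by omega)
    · simp [h3]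
    · exact mul_nonneg (hpos x l h3) (by omega)
  have h3 := (Finset.sum_eq_zero_iff_of_nonneg fun x _ => Finset.sum_nonneg fun l _ => hnn x l).1 h2
    x (Finset.mem_range.2 hx)
  have h4 : ∀ k < L, k ≠ m x → h x k = 0 := by
    intro k hk hkm
    have h5 := (Finset.sum_eq_zero_iff_of_nonneg fun l _ => hnn x l).1 h3 k (Finset.mem_range.2 hk)
    rcases mul_eq_zero.1 h5 with h6 | h6
    · exact h6
    · omega
  by_cases hlm : l = m x
  · rw [← h0 x hx]
    exact (Finset.sum_eq_single_of_mem l (Finset.mem_range.2 hl) fun k hk hkl =>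
      h4 k (Finset.mem_range.1 hk) (by omega)).symm
  · exact h4 l hl hlm

theorem beadInd_add_eq {e : ℕ} (he : 0 < e) {κ : Fin 2 → ZMod e} {s : Fin 2 → ℤ}
    (hs : ∀ a, (s a : ZMod e) = κ a) {lam mu : Fin 2 → ℕ → ℕ} (hlam : IsBipartition lam)
    (hmu : IsBipartition mu) {o : ℤ} {L : ℕ} (hW : ∀ a, Window (lam a) (s a) o (e * L))
    (hW' : ∀ a, Window (mu a) (s a) o (e * L))
    (hflush : Flush e (Bead (lam 0) (s 0)) (Bead (lam 1) (s 1)))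
    (hcnt : ∀ i, cnt e κ mu i = cnt e κ lam i) (b : ℤ) :
    beadInd (lam 0) (s 0) b + beadInd (lam 1) (s 1) b =
      beadInd (mu 0) (s 0) b + beadInd (mu 1) (s 1) b := by
  choose m hm using hflush.exists_threshold he (o := o) (T := e * L)
    fun b hb => ⟨(hW 0).above b hb, (hW 1).above b hb⟩
  have hle : ∀ f s b, 0 ≤ beadInd f s b ∧ beadInd f s b ≤ 1 := fun f s b => by
    rcases beadInd_eq f s b with h | h <;> omega
  have key := fun x hx l hl => eq_zero_of_weighted (e := e) (L := L) (m := m) (x := x) (l := l)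
    (h := fun x l => (beadInd (mu 0) (s 0) (o + (x + e * l : ℕ)) +
      beadInd (mu 1) (s 1) (o + (x + e * l : ℕ))) - (beadInd (lam 0) (s 0) (o + (x + e * l : ℕ)) +
      beadInd (lam 1) (s 1) (o + (x + e * l : ℕ))))
    (fun x l hl => by
      obtain ⟨h1, h2⟩ := (hm x l).1 hl
      have := hle (mu 0) (s 0) (o + (x + e * l : ℕ))
      have := hle (mu 1) (s 1) (o + (x + e * l : ℕ))
      rw [beadInd_eq_one.2 h1, beadInd_eq_one.2 h2]
      omega)
    (fun x l hl => by
      obtain ⟨h1, h2⟩ := (hm x l).2 hl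
      have := hle (mu 0) (s 0) (o + (x + e * l : ℕ))
      have := hle (mu 1) (s 1) (o + (x + e * l : ℕ))
      have h3 : ∀ f s b, ¬ Bead f s b → beadInd f s b = 0 := fun f s b h => if_neg h
      rw [h3 _ _ _ h1, h3 _ _ _ h2]
      omega)
    (fun x hx => by
      have h1 := cnt_sub_cnt he hs hlam hW hx
      have h2 := cnt_sub_cnt he hs hmu hW' hx
      rw [hcnt, hcnt, h1, ← sub_eq_zero, ← Finset.sum_sub_distrib] at h2
      rw [← neg_eq_zero, ← Finset.sum_neg_distrib, ← h2]
      exact Finset.sum_congr rfl fun l _ => by ring)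
    (by
      have h1 := cnt_eq_weighted he hs hlam hW
      have h2 := cnt_eq_weighted he hs hmu hW'
      rw [hcnt, h1, ← sub_eq_zero, ← Finset.sum_sub_distrib] at h2
      rw [← neg_eq_zero, ← Finset.sum_neg_distrib, ← h2]
      refine Finset.sum_congr rfl fun x _ => ?_
      rw [← Finset.sum_neg_distrib, ← Finset.sum_sub_distrib]
      exact Finset.sum_congr rfl fun l _ => by ring) hx hl
  rcases lt_or_ge b o with hb | hb
  · rw [beadInd_eq_one.2 ((hW 0).below b hb), beadInd_eq_one.2 ((hW 1).below b hb),
      beadInd_eq_one.2 ((hW' 0).below b hb), beadInd_eq_one.2 ((hW' 1).below b hb)]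
  rcases lt_or_ge b (o + (e * L : ℕ)) with hb' | hb'
  · obtain ⟨t, ht⟩ := Int.eq_ofNat_of_zero_le (sub_nonneg.2 hb)
    have h1 := key (t % e) (Nat.mod_lt _ he) (t / e) (Nat.div_lt_of_lt_mul (by omega))
    rw [Nat.mod_add_div, show o + (t : ℤ) = b by omega] at h1
    omega
  · have h3 : ∀ f s b, ¬ Bead f s b → beadInd f s b = 0 := fun f s b h => if_neg h
    rw [h3 _ _ _ ((hW 0).above b hb'), h3 _ _ _ ((hW 1).above b hb'),
      h3 _ _ _ ((hW' 0).above b hb'), h3 _ _ _ ((hW' 1).above b hb')]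

theorem Frame.dominates {e : ℕ} (he : 0 < e) {κ : Fin 2 → ZMod e} {s : Fin 2 → ℤ}
    {lam mu : Fin 2 → ℕ → ℕ} (hF : Frame e κ lam s) (hlam : IsBipartition lam)
    (hlt : ∀ p q, Bead (lam 0) (s 0) p ∧ ¬ Bead (lam 1) (s 1) p →
      Bead (lam 1) (s 1) q ∧ ¬ Bead (lam 0) (s 0) q → q < p)
    (hmu : IsBipartition mu) (hcnt : ∀ i, cnt e κ mu i = cnt e κ lam i) : Dominates lam mu := by
  obtain ⟨o, L, hW, hW'⟩ := exists_windows he hlam hmu s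
  have hsum := beadInd_add_eq he hF.charge hlam hmu hW hW' hF.flush hcnt
  obtain ⟨m, hmP, hmQ⟩ : ∃ m, (∀ p, Bead (lam 0) (s 0) p ∧ ¬ Bead (lam 1) (s 1) p → m ≤ p) ∧
      ∀ q, Bead (lam 1) (s 1) q ∧ ¬ Bead (lam 0) (s 0) q → q < m := by
    rcases hF.subsingleton with h | h
    · obtain ⟨p, hp⟩ := hF.left
      exact ⟨p, fun p' hp' => (h p p' hp hp').le, fun q hq => hlt p q hp hq⟩
    · obtain ⟨q, hq⟩ := hF.right
      refine ⟨q + 1, fun p hp => hlt p q hp hq, fun q' hq' => ?_⟩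
      rw [h q q' hq hq']
      omega
  have hsize := psize_add_eq hlam hmu hW hW' hsum
  simp only [beadInd] at hsum
  have h1 : ∀ z, m ≤ z → (Bead (mu 0) (s 0) z → Bead (lam 0) (s 0) z) ∧
      (Bead (lam 1) (s 1) z → Bead (mu 1) (s 1) z) := by
    intro z hz
    have h2 := hsum z
    have h3 : ¬ (Bead (lam 1) (s 1) z ∧ ¬ Bead (lam 0) (s 0) z) := fun h => by
      have := hmQ z h
      omega
    split_ifs at h2 <;> first | omega | tauto
  have h1' : ∀ z < m, (Bead (lam 0) (s 0) z → Bead (mu 0) (s 0) z) ∧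
      (Bead (mu 1) (s 1) z → Bead (lam 1) (s 1) z) := by
    intro z hz
    have h2 := hsum z
    have h3 : ¬ (Bead (lam 0) (s 0) z ∧ ¬ Bead (lam 1) (s 1) z) := fun h => by
      have := hmP z h
      omega
    split_ifs at h2 <;> first | omega | tauto
  exact dominates_of_le hlam hmu hsize
    (le_of_beads (hlam 0) (hmu 0) (hW 0) (hW' 0) (fun z hz => (h1 z hz).1) fun z hz => (h1' z hz).1)
    (le_of_beads (hmu 1) (hlam 1) (hW' 1) (hW 1) (fun z hz => (h1 z hz).2) fun z hz => (h1' z hz).2)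

/-! The statement. -/

theorem stmt19 (e : ℕ) (he : 2 ≤ e) (κ : Fin 2 → ZMod e) (lam : Fin 2 → ℕ → ℕ)
    (hlam : IsBipartition lam) (hwt : wt e κ lam = 1) :
    IsRestricted e κ lam ↔
      ∃ mu : Fin 2 → ℕ → ℕ, IsBipartition mu ∧
        (∀ i : ZMod e, cnt e κ mu i = cnt e κ lam i) ∧ ¬ Dominates lam mu := by
  have he' : 0 < e := by omega
  obtain ⟨s, hF⟩ := exists_frame he' hlam hwt
  constructor
  · intro hr
    by_contra hc
    obtain ⟨p₀, hp₀⟩ := hF.left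
    obtain ⟨q₀, hq₀⟩ := hF.right
    refine not_isRestricted he hF.charge hF.le hlam hF.flush hp₀ hq₀.symm
      (fun p q hp hp' hq hq' => ?_) hr
    by_contra hle
    refine hc (exists_not_dominates he' hlam hF.charge ⟨hp, hp'⟩ ⟨hq', hq⟩
      ((not_lt.1 hle).lt_of_ne ?_))
    rintro rfl
    exact hq hp
  · rintro ⟨mu, hmu, hcnt, hnd⟩
    refine Reducible.isRestricted he hF.charge hlam ⟨hF.flush, hF.subsingleton, fun _ _ _ _ => ?_⟩
    by_contra hc
    push Not at hc
    refine hnd (hF.dominates he' hlam (fun p q hp hq => (hc p q hp hq).lt_of_ne ?_) hmu hcnt)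
    rintro rfl
    exact hq.2 hp.1

end Wt3
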